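/- Let q be a prime power. Then (q,5) ∈ B(3,2), except possibly for q ∈ {2, 3, 4, 5, 7, 9, 11, 16}. -/

import Mathlib

open Polynomial

noncomputable section

/-- An element of a finite field is *primitive* if it generates the multiplicative group. -/
def IsPrimitiveElem {L : Type} [Field L] [Fintype L] (α : L) : Prop :=
  orderOf α = Fintype.card L - 1

/-- `β` is a *normal element* of `L` over `K`, where `n = [L : K]`:
the conjugates `β, β^q, …, β^(q^(n-1))` form a `K`-basis of `L`. -/
def IsNormalElem (K : Type) {L : Type} [Field K] [Fintype K] [Field L] [Algebra K L]
    (n : ℕ) (β : L) : Prop :=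
  LinearIndependent K (fun i : Fin n => β ^ Fintype.card K ^ (i : ℕ)) ∧
    Submodule.span K (Set.range fun i : Fin n => β ^ Fintype.card K ^ (i : ℕ)) = ⊤

/-- The set `Υ_Q(m₁, m₂)` of rational functions over the field `F` with `Q` elements. -/
def Upsilon (F : Type) [Field F] [Fintype F] (m₁ m₂ : ℕ) : Set (RatFunc F) :=
  {f | ∃ f₁ f₂ : F[X], f₂ ≠ 0 ∧
      f = algebraMap F[X] (RatFunc F) f₁ / algebraMap F[X] (RatFunc F) f₂ ∧
      f₁.natDegree ≤ m₁ ∧ f₂.natDegree ≤ m₂ ∧ IsCoprime f₁ f₂ ∧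
      ∃ (k : ℕ) (g : F[X]), 0 < k ∧ g.Monic ∧ Irreducible g ∧ g ≠ X ∧
        Nat.gcd k (Fintype.card F - 1) = 1 ∧
        g ^ k ∣ f₁ * f₂ ∧ ¬ g ^ (k + 1) ∣ f₁ * f₂}

/-- Evaluation of a rational function at a point of the same field (`0` if undefined). -/
def ratEval {F : Type} [Field F] (f : RatFunc F) (α : F) : F :=
  f.eval (RingHom.id F) α

/-- `α` is `s`-free. -/
def IsFree {F : Type} [Field F] (s : ℕ) (α : F) : Prop :=
  α ≠ 0 ∧ ∀ d : ℕ, d ∣ s → d ≠ 1 → ¬ ∃ β : F, β ^ d = α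

/-- The `F_q[x]`-module action `h ∘ β = ∑ hᵢ β^(qⁱ)` on `L`. -/
def polyAct {K L : Type} [Field K] [Fintype K] [Field L] [Algebra K L]
    (h : K[X]) (β : L) : L :=
  h.sum fun i a => algebraMap K L a * β ^ Fintype.card K ^ i

/-- `α` is `g`-free with respect to the `F_q[x]`-module structure of `L`. -/
def IsPolyFree (K : Type) {L : Type} [Field K] [Fintype K] [Field L] [Algebra K L]
    (g : K[X]) (α : L) : Prop :=
  ∀ h : K[X], h.Monic → h ∣ g → (∃ lam : L, α = polyAct h lam) → h = 1

/-- `N_f(e₁, e₂, g)`: the number of `α ∈ L` such that `α` is `e₁`-free,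
`f(α)` is `e₂`-free and `α` is `g`-free. -/
def NElems (K : Type) {L : Type} [Field K] [Fintype K] [Field L] [Fintype L] [Algebra K L]
    (f : RatFunc L) (e₁ e₂ : ℕ) (g : K[X]) : ℕ :=
  Nat.card {α : L | IsFree e₁ α ∧ IsFree e₂ (ratEval f α) ∧ IsPolyFree K g α}

/-- `W(ℓ)`: the number of squarefree divisors of `ℓ`. -/
def Wnat (ℓ : ℕ) : ℕ := (ℓ.divisors.filter Squarefree).card

/-- `W_q(g)`: the number of monic squarefree divisors of `g` in `F_q[x]`. -/
def Wpoly {K : Type} [Field K] (g : K[X]) : ℕ :=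
  Nat.card {h : K[X] // h.Monic ∧ Squarefree h ∧ h ∣ g}

/-- `Φ(g) = |(F_q[x]/(g))ˣ|`. -/
def PhiPoly {K : Type} [Field K] (g : K[X]) : ℕ :=
  Nat.card ((K[X] ⧸ Ideal.span ({g} : Set K[X]))ˣ)

/-- `(q, n) ∈ B(m₁, m₂)`: for every `f ∈ Υ_{qⁿ}(m₁, m₂)` there is a primitive element
`α` of `F_{qⁿ}`, normal over `F_q`, with `f(α)` also primitive. -/
def memB (m₁ m₂ q n : ℕ) : Prop :=
  ∀ (K L : Type) [Field K] [Field L] [Fintype K] [Fintype L] [Algebra K L],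
    Fintype.card K = q → Fintype.card L = q ^ n →
    ∀ f ∈ Upsilon L m₁ m₂,
      ∃ α : L, IsPrimitiveElem α ∧ IsNormalElem K n α ∧ IsPrimitiveElem (ratEval f α)

/-- `𝔑(q, n)`: the number of primitive elements of `F_{qⁿ}` that are normal over `F_q`. -/
def NNum (K L : Type) [Field K] [Fintype K] [Field L] [Fintype L] [Algebra K L] (n : ℕ) : ℕ :=
  Nat.card {α : L | IsPrimitiveElem α ∧ IsNormalElem K n α}

end

section

open Polynomial

/-- All `X`-degrees of the coefficients of a bivariate polynomial are bounded by `N`. -/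
def XDeg {K : Type} [Field K] (N : ℕ) (p : K[X][X]) : Prop := ∀ i, (p.coeff i).natDegree ≤ N

namespace XDeg
variable {K : Type} [Field K]

lemma mono {N M : ℕ} {p : K[X][X]} (h : XDeg N p) (hNM : N ≤ M) : XDeg M p :=
  fun i => (h i).trans hNM

lemma zero (N : ℕ) : XDeg N (0 : K[X][X]) := fun i => by simp

lemma one (N : ℕ) : XDeg N (1 : K[X][X]) := fun i => by
  rw [coeff_one]; split_ifs <;> simp

lemma neg {N : ℕ} {p : K[X][X]} (h : XDeg N p) : XDeg N (-p) := fun i => by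
  rw [coeff_neg, natDegree_neg]; exact h i

lemma sum {ι : Type} (s : Finset ι) (f : ι → K[X][X]) {N : ℕ} (h : ∀ i ∈ s, XDeg N (f i)) :
    XDeg N (∑ i ∈ s, f i) := fun j => by
  rw [finsetSum_coeff]
  exact natDegree_sum_le_of_forall_le _ _ (fun i hi => h i hi j)

lemma mul {N M : ℕ} {p q : K[X][X]} (hp : XDeg N p) (hq : XDeg M q) : XDeg (N + M) (p * q) :=
  fun i => by
    rw [coeff_mul]
    refine natDegree_sum_le_of_forall_le _ _ (fun x _ => ?_)
    exact natDegree_mul_le.trans (add_le_add (hp _) (hq _))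

lemma prod {ι : Type} (s : Finset ι) (f : ι → K[X][X]) {N : ℕ} (h : ∀ i ∈ s, XDeg N (f i)) :
    XDeg (s.card * N) (∏ i ∈ s, f i) := by
  classical
  induction s using Finset.induction_on with
  | empty => simpa using one _
  | insert a s ha ih =>
    rw [Finset.prod_insert ha, Finset.card_insert_of_notMem ha]
    have := (h a (Finset.mem_insert_self _ _)).mul
      (ih (fun i hi => h i (Finset.mem_insert_of_mem hi)))
    exact this.mono (by ring_nf; rfl)

lemma det {n : ℕ} (A : Matrix (Fin n) (Fin n) K[X][X]) {N : ℕ} (h : ∀ i j, XDeg N (A i j)) :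
    XDeg (n * N) A.det := by
  rw [Matrix.det_apply]
  refine sum _ _ (fun σ _ => ?_)
  have h1 : XDeg (n * N) (∏ i, A (σ i) i) := by
    have := prod Finset.univ (fun i => A (σ i) i) (fun i _ => h (σ i) i)
    simpa using this
  rcases Int.units_eq_one_or (Equiv.Perm.sign σ) with hs | hs
  · rw [hs, one_smul]; exact h1
  · rw [hs]; simpa [Units.smul_def] using h1.neg

end XDeg

lemma eval_X_pow_inj {K : Type} [Field K] (r : ℕ) (p : K[X][X])
    (hp : ∀ i, (p.coeff i).natDegree < r) (h : p.eval (X ^ r) = 0) : p = 0 := by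
  have hr : 0 < r := lt_of_le_of_lt (Nat.zero_le _) (hp 0)
  ext i l
  rw [coeff_zero, coeff_zero]
  by_cases hl : l < r
  · have h2 : (p.eval (X ^ r)).coeff (l + r * i) = (p.coeff i).coeff l := by
      rw [eval_eq_sum_range, finsetSum_coeff]
      have : ∀ j ∈ Finset.range (p.natDegree + 1),
          (p.coeff j * (X ^ r) ^ j).coeff (l + r * i) = if j = i then (p.coeff i).coeff l else 0 := by
        intro j _
        rw [← pow_mul, coeff_mul_X_pow']
        by_cases hji : j = i
        · subst hji; simp
        · rw [if_neg hji]
          rcases Nat.lt_or_ge j i with h3 | h3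
          · have h4 : r * j + r ≤ r * i := by nlinarith
            rw [if_pos (by omega)]
            exact coeff_eq_zero_of_natDegree_lt (lt_of_lt_of_le (hp j) (by omega))
          · have h4 : r * i + r ≤ r * j := by
              have : i + 1 ≤ j := by omega
              nlinarith
            rw [if_neg (by omega)]
      rw [Finset.sum_congr rfl this, Finset.sum_ite_eq' ]
      split_ifs with h5
      · rfl
      · rw [Finset.mem_range, not_lt] at h5
        rw [coeff_eq_zero_of_natDegree_lt (p := p) (by omega), coeff_zero]
    rw [← h2, h, coeff_zero]
  · exact coeff_eq_zero_of_natDegree_lt (lt_of_lt_of_le (hp i) (by omega))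

/-- Kummer-type divisibility: the degree of a `d`-th root. -/
lemma kummer_deg {W : Type} [Field W] (d : ℕ) (F : W[X]) (hF0 : F ≠ 0)
    (c0 : W) (hc0 : c0 ≠ 0)
    (hF : ∀ n, (∀ a : W, d ∣ n * F.rootMultiplicity a) → d ∣ n)
    {M : Type} [Field M] [Algebra (RatFunc W) M] (y : M) (hy : IsIntegral (RatFunc W) y)
    (hyd : y ^ d = algebraMap (RatFunc W) M (algebraMap W[X] (RatFunc W) (C c0 * F))) :
    d ∣ (minpoly (RatFunc W) y).natDegree := by
  set n := (minpoly (RatFunc W) y).natDegree with hn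
  have hfd : FiniteDimensional (RatFunc W) (IntermediateField.adjoin (RatFunc W) {y}) :=
    IntermediateField.adjoin.finiteDimensional hy
  have hfr : Module.finrank (RatFunc W) (IntermediateField.adjoin (RatFunc W) {y}) = n :=
    IntermediateField.adjoin.finrank hy
  set g := IntermediateField.AdjoinSimple.gen (RatFunc W) y
  have hg : g ^ d = algebraMap (RatFunc W) (IntermediateField.adjoin (RatFunc W) {y})
      (algebraMap W[X] (RatFunc W) (C c0 * F)) := by
    apply Subtype.ext
    change y ^ d = _
    rw [hyd]; rfl
  have hnorm : (Algebra.norm (RatFunc W) g) ^ d =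
      (algebraMap W[X] (RatFunc W) (C c0 * F)) ^ n := by
    rw [← map_pow, hg, Algebra.norm_algebraMap, hfr]
  obtain ⟨P, R, hR, hPR⟩ := IsFractionRing.div_surjective (A := W[X]) (Algebra.norm (RatFunc W) g)
  have hR0 : R ≠ 0 := nonZeroDivisors.ne_zero hR
  have hRa : algebraMap W[X] (RatFunc W) R ≠ 0 := by
    simpa using hR0
  have hcF : C c0 * F ≠ 0 := mul_ne_zero (by simpa using hc0) hF0
  have heq : P ^ d = R ^ d * (C c0 * F) ^ n := by
    apply IsFractionRing.injective W[X] (RatFunc W)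
    rw [← hPR, div_pow, div_eq_iff (pow_ne_zero _ hRa)] at hnorm
    simp only [map_pow, map_mul] at hnorm ⊢
    rw [hnorm]; ring
  apply hF
  intro a
  have h1 := congrArg (fun f => f.rootMultiplicity a) heq
  beta_reduce at h1
  classical
  have hP0 : P ^ d ≠ 0 := by rw [heq]; exact mul_ne_zero (pow_ne_zero _ hR0) (pow_ne_zero _ hcF)
  simp only [← count_roots] at h1 ⊢
  rw [roots_mul (by rw [← heq]; exact hP0), roots_pow, roots_pow, roots_pow,
    roots_C_mul _ hc0] at h1
  simp only [Multiset.count_add, Multiset.count_nsmul] at h1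
  have : d * Multiset.count a P.roots - d * Multiset.count a R.roots = n * Multiset.count a F.roots := by
    omega
  rw [← this, ← Nat.mul_sub]
  exact dvd_mul_right _ _

end

section

open Polynomial

lemma kummer_coprime {W : Type} [Field W] (d : ℕ) (F : W[X]) (hF0 : F ≠ 0)
    (c1 : W) (hc1 : c1 ≠ 0)
    (hF : ∀ n, (∀ a : W, d ∣ n * F.rootMultiplicity a) → d ∣ n)
    (H : (RatFunc W)[X]) (hH : H.natDegree < d) (hH0 : H ≠ 0) :
    IsCoprime H (C (algebraMap W[X] (RatFunc W) (C c1)) * X ^ d -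
      C (algebraMap W[X] (RatFunc W) F)) := by
  refine isCoprime_of_irreducible_dvd (fun h => hH0 h.1) ?_
  intro π hπ h1 h2
  have : Fact (Irreducible π) := ⟨hπ⟩
  have hπ0 : π ≠ 0 := hπ.ne_zero
  have hdeg : π.natDegree < d := lt_of_le_of_lt (natDegree_le_of_dvd h1 hH0) hH
  set y : AdjoinRoot π := AdjoinRoot.root π with hy
  have hyint : IsIntegral (RatFunc W) y := AdjoinRoot.isIntegral_root hπ0
  have hmin : (minpoly (RatFunc W) y).natDegree = π.natDegree := by
    rw [hy, AdjoinRoot.minpoly_root hπ0, natDegree_mul_C]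
    simpa using hπ0
  have hc1' : algebraMap W[X] (RatFunc W) (C c1) ≠ 0 := by simpa using hc1
  have hyd : y ^ d = algebraMap (RatFunc W) (AdjoinRoot π)
      (algebraMap W[X] (RatFunc W) (C c1⁻¹ * F)) := by
    have h3 := (AdjoinRoot.mk_eq_zero).2 h2
    simp only [map_sub, map_mul, map_pow, AdjoinRoot.mk_X, AdjoinRoot.mk_C] at h3
    have h5 : algebraMap W[X] (RatFunc W) (C c1⁻¹) * algebraMap W[X] (RatFunc W) (C c1) = 1 := by
      rw [← map_mul, ← C_mul, inv_mul_cancel₀ hc1, C_1, map_one]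
    have h4 := congrArg (fun z => AdjoinRoot.of π (algebraMap W[X] (RatFunc W) (C c1⁻¹)) * z) (sub_eq_zero.1 h3)
    simp only [← mul_assoc, ← map_mul (AdjoinRoot.of π), h5, map_one, one_mul] at h4
    rw [h4, ← map_mul]; rfl
  have := kummer_deg d F hF0 c1⁻¹ (inv_ne_zero hc1) hF y hyint hyd
  rw [hmin] at this
  have h6 := Nat.le_of_dvd hπ.natDegree_pos this
  omega

lemma indep {K W : Type} [Field K] [Field W] (ψ : K[X] →+* W) (hψ : Function.Injective ψ)
    (d : ℕ) (hd : 0 < d) (F u : K[X]) (hF0 : F ≠ 0) (r N : ℕ) (hFN : F.natDegree ≤ N)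
    (hr : 2 * d * N < r) (hu : F * u ^ d = F.comp (X ^ r))
    (hF : ∀ n, (∀ a : W, d ∣ n * (F.map (ψ.comp C)).rootMultiplicity a) → d ∣ n)
    (h : ℕ → K[X][X]) (hh : ∀ j, XDeg N (h j))
    (hsum : ∑ j ∈ Finset.range d, (h j).eval (X ^ r) * u ^ j = 0) :
    ∀ j < d, h j = 0 := by
  set H : K[X][X][X] := ∑ j ∈ Finset.range d, C (h j) * X ^ j with hHdef
  have hHc : ∀ j, H.coeff j = if j < d then h j else 0 := by
    intro j
    simp [hHdef, finsetSum_coeff, coeff_C_mul, coeff_X_pow]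
  set P : K[X][X][X] := C (C F) * X ^ d - C (F.map C) with hPdef
  have hPc : ∀ j, XDeg N (P.coeff j) := by
    intro j i
    rw [hPdef]
    simp only [coeff_sub, coeff_C_mul, coeff_X_pow, coeff_C]
    refine (natDegree_sub_le _ _).trans (max_le ?_ ?_)
    · by_cases hj : j = d
      · simp only [hj, if_true, coeff_one]
        split_ifs <;> simp [hFN]
      · simp [hj]
    · split_ifs
      · rw [coeff_map, natDegree_C]; exact Nat.zero_le _
      · simp
  have hXres : XDeg ((d - 1 + d) * N) (resultant H P (d - 1) d) := by
    unfold resultant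
    apply XDeg.det
    intro i j
    rw [sylvester, Matrix.of_apply]
    refine Fin.addCases (fun j => ?_) (fun j => ?_) j
    · rw [Fin.addCases_left]; split_ifs
      · exact hPc _
      · exact XDeg.zero _
    · rw [Fin.addCases_right]; split_ifs
      · rw [hHc]; split_ifs
        · exact hh _
        · exact XDeg.zero _
      · exact XDeg.zero _
  have hHd : H.natDegree ≤ d - 1 := by
    rw [natDegree_le_iff_coeff_eq_zero]
    intro j hj
    rw [hHc, if_neg (by omega)]
  have hPd : P.natDegree ≤ d := by
    rw [natDegree_le_iff_coeff_eq_zero]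
    intro j hj
    rw [hPdef]
    simp only [coeff_sub, coeff_C_mul, coeff_X_pow, coeff_C]
    rw [if_neg (by omega), if_neg (by omega)]; simp
  have hres : resultant H P (d - 1) d = 0 := by
    apply eval_X_pow_inj r
    · intro i
      refine lt_of_le_of_lt (hXres i) (lt_of_le_of_lt ?_ hr)
      apply Nat.mul_le_mul_right; omega
    · obtain ⟨p, q, -, -, hpq⟩ := exists_mul_add_mul_eq_C_resultant H P hHd hPd (by omega)
      have := congrArg (eval₂ (evalRingHom (X ^ r : K[X])) u) hpq
      simp only [eval₂_add, eval₂_mul, eval₂_C] at this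
      rw [coe_evalRingHom] at this
      rw [← this]
      have e1 : eval₂ (evalRingHom (X ^ r : K[X])) u H = 0 := by
        rw [hHdef, eval₂_finsetSum]
        simpa using hsum
      have e2 : eval₂ (evalRingHom (X ^ r : K[X])) u P = 0 := by
        rw [hPdef]
        simp only [eval₂_sub, eval₂_mul, eval₂_C, eval₂_pow, eval₂_X, coe_evalRingHom, eval_C]
        rw [hu, eval_map, comp, sub_self]
      rw [e1, e2]; simp
  set Ψ : K[X][X] →+* RatFunc W := (algebraMap W[X] (RatFunc W)).comp (mapRingHom ψ) with hΨ
  have hΨi : Function.Injective Ψ :=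
    (IsFractionRing.injective W[X] (RatFunc W)).comp (map_injective ψ hψ)
  have hFW : F.map (ψ.comp C) ≠ 0 :=
    (Polynomial.map_ne_zero_iff (f := ψ.comp C) (hψ.comp C_injective)).2 hF0
  have hc1 : ψ F ≠ 0 := (map_ne_zero_iff ψ hψ).2 hF0
  have hPm : P.map Ψ = C (algebraMap W[X] (RatFunc W) (C (ψ F))) * X ^ d -
      C (algebraMap W[X] (RatFunc W) (F.map (ψ.comp C))) := by
    rw [hPdef, hΨ]
    simp [Polynomial.map_map]
  have hHm : H.map Ψ = 0 := by
    by_contra hne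
    have hdeg : (H.map Ψ).natDegree < d := by
      have := natDegree_map_le (f := Ψ) (p := H)
      omega
    have hcop := kummer_coprime d _ hFW _ hc1 hF _ hdeg hne
    rw [← hPm] at hcop
    have hPmd : (P.map Ψ).natDegree = d := by
      rw [hPm]
      rw [natDegree_sub_C, natDegree_C_mul_X_pow]
      simpa using hc1
    have h1 : resultant (H.map Ψ) (P.map Ψ) (d-1) d = 0 := by
      rw [resultant_map_map, hres, map_zero]
    have h2 : d - 1 = (H.map Ψ).natDegree + (d - 1 - (H.map Ψ).natDegree) := by omega
    rw [h2, resultant_add_left_deg _ _ _ _ _ le_rfl] at h1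
    have h3 : (P.map Ψ).coeff d ≠ 0 := by
      conv in d => rw [← hPmd]
      rw [coeff_natDegree, leadingCoeff_ne_zero]
      intro h0
      rw [h0] at hPmd; simp at hPmd; omega
    have h4 : resultant (H.map Ψ) (P.map Ψ) (H.map Ψ).natDegree (P.map Ψ).natDegree = 0 := by
      rw [hPmd]
      rcases mul_eq_zero.1 h1 with h5 | h5
      · exact absurd h5 (mul_ne_zero (pow_ne_zero _ (neg_ne_zero.2 one_ne_zero))
          (pow_ne_zero _ h3))
      · exact h5
    rw [resultant_eq_zero_iff] at h4
    exact h4.2 hcop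
  intro j hj
  have h1 : H = 0 := map_injective Ψ hΨi (by rw [hHm, Polynomial.map_zero])
  have h2 := hHc j
  rw [if_pos hj, h1, coeff_zero] at h2
  exact h2.symm

end

section

open Polynomial

lemma exists_rel {K ι : Type} [Field K] (S : Finset ι) (v : ι → K[X]) (M : ℕ)
    (hv : ∀ t ∈ S, (v t).natDegree < M) (h : M < S.card) :
    ∃ w : ι → K, (∃ t ∈ S, w t ≠ 0) ∧ ∑ t ∈ S, C (w t) * v t = 0 := by
  classical
  let Φ : (S → K) →ₗ[K] (Fin M → K) :=
    (LinearMap.pi (fun k : Fin M => lcoeff K (k : ℕ))).comp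
      (Fintype.linearCombination K (fun t : S => v t))
  have hk : LinearMap.ker Φ ≠ ⊥ := by
    apply LinearMap.ker_ne_bot_of_finrank_lt
    rw [Module.finrank_fin_fun, Module.finrank_fintype_fun_eq_card]
    simpa using h
  obtain ⟨w, hw, hw0⟩ := Submodule.exists_mem_ne_zero_of_ne_bot hk
  obtain ⟨t, ht⟩ := Function.ne_iff.1 hw0
  refine ⟨fun t => if h : t ∈ S then w ⟨t, h⟩ else 0, ⟨t, t.2, ?_⟩, ?_⟩
  · simpa using ht
  · have e : ∑ t ∈ S, C ((if h : t ∈ S then w ⟨t, h⟩ else 0) : K) * v t = ∑ t : S, w t • v t := by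
      rw [← Finset.sum_coe_sort]
      refine Finset.sum_congr rfl (fun t _ => ?_)
      simp [smul_eq_C_mul]
    rw [e]
    ext k
    rw [coeff_zero]
    by_cases hkM : k < M
    · have := congrFun (LinearMap.mem_ker.1 hw) ⟨k, hkM⟩
      simpa [Φ, Fintype.linearCombination_apply] using this
    · rw [finsetSum_coeff]
      refine Finset.sum_eq_zero (fun t _ => ?_)
      rw [coeff_smul, coeff_eq_zero_of_natDegree_lt (lt_of_lt_of_le (hv t t.2) (by omega)), smul_zero]

lemma stepanov_count {K W : Type} [Field K] [Fintype K] [DecidableEq K] [Field W] (ψ : K[X] →+* W)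
    (hψ : Function.Injective ψ) (p t r d m A B N : ℕ) [hp : Fact p.Prime] [CharP K p]
    (hr : r = p ^ t) (hK : Fintype.card K = r ^ 2) (hd : 0 < d) (hdr : d ∣ r - 1)
    (F : K[X]) (hF0 : F ≠ 0) (hFm : F.natDegree ≤ m) (hFr : F ^ r = F.comp (X ^ r))
    (hF : ∀ n, (∀ a : W, d ∣ n * (F.map (ψ.comp C)).rootMultiplicity a) → d ∣ n)
    (hB : B ≤ N) (hm : m ≤ N) (hN : 2 * d * N < r)
    (hAB : r * B + A + m * r < A * d * B) (c : K) :
    (Finset.univ.filter (fun x : K => F.eval x ≠ 0 ∧ (F.eval x) ^ ((r ^ 2 - 1) / d) = c)).card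
      ≤ B + A * r + m * r := by
  set e := (r - 1) / d with he
  have hde : d * e = r - 1 := Nat.mul_div_cancel' hdr
  have hr1 : 1 ≤ r := by omega
  set u := F ^ e with hu
  have hud : F * u ^ d = F.comp (X ^ r) := by
    rw [hu, ← pow_mul, mul_comm e, hde, ← pow_succ', Nat.sub_add_cancel hr1, hFr]
  have hudeg : ∀ j < d, (u ^ j).natDegree ≤ m * (r - 1) := by
    intro j hj
    rw [hu, ← pow_mul, natDegree_pow, mul_comm]
    refine Nat.mul_le_mul hFm ?_
    rw [← hde, mul_comm]; exact Nat.mul_le_mul_right _ hj.le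
  -- the linear system
  obtain ⟨w, ⟨t0, ht0, hwt0⟩, hw⟩ := exists_rel (K := K)
    (Finset.range A ×ˢ Finset.range d ×ˢ Finset.range B)
    (fun t => X ^ (r * t.2.2 + t.1) * (C (c ^ t.2.1) * u ^ (d - 1 - t.2.1)))
    (r * B + A + m * r) (by
      rintro ⟨i, j, b⟩ hmem
      simp only [Finset.mem_product, Finset.mem_range] at hmem
      obtain ⟨hi, hj, hb⟩ := hmem
      refine lt_of_le_of_lt natDegree_mul_le ?_
      rw [natDegree_X_pow]
      have h1 : (C (c ^ j) * u ^ (d - 1 - j)).natDegree ≤ m * (r - 1) :=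
        (natDegree_C_mul_le _ _).trans (hudeg _ (by omega))
      have h2 : m * (r - 1) ≤ m * r := Nat.mul_le_mul_left _ (by omega)
      have h3 : r * b ≤ r * B := Nat.mul_le_mul_left _ hb.le
      simp only
      omega) (by simpa [mul_assoc] using hAB)
  -- auxiliary polynomials
  set v : ℕ → ℕ → K[X] := fun i j => ∑ b ∈ Finset.range B, C ((w (i, j, b)) ^ r) * X ^ b with hv
  have hvdeg : ∀ i j, (v i j).natDegree ≤ B - 1 := by
    intro i j
    refine natDegree_sum_le_of_forall_le _ _ (fun b hb => ?_)
    rw [Finset.mem_range] at hb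
    exact (natDegree_C_mul_X_pow_le _ _).trans (by omega)
  set f : K[X] := ∑ j ∈ Finset.range d, ∑ i ∈ Finset.range A, v i j * X ^ (r * i) * u ^ j with hf
  set h : ℕ → K[X][X] := fun j => ∑ i ∈ Finset.range A, C (v i j) * X ^ i with hh
  have hfne : f ≠ 0 := by
    intro hf0
    have hind := indep ψ hψ d hd F u hF0 r N (hFm.trans hm) hN hud hF h (by
      intro j i
      rw [hh]
      simp only [finsetSum_coeff, coeff_C_mul, coeff_X_pow]
      refine natDegree_sum_le_of_forall_le _ _ (fun i' _ => ?_)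
      split_ifs
      · rw [mul_one]; exact (hvdeg _ _).trans (by omega)
      · simp) (by
      rw [← hf0, hf]
      refine Finset.sum_congr rfl (fun j _ => ?_)
      rw [hh]
      simp only [eval_finsetSum, eval_mul, eval_C, eval_pow, eval_X, ← pow_mul, Finset.sum_mul])
    obtain ⟨i, j, b⟩ := t0
    simp only [Finset.mem_product, Finset.mem_range] at ht0
    have h1 := hind j ht0.2.1
    have h2 : (h j).coeff i = v i j := by
      simp only [hh, finsetSum_coeff, coeff_C_mul, coeff_X_pow]
      simp [ht0.1]
    have h3 : (v i j).coeff b = (w (i, j, b)) ^ r := by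
      simp only [hv, finsetSum_coeff, coeff_C_mul, coeff_X_pow]
      simp [ht0.2.2]
    rw [h1, coeff_zero] at h2
    rw [← h2, coeff_zero] at h3
    exact hwt0 (pow_eq_zero_iff (by omega) |>.1 h3.symm)
  have hfdeg : f.natDegree ≤ B + A * r + m * r := by
    refine natDegree_sum_le_of_forall_le _ _ (fun j hj => ?_)
    refine natDegree_sum_le_of_forall_le _ _ (fun i hi => ?_)
    rw [Finset.mem_range] at hi hj
    have h1 := hudeg j hj
    have h2 := hvdeg i j
    have h3 : m * (r - 1) ≤ m * r := Nat.mul_le_mul_left _ (by omega)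
    have h4 : r * i ≤ A * r := by rw [mul_comm]; exact Nat.mul_le_mul_right _ hi.le
    refine natDegree_mul_le.trans ?_
    refine (add_le_add_left natDegree_mul_le _).trans ?_
    rw [natDegree_X_pow]
    omega
  have hcard : ∀ x : K, x ^ r ^ 2 = x := fun x => by rw [← hK]; exact FiniteField.pow_card x
  refine le_trans ?_ ((Multiset.toFinset_card_le f.roots).trans ((card_roots' f).trans hfdeg))
  refine Finset.card_le_card (fun x hx => ?_)
  rw [Finset.mem_filter] at hx
  obtain ⟨-, hFx, hFc⟩ := hx
  rw [Multiset.mem_toFinset, mem_roots hfne, IsRoot]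
  have hux : u.eval x ≠ 0 := by rw [hu, eval_pow]; exact pow_ne_zero _ hFx
  have huc : (u.eval x) ^ r * u.eval x = c := by
    rw [← pow_succ, ← hFc, hu, eval_pow, ← pow_mul]
    congr 1
    have : r ^ 2 - 1 = (r - 1) * (r + 1) := by
      obtain ⟨s, rfl⟩ := Nat.exists_eq_add_of_le hr1
      simp only [Nat.add_sub_cancel_left]
      rw [show (1 + s) ^ 2 = s * (1 + s + 1) + 1 by ring]; simp
    rw [this, ← hde, mul_assoc, Nat.mul_div_cancel_left _ hd]
  have hfr : (f.eval x) ^ r * (u.eval x) ^ (d - 1) = 0 := by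
    have hw' := congrArg (eval x) hw
    rw [eval_zero, eval_finsetSum] at hw'
    rw [← hw', hf]
    simp only [eval_finsetSum, hv, eval_mul, eval_C, eval_pow, eval_X]
    have hs : ∀ (T : Finset ℕ) (G : ℕ → K), (∑ i ∈ T, G i) ^ r = ∑ i ∈ T, G i ^ r := by
      intro T G
      rw [hr]; exact sum_pow_char_pow p t T G
    rw [hs, Finset.sum_product, Finset.sum_mul]
    simp only [Finset.sum_product]
    rw [Finset.sum_comm]
    refine Finset.sum_congr rfl (fun j hj => ?_)
    rw [Finset.mem_range] at hj
    rw [hs, Finset.sum_mul]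
    refine Finset.sum_congr rfl (fun i hi => ?_)
    rw [mul_pow, mul_pow, hs, Finset.sum_mul, Finset.sum_mul, Finset.sum_mul]
    refine Finset.sum_congr rfl (fun b hb => ?_)
    have e1 : (w (i, j, b) ^ r) ^ r = w (i, j, b) := by
      rw [← pow_mul, ← sq, hcard]
    have e2 : (x ^ (r * i)) ^ r = x ^ i := by
      rw [← pow_mul, mul_right_comm, ← sq, pow_mul, hcard]
    have e3 : ((eval x u) ^ j) ^ r * (eval x u) ^ (d - 1) = c ^ j * (eval x u) ^ (d - 1 - j) := by
      rw [← huc, mul_pow, mul_assoc, ← pow_add, Nat.add_sub_cancel' (by omega), ← pow_mul,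
        ← pow_mul, mul_comm j r]
    rw [mul_pow, e1, e2, mul_assoc, e3, pow_add, ← pow_mul, mul_comm b r]
    ring
  rcases mul_eq_zero.1 hfr with h1 | h1
  · exact pow_eq_zero_iff (by omega) |>.1 h1
  · exact absurd h1 (pow_ne_zero _ hux)

end

section

open Polynomial

lemma stepanov_count' {K W : Type} [Field K] [Fintype K] [DecidableEq K] [Field W] (ψ : K[X] →+* W)
    (hψ : Function.Injective ψ) (p t r d m : ℕ) [hp : Fact p.Prime] [CharP K p]
    (hr : r = p ^ t) (hK : Fintype.card K = r ^ 2) (hd : 0 < d) (hdr : d ∣ r - 1)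
    (F : K[X]) (hF0 : F ≠ 0) (hFm : F.natDegree ≤ m) (hFr : F ^ r = F.comp (X ^ r))
    (hF : ∀ n, (∀ a : W, d ∣ n * (F.map (ψ.comp C)).rootMultiplicity a) → d ∣ n)
    (hbig : 16 * (m + 2) * (d + 1) ≤ r) (c : K) :
    ((Finset.univ.filter (fun x : K => F.eval x ≠ 0 ∧
      (F.eval x) ^ ((r ^ 2 - 1) / d) = c)).card : ℝ) ≤ (r : ℝ) ^ 2 / d + (5 * m + 9) * r := by
  obtain ⟨e, he⟩ := hdr
  set B := r / (4 * d) with hB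
  have h1 : 4 * d * B ≤ r := Nat.mul_div_le r (4 * d)
  have h2 : r < 4 * d * B + 4 * d := by
    have := Nat.lt_mul_div_succ r (show 0 < 4 * d by omega)
    rw [← hB] at this; linarith
  have hr1 : 1 ≤ r := by nlinarith
  have hr2 : r = d * e + 1 := by omega
  have he_le : e ≤ r := by nlinarith
  have hBr : B ≤ r := by nlinarith
  have hmB : m ≤ B := by
    by_contra hlt
    have h3 : B + 1 ≤ m := by omega
    have h4 : 4 * d * (B + 1) ≤ 4 * d * m := Nat.mul_le_mul_left _ h3
    nlinarith
  have := stepanov_count ψ hψ p t r d m (e + 4 * (m + 2)) B B hr hK hd ⟨e, he⟩ F hF0 hFm hFr hF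
    le_rfl hmB (by nlinarith) (by
      have e1 : (e + 4 * (m + 2)) * d * B = d * e * B + (m + 2) * (4 * d * B) := by ring
      have e2 : r * B = d * e * B + B := by
        conv_lhs => rw [hr2]
        ring
      rw [e1, e2]
      have e3 : (m + 2) * r < (m + 2) * (4 * d * B + 4 * d) :=
        Nat.mul_lt_mul_of_pos_left h2 (by omega)
      nlinarith) c
  have h5 : ((Finset.univ.filter (fun x : K => F.eval x ≠ 0 ∧
      (F.eval x) ^ ((r ^ 2 - 1) / d) = c)).card : ℝ) ≤ (B : ℝ) + (e + 4 * (m + 2)) * r + m * r := by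
    exact_mod_cast this
  have hd' : (0 : ℝ) < d := by exact_mod_cast hd
  have h6 : (e : ℝ) * r ≤ (r : ℝ) ^ 2 / d := by
    rw [le_div_iff₀ hd']
    have : (r : ℝ) = d * e + 1 := by exact_mod_cast hr2
    have h7 : (0 : ℝ) ≤ r := Nat.cast_nonneg _
    nlinarith
  have h7 : (B : ℝ) ≤ r := by exact_mod_cast hBr
  nlinarith

lemma charsum_bound {K W : Type} [Field K] [Fintype K] [Field W] (ψ : K[X] →+* W)
    (hψ : Function.Injective ψ) (p t r d m : ℕ) [hp : Fact p.Prime] [CharP K p]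
    (hr : r = p ^ t) (hK : Fintype.card K = r ^ 2) (hd : 0 < d) (hdr : d ∣ r - 1)
    (F : K[X]) (hF0 : F ≠ 0) (hFm : F.natDegree ≤ m) (hFr : F ^ r = F.comp (X ^ r))
    (hF : ∀ n, (∀ a : W, d ∣ n * (F.map (ψ.comp C)).rootMultiplicity a) → d ∣ n)
    (hbig : 16 * (m + 2) * (d + 1) ≤ r) (χ : MulChar K ℂ) (hχ : χ ≠ 1) (hχd : χ ^ d = 1) :
    ‖∑ x : K, χ (F.eval x)‖ ≤ 2 * d * ((5 * m + 9) * r) + m := by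
  classical
  obtain ⟨g, hg⟩ := IsCyclic.exists_generator (α := Kˣ)
  have hg' : ∀ x, x ∈ Submonoid.powers g := fun x => by
    rw [mem_powers_iff_mem_zpowers]; exact hg x
  have hr1 : 1 ≤ r := by nlinarith
  have hord : orderOf g = r ^ 2 - 1 := by
    rw [orderOf_eq_card_of_forall_mem_zpowers hg, Nat.card_eq_fintype_card, Fintype.card_units, hK]
  have hddvd : d ∣ r ^ 2 - 1 := by
    refine hdr.trans ⟨r + 1, ?_⟩
    obtain ⟨s, rfl⟩ := Nat.exists_eq_add_of_le hr1
    simp only [Nat.add_sub_cancel_left]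
    rw [show (1 + s) ^ 2 = s * (1 + s + 1) + 1 by ring]; simp
  set e := (r ^ 2 - 1) / d with he
  have hde : e * d = r ^ 2 - 1 := Nat.div_mul_cancel hddvd
  have hpos : 0 < r ^ 2 - 1 := by
    have : 2 ≤ r := by nlinarith
    have : 4 ≤ r ^ 2 := by nlinarith
    omega
  set ζ : K := (g : K) ^ e with hζ
  have hprim : IsPrimitiveRoot ζ d := by
    have h1 : IsPrimitiveRoot (g : K) (r ^ 2 - 1) := by
      rw [IsPrimitiveRoot.coe_units_iff, ← hord]; exact IsPrimitiveRoot.orderOf g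
    exact h1.pow hpos hde.symm
  set z := χ g with hz
  have hzd : z ^ d = 1 := by
    rw [hz, ← MulChar.pow_apply_coe, hχd, MulChar.one_apply_coe]
  have hz1 : z ≠ 1 := by
    intro h1
    apply hχ
    ext a
    obtain ⟨n, rfl⟩ := hg' a
    simp only [Units.val_pow_eq_pow_val, map_pow, MulChar.one_apply_coe]
    rw [← hz, h1, one_pow]
  have hgeom : ∑ k ∈ Finset.range d, z ^ k = 0 := by
    have := geom_sum_mul z d
    rw [hzd, sub_self] at this
    exact (mul_eq_zero.1 this).resolve_right (sub_ne_zero.2 hz1)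
  have hznorm : ‖z‖ = 1 := Complex.norm_eq_one_of_pow_eq_one hzd hd.ne'
  -- key decomposition
  have key : ∀ y : K, y ≠ 0 → ∃ k ∈ Finset.range d, y ^ e = ζ ^ k ∧ χ y = z ^ k := by
    intro y hy
    obtain ⟨n, hn⟩ := hg' (Units.mk0 y hy)
    have hn' : (g : K) ^ n = y := by
      have := congrArg Units.val hn
      simpa using this
    refine ⟨n % d, Finset.mem_range.2 (Nat.mod_lt _ hd), ?_, ?_⟩
    · rw [← hn', hζ, ← pow_mul, mul_comm, pow_mul, ← hζ]
      exact (pow_eq_pow_mod n hprim.pow_eq_one)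
    · rw [← hn', map_pow, ← hz]
      exact (pow_eq_pow_mod n hzd)
  set Nk : ℕ → ℕ := fun k => (Finset.univ.filter (fun x : K => F.eval x ≠ 0 ∧
      (F.eval x) ^ e = ζ ^ k)).card with hNk
  have hterm : ∀ (w : ℂ) (hw : w ^ d = 1) (φ : K → ℂ) (hφ0 : φ 0 = 0)
      (hφ : ∀ y ≠ 0, ∀ k < d, y ^ e = ζ ^ k → φ y = w ^ k),
      ∑ x : K, φ (F.eval x) = ∑ k ∈ Finset.range d, w ^ k * (Nk k : ℂ) := by
    intro w hw φ hφ0 hφ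
    have : ∀ x : K, φ (F.eval x) = ∑ k ∈ Finset.range d,
        if F.eval x ≠ 0 ∧ (F.eval x) ^ e = ζ ^ k then w ^ k else 0 := by
      intro x
      by_cases hx : F.eval x = 0
      · simp [hx, hφ0]
      · obtain ⟨k, hk, h1, h2⟩ := key _ hx
        rw [Finset.sum_eq_single k]
        · rw [if_pos ⟨hx, h1⟩, hφ _ hx k (Finset.mem_range.1 hk) h1]
        · intro j hj hjk
          rw [if_neg]
          rintro ⟨-, h3⟩
          rw [h1] at h3
          exact hjk (hprim.pow_inj (Finset.mem_range.1 hj) (Finset.mem_range.1 hk) h3.symm)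
        · exact fun h => absurd hk h
    rw [Finset.sum_congr rfl (fun x _ => this x), Finset.sum_comm]
    refine Finset.sum_congr rfl (fun k _ => ?_)
    rw [← Finset.sum_filter, Finset.sum_const, nsmul_eq_mul, mul_comm]
  have hsum : ∑ x : K, χ (F.eval x) = ∑ k ∈ Finset.range d, z ^ k * (Nk k : ℂ) := by
    refine hterm z hzd (fun y => χ y) (MulChar.map_zero χ) ?_
    intro y hy k hk h1
    obtain ⟨j, hj, h2, h3⟩ := key y hy
    rw [h3, hprim.pow_inj (Finset.mem_range.1 hj) hk (h2.symm.trans h1)]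
  have htot : (r : ℝ) ^ 2 - m ≤ ∑ k ∈ Finset.range d, (Nk k : ℝ) := by
    have h1 := hterm 1 (one_pow _) (fun y => if y = 0 then 0 else 1) (by simp) (by
      intro y hy k _ _; simp [hy])
    have h2 : ∑ x : K, (if F.eval x = 0 then (0 : ℂ) else 1) =
        ((Finset.univ.filter (fun x : K => ¬ F.eval x = 0)).card : ℂ) := by
      rw [Finset.card_filter]; push_cast
      refine Finset.sum_congr rfl (fun x _ => ?_)
      split_ifs <;> simp
    rw [h2] at h1
    simp only [one_pow, one_mul] at h1
    have h3 : (Finset.univ.filter (fun x : K => ¬ F.eval x = 0)).card =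
        ∑ k ∈ Finset.range d, Nk k := by exact_mod_cast h1
    have h4 : (Finset.univ.filter (fun x : K => F.eval x = 0)).card ≤ m := by
      refine le_trans ?_ ((Multiset.toFinset_card_le F.roots).trans ((card_roots' F).trans hFm))
      refine Finset.card_le_card (fun x hx => ?_)
      rw [Multiset.mem_toFinset, mem_roots hF0]
      exact (Finset.mem_filter.1 hx).2
    have h5 := Finset.card_filter_add_card_filter_not (s := (Finset.univ : Finset K))
      (fun x : K => F.eval x = 0)
    rw [Finset.card_univ, hK] at h5
    have h6 : r ^ 2 ≤ m + ∑ k ∈ Finset.range d, Nk k := by omega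
    have h7 : (r : ℝ) ^ 2 ≤ m + ∑ k ∈ Finset.range d, (Nk k : ℝ) := by exact_mod_cast h6
    linarith
  have hle : ∀ k, (Nk k : ℝ) ≤ (r : ℝ) ^ 2 / d + (5 * m + 9) * r := fun k =>
    stepanov_count' ψ hψ p t r d m hr hK hd hdr F hF0 hFm hFr hF hbig _
  have hsum2 : ∑ x : K, χ (F.eval x) =
      ∑ k ∈ Finset.range d, z ^ k * (((Nk k : ℝ) - (r : ℝ) ^ 2 / d : ℝ) : ℂ) := by
    rw [hsum]
    push_cast
    simp only [mul_sub, Finset.sum_sub_distrib]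
    rw [← Finset.sum_mul, hgeom, zero_mul, sub_zero]
  rw [hsum2]
  refine (norm_sum_le _ _).trans ?_
  have hd' : (d : ℝ) ≠ 0 := by exact_mod_cast hd.ne'
  calc ∑ k ∈ Finset.range d, ‖z ^ k * (((Nk k : ℝ) - (r : ℝ) ^ 2 / d : ℝ) : ℂ)‖
      ≤ ∑ k ∈ Finset.range d, (2 * ((5 * m + 9) * r) - ((Nk k : ℝ) - (r : ℝ) ^ 2 / d)) := by
        refine Finset.sum_le_sum (fun k _ => ?_)
        rw [norm_mul, norm_pow, hznorm, one_pow, one_mul, Complex.norm_real, Real.norm_eq_abs]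
        have h1 := hle k
        have h2 : (0 : ℝ) ≤ (5 * m + 9) * r := by positivity
        rw [abs_le]
        constructor <;> linarith
    _ = 2 * d * ((5 * m + 9) * r) + (r : ℝ) ^ 2 - ∑ k ∈ Finset.range d, (Nk k : ℝ) := by
        simp only [Finset.sum_sub_distrib, Finset.sum_const, Finset.card_range, nsmul_eq_mul]
        field_simp
        ring
    _ ≤ _ := by linarith

end

section

open Polynomial

lemma growth (B : Finset ℂ) (c : ℂ → ℂ) (ρ Cst : ℝ) (hρ : 0 < ρ) (k0 : ℕ)
    (h : ∀ k ≥ k0, ‖∑ b ∈ B, c b * b ^ k‖ ≤ Cst * ρ ^ k) (b1 : ℂ) (hb1 : b1 ∈ B) (hc : c b1 ≠ 0) :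
    ‖b1‖ ≤ ρ := by
  classical
  set p : ℂ[X] := ∏ b ∈ B.erase b1, (X - C b) with hp
  have hp1 : p.eval b1 ≠ 0 := by
    rw [hp, eval_prod]
    refine Finset.prod_ne_zero_iff.2 (fun b hb => ?_)
    rw [eval_sub, eval_X, eval_C, sub_ne_zero]
    exact (Finset.ne_of_mem_erase hb).symm
  have hp0 : ∀ b ∈ B, b ≠ b1 → p.eval b = 0 := by
    intro b hb hne
    rw [hp, eval_prod]
    exact Finset.prod_eq_zero (Finset.mem_erase.2 ⟨hne, hb⟩) (by simp)
  have key : ∀ k, ∑ j ∈ Finset.range (p.natDegree + 1), p.coeff j * ∑ b ∈ B, c b * b ^ (k + j) =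
      c b1 * p.eval b1 * b1 ^ k := by
    intro k
    have : ∀ b ∈ B, c b * p.eval b * b ^ k =
        ∑ j ∈ Finset.range (p.natDegree + 1), p.coeff j * (c b * b ^ (k + j)) := by
      intro b _
      rw [eval_eq_sum_range, Finset.mul_sum, Finset.sum_mul]
      refine Finset.sum_congr rfl (fun j _ => ?_)
      rw [pow_add]; ring
    simp only [Finset.mul_sum]
    rw [Finset.sum_comm, ← Finset.sum_congr rfl this, Finset.sum_eq_single b1]
    · intro b hb hne; rw [hp0 b hb hne]; ring
    · exact fun h => absurd hb1 h
  set D := ∑ j ∈ Finset.range (p.natDegree + 1), ‖p.coeff j‖ * (Cst * ρ ^ j) with hD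
  have hbound : ∀ k ≥ k0, ‖c b1 * p.eval b1‖ * ‖b1‖ ^ k ≤ D * ρ ^ k := by
    intro k hk
    rw [← norm_pow, ← norm_mul, ← key k]
    refine (norm_sum_le _ _).trans ?_
    rw [hD, Finset.sum_mul]
    refine Finset.sum_le_sum (fun j _ => ?_)
    rw [norm_mul, mul_assoc]
    refine mul_le_mul_of_nonneg_left ?_ (norm_nonneg _)
    refine (h (k + j) (by omega)).trans (le_of_eq ?_)
    rw [pow_add]; ring
  by_contra hlt
  rw [not_le] at hlt
  have hpos : 0 < ‖c b1 * p.eval b1‖ := norm_pos_iff.2 (mul_ne_zero hc hp1)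
  have h1 : 1 < ‖b1‖ / ρ := (one_lt_div hρ).2 hlt
  obtain ⟨n, hn⟩ := pow_unbounded_of_one_lt (D / ‖c b1 * p.eval b1‖) h1
  have h2 : D / ‖c b1 * p.eval b1‖ < (‖b1‖ / ρ) ^ (n + k0) :=
    hn.trans_le (pow_le_pow_right₀ h1.le (by omega))
  have h3 := hbound (n + k0) (by omega)
  rw [div_lt_iff₀ hpos, div_pow, div_mul_eq_mul_div, lt_div_iff₀ (pow_pos hρ _)] at h2
  linarith

lemma growth_apply (ms : Multiset ℂ) (Q Cst : ℝ) (hQ : 1 < Q) (k0 : ℕ) (S : ℕ → ℂ)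
    (hS : ∀ k ≥ 1, S k = (Q : ℂ) ^ k - (ms.map (fun w => w ^ k)).sum)
    (h : ∀ k ≥ k0, ‖S (2 * k)‖ ≤ Cst * Q ^ k) (hS1 : ‖S 1‖ ≤ Q)
    (m : ℕ) (hcard : ms.card ≤ m) (hm : 1 ≤ m) (hQm : ((m : ℝ) - 1) ^ 2 < Q) :
    ‖S 1‖ ≤ (m - 1) * Real.sqrt Q := by
  classical
  have hQ0 : 0 < Q := by linarith
  set s2 := ms.map (fun w => w ^ 2) with hs2
  set B : Finset ℂ := insert ((Q : ℂ) ^ 2) s2.toFinset with hB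
  set c : ℂ → ℂ := fun b => (if b = (Q : ℂ) ^ 2 then 1 else 0) - (s2.count b : ℂ) with hc
  have hmsum : ∀ k, (ms.map (fun w => w ^ (2 * k))).sum = ∑ b ∈ B, (s2.count b : ℂ) * b ^ k := by
    intro k
    have h1 : (ms.map (fun w => w ^ (2 * k))) = s2.map (fun b => b ^ k) := by
      rw [hs2, Multiset.map_map]
      refine Multiset.map_congr rfl (fun w _ => ?_)
      simp [pow_mul]
    rw [h1, Finset.sum_multiset_map_count]
    refine (Finset.sum_subset (Finset.subset_insert ((Q : ℂ) ^ 2) _) ?_).trans ?_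
    · intro b _ hb
      rw [Multiset.mem_toFinset] at hb
      rw [Multiset.count_eq_zero_of_notMem hb, zero_smul]
    · refine Finset.sum_congr rfl (fun b _ => ?_)
      rw [nsmul_eq_mul]
  have hT : ∀ k ≥ k0 + 1, ‖∑ b ∈ B, c b * b ^ k‖ ≤ Cst * Q ^ k := by
    intro k hk
    have : ∑ b ∈ B, c b * b ^ k = S (2 * k) := by
      rw [hS _ (by omega), hmsum]
      simp only [hc, sub_mul, Finset.sum_sub_distrib, ite_mul, one_mul, zero_mul]
      rw [Finset.sum_ite_eq' B, if_pos (Finset.mem_insert_self _ _), pow_mul]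
    rw [this]
    exact h k (by omega)
  have hg := growth B c Q Cst hQ0 (k0 + 1) hT
  have hcQ : c ((Q : ℂ) ^ 2) = 0 := by
    by_contra hne
    have := hg _ (Finset.mem_insert_self _ _) hne
    rw [norm_pow, Complex.norm_real, Real.norm_eq_abs, abs_of_pos hQ0] at this
    nlinarith
  have hcount : s2.count ((Q : ℂ) ^ 2) = 1 := by
    simp only [hc, if_true] at hcQ
    have : (s2.count ((Q : ℂ) ^ 2) : ℂ) = 1 := (sub_eq_zero.1 hcQ).symm
    exact_mod_cast this
  have hmem : (Q : ℂ) ^ 2 ∈ s2 := by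
    rw [← Multiset.count_pos]; omega
  obtain ⟨w0, hw0, hw0Q⟩ := Multiset.mem_map.1 hmem
  obtain ⟨ms', rfl⟩ := Multiset.exists_cons_of_mem hw0
  have hsmall : ∀ w ∈ ms', ‖w‖ ≤ Real.sqrt Q := by
    intro w hw
    have hne : w ^ 2 ≠ (Q : ℂ) ^ 2 := by
      intro heq
      rw [hs2, Multiset.map_cons, hw0Q, Multiset.count_cons_self] at hcount
      have : 0 < (ms'.map (fun w => w ^ 2)).count ((Q : ℂ) ^ 2) := by
        rw [Multiset.count_pos, ← heq]
        exact Multiset.mem_map_of_mem _ hw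
      omega
    have hin : w ^ 2 ∈ s2 := Multiset.mem_map_of_mem _ (Multiset.mem_cons_of_mem hw)
    have hcw : c (w ^ 2) ≠ 0 := by
      simp only [hc, if_neg hne, zero_sub, neg_ne_zero]
      have := Multiset.count_pos.2 hin
      exact_mod_cast this.ne'
    have := hg _ (Finset.mem_insert_of_mem (Multiset.mem_toFinset.2 hin)) hcw
    rw [norm_pow] at this
    exact Real.le_sqrt_of_sq_le this
  have hsum' : ‖ms'.sum‖ ≤ (m - 1) * Real.sqrt Q := by
    have h1 : ‖ms'.sum‖ ≤ (ms'.map norm).sum := by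
      exact Multiset.le_sum_of_subadditive norm norm_zero.le norm_add_le ms'
    have h2 : (ms'.map norm).sum ≤ ms'.card * Real.sqrt Q := by
      have := Multiset.sum_le_card_nsmul (ms'.map norm) (Real.sqrt Q) (by
        intro x hx
        obtain ⟨w, hw, rfl⟩ := Multiset.mem_map.1 hx
        exact hsmall w hw)
      simpa using this
    have h3 : (ms'.card : ℝ) ≤ m - 1 := by
      rw [Multiset.card_cons] at hcard
      have : (ms'.card : ℝ) + 1 ≤ m := by exact_mod_cast hcard
      linarith
    exact h1.trans (h2.trans (mul_le_mul_of_nonneg_right h3 (Real.sqrt_nonneg _)))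
  have hS1' := hS 1 le_rfl
  simp only [pow_one, Multiset.map_id', Multiset.sum_cons] at hS1'
  rcases sq_eq_sq_iff_eq_or_eq_neg.1 hw0Q with h1 | h1
  · rw [hS1', h1, sub_add_cancel_left, norm_neg]; exact hsum'
  · exfalso
    rw [h1] at hS1'
    have h2 : (2 * Q : ℂ) = S 1 + ms'.sum := by rw [hS1']; ring
    have h3 : 2 * Q ≤ Q + (m - 1) * Real.sqrt Q := by
      calc 2 * Q = ‖(2 * Q : ℂ)‖ := by
            rw [norm_mul, Complex.norm_real, Real.norm_eq_abs, abs_of_pos hQ0]; simp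
        _ ≤ ‖S 1‖ + ‖ms'.sum‖ := by rw [h2]; exact norm_add_le _ _
        _ ≤ _ := add_le_add hS1 hsum'
    have h4 := Real.sq_sqrt hQ0.le
    have h5 := Real.sqrt_pos.2 hQ0
    have h6 : (1 : ℝ) ≤ m := by exact_mod_cast hm
    have h7 : (m - 1 : ℝ) < Real.sqrt Q := by
      exact Real.lt_sqrt_of_sq_lt hQm
    nlinarith

end

section

open Polynomial

/-- generating series of the (negated) power sums. -/
noncomputable def psumSeries (ms : Multiset ℂ) : PowerSeries ℂ :=
  PowerSeries.mk (fun k => if k = 0 then 0 else (ms.map (fun w => w ^ k)).sum)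

lemma psum_single (w : ℂ) :
    PowerSeries.X * PowerSeries.derivative ℂ (1 - PowerSeries.C w * PowerSeries.X) =
      - psumSeries {w} * (1 - PowerSeries.C w * PowerSeries.X) := by
  have h1 : PowerSeries.derivative ℂ (1 - PowerSeries.C w * PowerSeries.X) = - PowerSeries.C w := by
    rw [map_sub, Derivation.map_one_eq_zero, Derivation.leibniz, PowerSeries.derivative_C]
    simp [PowerSeries.derivative_X]
  rw [h1]
  ext n
  rcases n with _ | n
  · simp [psumSeries]
  · have h2 : - psumSeries {w} * (1 - PowerSeries.C w * PowerSeries.X) =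
      - psumSeries {w} + PowerSeries.C w * psumSeries {w} * PowerSeries.X := by ring
    rw [h2, mul_comm PowerSeries.X, PowerSeries.coeff_succ_mul_X, map_add,
      PowerSeries.coeff_succ_mul_X, PowerSeries.coeff_C_mul]
    rcases n with _ | n
    · simp [psumSeries]
    · simp [psumSeries]
      ring

lemma psum_add (s t : Multiset ℂ) : psumSeries (s + t) = psumSeries s + psumSeries t := by
  ext n
  simp only [psumSeries, map_add, PowerSeries.coeff_mk]
  split_ifs <;> simp

lemma psum_prod (ms : Multiset ℂ) :
    PowerSeries.X * PowerSeries.derivative ℂ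
      ((ms.map (fun w => (1 - PowerSeries.C w * PowerSeries.X : PowerSeries ℂ))).prod) =
      - psumSeries ms * (ms.map (fun w => (1 - PowerSeries.C w * PowerSeries.X : PowerSeries ℂ))).prod := by
  induction ms using Multiset.induction_on with
  | empty =>
    have : psumSeries 0 = 0 := by ext n; simp [psumSeries]
    simp [this]
  | cons w ms ih =>
    rw [Multiset.map_cons, Multiset.prod_cons, Derivation.leibniz, smul_eq_mul, smul_eq_mul, mul_add,
      ← Multiset.singleton_add, psum_add]
    have := psum_single w
    linear_combination (1 - PowerSeries.C w * PowerSeries.X) * ih +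
      (ms.map (fun w => (1 - PowerSeries.C w * PowerSeries.X : PowerSeries ℂ))).prod * this

lemma exists_factor (P : ℂ[X]) (h0 : P.coeff 0 = 1) : ∃ ms : Multiset ℂ, ms.card ≤ P.natDegree ∧
    P = (ms.map (fun w => 1 - C w * X)).prod := by
  have hP : P ≠ 0 := by rintro rfl; simp at h0
  refine ⟨P.roots.map (fun a => a⁻¹), by simpa using card_roots' P, ?_⟩
  have h1 := (IsAlgClosed.splits P).eq_prod_roots
  have h2 : P.roots.map (fun a => X - C a) = P.roots.map (fun a => C (-a) * (1 - C a⁻¹ * X)) := by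
    refine Multiset.map_congr rfl (fun a ha => ?_)
    have ha0 : a ≠ 0 := by
      rintro rfl
      have := (mem_roots hP).1 ha
      rw [IsRoot, ← coeff_zero_eq_eval_zero, h0] at this
      exact one_ne_zero this
    rw [mul_sub, ← mul_assoc, ← C_mul, neg_mul, mul_inv_cancel₀ ha0]
    simp; ring
  rw [h2, Multiset.prod_map_mul, ← mul_assoc] at h1
  have h3 : (P.roots.map (fun a => (C (-a) : ℂ[X]))).prod = C ((P.roots.map (fun a => -a)).prod) := by
    rw [map_multiset_prod, Multiset.map_map]; rfl
  rw [h3, ← C_mul] at h1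
  have h4 := congrArg (eval 0) h1
  rw [← coeff_zero_eq_eval_zero, h0, eval_mul, eval_C, eval_multiset_prod, Multiset.map_map] at h4
  have h5 : (P.roots.map ((eval 0) ∘ fun a => (1 - C a⁻¹ * X : ℂ[X]))).prod = 1 := by
    refine Multiset.prod_eq_one (fun x hx => ?_)
    obtain ⟨b, -, rfl⟩ := Multiset.mem_map.1 hx
    simp
  rw [h5, mul_one] at h4
  rw [Multiset.map_map]
  conv_lhs => rw [h1]
  simp only [Function.comp_def]
  rw [← h4]; simp

lemma newton_series (a S : ℕ → ℂ) (Q : ℂ) (m : ℕ) (ha0 : a 0 = 1)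
    (hrec : ∀ n : ℕ, (n : ℂ) * a n = ∑ k ∈ Finset.Icc 1 n, S k * a (n - k))
    (hper : ∀ n ≥ m, a (n + 1) = Q * a n) :
    ∃ ms : Multiset ℂ, ms.card ≤ m ∧
      ∀ k ≥ 1, S k = Q ^ k - (ms.map (fun w => w ^ k)).sum := by
  set A : PowerSeries ℂ := PowerSeries.mk a with hA
  set s : PowerSeries ℂ := PowerSeries.mk (fun k => if k = 0 then 0 else S k) with hs
  have h1 : PowerSeries.X * PowerSeries.derivative ℂ A = s * A := by
    ext n
    have e1 : PowerSeries.coeff n (s * A) = ∑ k ∈ Finset.Icc 1 n, S k * a (n - k) := by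
      rw [PowerSeries.coeff_mul, Finset.Nat.sum_antidiagonal_eq_sum_range_succ
        (fun i j => PowerSeries.coeff i s * PowerSeries.coeff j A)]
      rw [Finset.sum_range_succ', ]
      simp only [hs, hA, PowerSeries.coeff_mk, if_true, zero_mul, add_zero, Nat.succ_ne_zero, if_false]
      rw [← Finset.sum_image (f := fun k => S k * a (n - k)) (g := fun k => k + 1) (by
        intro x _ y _ h; simpa using h)]
      refine Finset.sum_congr ?_ (fun _ _ => rfl)
      ext k
      simp only [Finset.mem_image, Finset.mem_range, Finset.mem_Icc]
      constructor
      · rintro ⟨x, hx, rfl⟩; omega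
      · intro h; exact ⟨k - 1, by omega, by omega⟩
    rw [e1, ← hrec]
    rcases n with _ | n
    · simp
    · rw [mul_comm, PowerSeries.coeff_succ_mul_X, PowerSeries.coeff_derivative, hA,
        PowerSeries.coeff_mk]
      push_cast; ring
  set lin : PowerSeries ℂ := 1 - PowerSeries.C Q * PowerSeries.X with hlin
  set M := A * lin with hM
  have hMc : ∀ n > m, PowerSeries.coeff n M = 0 := by
    intro n hn
    obtain ⟨n, rfl⟩ : ∃ k, n = k + 1 := ⟨n - 1, by omega⟩
    have : M = A - PowerSeries.C Q * A * PowerSeries.X := by rw [hM, hlin]; ring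
    rw [this, map_sub, PowerSeries.coeff_succ_mul_X, PowerSeries.coeff_C_mul, hA,
      PowerSeries.coeff_mk, PowerSeries.coeff_mk, hper n (by omega), sub_self]
  set P := PowerSeries.trunc (m + 1) M with hP
  have hPM : (P : PowerSeries ℂ) = M := by
    ext n
    rw [Polynomial.coeff_coe, hP, PowerSeries.coeff_trunc]
    split_ifs with h
    · rfl
    · exact (hMc n (by omega)).symm
  have hP0 : P.coeff 0 = 1 := by
    rw [hP, PowerSeries.coeff_trunc, if_pos (by omega), hM, hlin]
    simp [hA, ha0]
  obtain ⟨ms, hms, hfac⟩ := exists_factor P hP0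
  have hPdeg : P.natDegree ≤ m := by
    have := PowerSeries.natDegree_trunc_lt M m
    rw [hP]; omega
  refine ⟨ms, hms.trans hPdeg, ?_⟩
  have hMfac : M = (ms.map (fun w => (1 - PowerSeries.C w * PowerSeries.X : PowerSeries ℂ))).prod := by
    rw [← hPM, hfac]
    have : ∀ q : ℂ[X], (q : PowerSeries ℂ) = Polynomial.coeToPowerSeries.ringHom q := fun q => rfl
    rw [this, map_multiset_prod, Multiset.map_map]
    congr 1
    refine Multiset.map_congr rfl (fun w _ => ?_)
    simp
  have h2 := psum_prod ms
  rw [← hMfac] at h2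
  have h3 := psum_single Q
  rw [← hlin] at h3
  have h4 : PowerSeries.X * PowerSeries.derivative ℂ M = (s - psumSeries {Q}) * M := by
    rw [hM, Derivation.leibniz, smul_eq_mul, smul_eq_mul]
    linear_combination lin * h1 + A * h3
  have hMne : M ≠ 0 := by
    intro h
    have := hP0
    rw [hP, PowerSeries.coeff_trunc, if_pos (by omega), h] at this
    simp at this
  have h5 : s - psumSeries {Q} = - psumSeries ms := mul_right_cancel₀ hMne (h4.symm.trans h2)
  intro k hk
  have h6 := congrArg (PowerSeries.coeff k) h5
  simp only [hs, psumSeries, map_sub, map_neg, PowerSeries.coeff_mk, if_neg (show k ≠ 0 by omega)] at h6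
  simp at h6
  linear_combination h6

lemma weil_analytic (a S : ℕ → ℂ) (Q Cst : ℝ) (m k0 : ℕ) (ha0 : a 0 = 1)
    (hrec : ∀ n : ℕ, (n : ℂ) * a n = ∑ k ∈ Finset.Icc 1 n, S k * a (n - k))
    (hper : ∀ n ≥ m, a (n + 1) = Q * a n) (hQ : 1 < Q)
    (h : ∀ k ≥ k0, ‖S (2 * k)‖ ≤ Cst * Q ^ k) (hS1 : ‖S 1‖ ≤ Q)
    (hm : 1 ≤ m) (hQm : ((m : ℝ) - 1) ^ 2 < Q) :
    ‖S 1‖ ≤ (m - 1) * Real.sqrt Q := by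
  obtain ⟨ms, h1, h2⟩ := newton_series a S Q m ha0 hrec hper
  exact growth_apply ms Q Cst hQ k0 S h2 h hS1 m h1 hm hQm

end

section

open Polynomial

section
variable {L : Type} [Field L] [Fintype L]

lemma finite_monic_deg (n : ℕ) : {p : L[X] | p.Monic ∧ p.natDegree = n}.Finite := by
  have e := (monicEquivDegreeLT (R := L) n).trans (degreeLTEquiv L n).toEquiv
  exact Finite.of_equiv _ e.symm

/-- The monic polynomials of degree `n`. -/
noncomputable def Mon (L : Type) [Field L] [Fintype L] (n : ℕ) : Finset L[X] :=
  (finite_monic_deg (L := L) n).toFinset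

lemma mem_Mon {n : ℕ} {p : L[X]} : p ∈ Mon L n ↔ p.Monic ∧ p.natDegree = n := by
  simp [Mon]

lemma card_Mon (n : ℕ) : (Mon L n).card = Fintype.card L ^ n := by
  rw [Mon, ← Nat.card_eq_card_finite_toFinset]
  have e := (monicEquivDegreeLT (R := L) n).trans (degreeLTEquiv L n).toEquiv
  rw [show Nat.card {p : L[X] | p.Monic ∧ p.natDegree = n} = Nat.card (Fin n → L) from Nat.card_congr e]
  simp

/-- Monic irreducible polynomials of degree at most `n`. -/
noncomputable def IrrLe (L : Type) [Field L] [Fintype L] (n : ℕ) : Finset L[X] :=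
  open scoped Classical in ((Finset.range (n + 1)).biUnion (Mon L)).filter Irreducible

lemma mem_IrrLe {n : ℕ} {p : L[X]} :
    p ∈ IrrLe L n ↔ p.Monic ∧ p.natDegree ≤ n ∧ Irreducible p := by
  simp only [IrrLe, Finset.mem_filter, Finset.mem_biUnion, Finset.mem_range, mem_Mon]
  constructor
  · rintro ⟨⟨a, ha, hm, hd⟩, hi⟩; exact ⟨hm, by omega, hi⟩
  · rintro ⟨hm, hd, hi⟩; exact ⟨⟨_, by omega, hm, rfl⟩, hi⟩

open scoped Classical in
lemma deg_eq_sum (n : ℕ) (h : L[X]) (hh : h ∈ Mon L n) :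
    n = ∑ P ∈ IrrLe L n, ∑ e ∈ Finset.Icc 1 n, if P ^ e ∣ h then P.natDegree else 0 := by
  obtain ⟨hm, hd⟩ := mem_Mon.1 hh
  have h0 : h ≠ 0 := hm.ne_zero
  set s := UniqueFactorizationMonoid.normalizedFactors h with hs
  have hprod : s.prod = h := by
    have := UniqueFactorizationMonoid.prod_normalizedFactors_eq h0
    rw [hs, this, hm.normalize_eq_self]
  have hsm : ∀ P ∈ s, P.Monic ∧ Irreducible P ∧ P ∣ h := by
    intro P hP
    have hi := UniqueFactorizationMonoid.irreducible_of_normalized_factor P hP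
    refine ⟨?_, hi, UniqueFactorizationMonoid.dvd_of_mem_normalizedFactors hP⟩
    have := UniqueFactorizationMonoid.normalize_normalized_factor P hP
    rw [← this]
    exact monic_normalize hi.ne_zero
  have hdeg : n = ∑ P ∈ s.toFinset, s.count P * P.natDegree := by
    rw [← hd, ← hprod, natDegree_multiset_prod_of_monic _ (fun P hP => (hsm P hP).1),
      Finset.sum_multiset_map_count]
    simp
  have hsub : s.toFinset ⊆ IrrLe L n := by
    intro P hP
    rw [Multiset.mem_toFinset] at hP
    obtain ⟨h1, h2, h3⟩ := hsm P hP
    exact mem_IrrLe.2 ⟨h1, hd ▸ natDegree_le_of_dvd h3 h0, h2⟩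
  have hcnt : ∀ P ∈ IrrLe L n, (∑ e ∈ Finset.Icc 1 n, if P ^ e ∣ h then P.natDegree else 0) =
      s.count P * P.natDegree := by
    intro P hP
    obtain ⟨h1, h2, h3⟩ := mem_IrrLe.1 hP
    have hdvd : ∀ e, P ^ e ∣ h ↔ e ≤ s.count P := by
      intro e
      have h4 := UniqueFactorizationMonoid.emultiplicity_eq_count_normalizedFactors h3 h0
      rw [pow_dvd_iff_le_emultiplicity, h4, h1.normalize_eq_self, ← hs, Nat.cast_le]
    have hle : s.count P ≤ n := by
      have h5 : P ^ (s.count P) ∣ h := (hdvd _).2 le_rfl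
      have h6 := natDegree_le_of_dvd h5 h0
      rw [natDegree_pow, hd] at h6
      have h7 := h3.natDegree_pos
      nlinarith
    rw [← Finset.sum_filter, Finset.sum_const, smul_eq_mul]
    congr 1
    have : (Finset.Icc 1 n).filter (fun e => P ^ e ∣ h) = Finset.Icc 1 (s.count P) := by
      ext e
      rw [Finset.mem_filter, hdvd, Finset.mem_Icc, Finset.mem_Icc]; omega
    rw [this]; simp
  rw [Finset.sum_congr rfl hcnt]
  conv_lhs => rw [hdeg]
  refine Finset.sum_subset hsub (fun P _ hP => ?_)
  rw [Multiset.mem_toFinset] at hP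
  rw [Multiset.count_eq_zero_of_notMem hP, zero_mul]

variable (lam : L[X] → ℂ)

noncomputable def aSeq (n : ℕ) : ℂ := ∑ h ∈ Mon L n, lam h

noncomputable def sSeq (k : ℕ) : ℂ := ∑ P ∈ IrrLe L k,
  if P.natDegree ∣ k then (P.natDegree : ℂ) * lam P ^ (k / P.natDegree) else 0

lemma lam_pow (h1 : lam 1 = 1) (hmul : ∀ a b : L[X], a.Monic → b.Monic → lam (a * b) = lam a * lam b)
    (P : L[X]) (hP : P.Monic) (e : ℕ) : lam (P ^ e) = lam P ^ e := by
  induction e with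
  | zero => simp [h1]
  | succ e ih => rw [pow_succ, hmul _ _ (hP.pow e) hP, ih, pow_succ]

open scoped Classical in
lemma sum_dvd (h1 : lam 1 = 1) (hmul : ∀ a b : L[X], a.Monic → b.Monic → lam (a * b) = lam a * lam b)
    (n e : ℕ) (P : L[X]) (hP : P.Monic) :
    (∑ h ∈ Mon L n, if P ^ e ∣ h then lam h else 0) =
      if e * P.natDegree ≤ n then lam P ^ e * aSeq lam (n - e * P.natDegree) else 0 := by
  split_ifs with hle
  · rw [← Finset.sum_filter, aSeq, Finset.mul_sum]
    symm
    refine Finset.sum_bij (fun k _ => P ^ e * k) ?_ ?_ ?_ ?_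
    · intro k hk
      obtain ⟨hk1, hk2⟩ := mem_Mon.1 hk
      rw [Finset.mem_filter, mem_Mon]
      refine ⟨⟨(hP.pow e).mul hk1, ?_⟩, dvd_mul_right _ _⟩
      rw [(hP.pow e).natDegree_mul hk1, hP.natDegree_pow, hk2]; omega
    · intro a _ b _ hab
      exact mul_left_cancel₀ (hP.pow e).ne_zero hab
    · intro b hb
      rw [Finset.mem_filter, mem_Mon] at hb
      obtain ⟨⟨hb1, hb2⟩, k, rfl⟩ := hb
      have hk : k.Monic := (hP.pow e).of_mul_monic_left hb1
      refine ⟨k, mem_Mon.2 ⟨hk, ?_⟩, rfl⟩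
      rw [(hP.pow e).natDegree_mul hk, hP.natDegree_pow] at hb2; omega
    · intro k hk
      rw [hmul _ _ (hP.pow e) (mem_Mon.1 hk).1, lam_pow lam h1 hmul P hP]
  · refine Finset.sum_eq_zero (fun h hh => ?_)
    rw [if_neg]
    intro hd
    obtain ⟨hm, hn⟩ := mem_Mon.1 hh
    have := natDegree_le_of_dvd hd hm.ne_zero
    rw [hP.natDegree_pow, hn] at this
    exact hle this

lemma sSeq_eq (n k : ℕ) (hk : 1 ≤ k) (hkn : k ≤ n) : sSeq lam k = ∑ P ∈ IrrLe L n,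
    if P.natDegree ∣ k then (P.natDegree : ℂ) * lam P ^ (k / P.natDegree) else 0 := by
  refine Finset.sum_subset ?_ ?_
  · intro P hP
    obtain ⟨a, b, c⟩ := mem_IrrLe.1 hP
    exact mem_IrrLe.2 ⟨a, b.trans hkn, c⟩
  · intro P hP hP'
    rw [if_neg]
    intro hd
    obtain ⟨a, b, c⟩ := mem_IrrLe.1 hP
    exact hP' (mem_IrrLe.2 ⟨a, Nat.le_of_dvd hk hd, c⟩)

lemma aSeq_rec (h1 : lam 1 = 1) (hmul : ∀ a b : L[X], a.Monic → b.Monic → lam (a * b) = lam a * lam b)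
    (n : ℕ) : (n : ℂ) * aSeq lam n =
    ∑ k ∈ Finset.Icc 1 n, sSeq lam k * aSeq lam (n - k) := by
  classical
  have e1 : (n : ℂ) * aSeq lam n = ∑ P ∈ IrrLe L n, ∑ e ∈ Finset.Icc 1 n,
      (P.natDegree : ℂ) * (if e * P.natDegree ≤ n then lam P ^ e * aSeq lam (n - e * P.natDegree) else 0) := by
    rw [aSeq, Finset.mul_sum]
    have : ∀ h ∈ Mon L n, (n : ℂ) * lam h = ∑ P ∈ IrrLe L n, ∑ e ∈ Finset.Icc 1 n,
        (P.natDegree : ℂ) * (if P ^ e ∣ h then lam h else 0) := by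
      intro h hh
      conv_lhs => rw [deg_eq_sum n h hh]
      push_cast
      simp only [Finset.sum_mul]
      refine Finset.sum_congr rfl (fun P _ => Finset.sum_congr rfl (fun e _ => ?_))
      split_ifs <;> simp
    rw [Finset.sum_congr rfl this, Finset.sum_comm]
    refine Finset.sum_congr rfl (fun P hP => ?_)
    rw [Finset.sum_comm]
    refine Finset.sum_congr rfl (fun e _ => ?_)
    rw [← Finset.mul_sum, sum_dvd lam h1 hmul n e P (mem_IrrLe.1 hP).1]
  rw [e1]
  have e2 : ∀ k ∈ Finset.Icc 1 n, sSeq lam k * aSeq lam (n - k) = ∑ P ∈ IrrLe L n,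
      (if P.natDegree ∣ k then (P.natDegree : ℂ) * lam P ^ (k / P.natDegree) else 0) *
        aSeq lam (n - k) := by
    intro k hk
    rw [Finset.mem_Icc] at hk
    rw [sSeq_eq lam n k hk.1 hk.2, Finset.sum_mul]
  rw [Finset.sum_congr rfl e2]
  conv_rhs => rw [Finset.sum_comm]
  refine Finset.sum_congr rfl (fun P hP => ?_)
  have hpos := (mem_IrrLe.1 hP).2.2.natDegree_pos
  simp only [mul_ite, mul_zero, ite_mul, zero_mul]
  rw [← Finset.sum_filter, ← Finset.sum_filter]
  refine Finset.sum_bij (fun e _ => e * P.natDegree) ?_ ?_ ?_ ?_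
  · intro e he
    rw [Finset.mem_filter, Finset.mem_Icc] at he ⊢
    refine ⟨⟨?_, he.2⟩, dvd_mul_left _ _⟩
    nlinarith [he.1.1]
  · intro a _ b _ hab
    exact Nat.eq_of_mul_eq_mul_right hpos hab
  · intro k hk
    rw [Finset.mem_filter, Finset.mem_Icc] at hk
    obtain ⟨⟨hk1, hk2⟩, c, rfl⟩ := hk
    refine ⟨c, ?_, mul_comm _ _⟩
    rw [Finset.mem_filter, Finset.mem_Icc]
    refine ⟨⟨?_, ?_⟩, by rw [mul_comm]; exact hk2⟩
    · rcases Nat.eq_zero_or_pos c with rfl | h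
      · simp at hk1
      · exact h
    · nlinarith
  · intro e _
    rw [Nat.mul_div_cancel _ hpos]; ring

lemma aSeq_per (R : L[X]) (hR : R.Monic) (hmod : ∀ a b : L[X], a.Monic → b.Monic → R ∣ a - b →
    lam a = lam b) (n : ℕ) (hn : R.natDegree ≤ n) :
    aSeq lam (n + 1) = Fintype.card L * aSeq lam n := by
  classical
  have key : ∀ n, R.natDegree ≤ n → aSeq lam n =
      (Fintype.card L : ℂ) ^ (n - R.natDegree) * aSeq lam R.natDegree := by
    intro n hn
    have hdeg : ∀ a : L[X], a.Monic → a.natDegree = R.natDegree → (a - R).degree < R.degree := by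
      intro a ha had
      have h0 : a.degree = R.degree := by
        rw [degree_eq_natDegree hR.ne_zero, degree_eq_natDegree ha.ne_zero, had]
      rw [← h0]
      exact degree_sub_lt_left h0 ha.ne_zero (by rw [ha, hR])
    have : aSeq lam n = ∑ x ∈ Mon L R.natDegree ×ˢ Mon L (n - R.natDegree), lam x.1 := by
      rw [aSeq]
      symm
      refine Finset.sum_bij (fun x _ => (x.1 - R) + R * x.2) ?_ ?_ ?_ ?_
      · rintro ⟨a, k⟩ hx
        simp only [Finset.mem_product, mem_Mon] at hx ⊢
        obtain ⟨⟨ha, had⟩, hk, hkd⟩ := hx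
        have hlt : (a - R).degree < (R * k).degree := by
          refine (hdeg a ha had).trans_le ?_
          rw [mul_comm, hR.degree_mul]
          exact le_add_of_nonneg_left (zero_le_degree_iff.2 hk.ne_zero)
        refine ⟨(hR.mul hk).add_of_right hlt, ?_⟩
        rw [natDegree_add_eq_right_of_degree_lt hlt, hR.natDegree_mul hk, hkd]; omega
      · rintro ⟨a, k⟩ hx ⟨a', k'⟩ hx' heq
        simp only [Finset.mem_product, mem_Mon] at hx hx' heq
        obtain ⟨⟨ha, had⟩, hk, hkd⟩ := hx
        obtain ⟨⟨ha', had'⟩, hk', hkd'⟩ := hx'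
        have h2 := div_modByMonic_unique k (a - R) hR ⟨rfl, hdeg a ha had⟩
        have h3 := div_modByMonic_unique (f := (a - R) + R * k) k' (a' - R) hR ⟨heq.symm, hdeg a' ha' had'⟩
        rw [h2.1, h2.2] at h3
        exact Prod.ext (sub_left_injective h3.2) h3.1
      · intro b hb
        rw [mem_Mon] at hb
        refine ⟨⟨b %ₘ R + R, b /ₘ R⟩, ?_, ?_⟩
        · simp only [Finset.mem_product, mem_Mon]
          have hlt := degree_modByMonic_lt b hR
          refine ⟨⟨hR.add_of_right hlt, natDegree_add_eq_right_of_degree_lt hlt⟩, ?_, ?_⟩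
          · rw [Monic, leadingCoeff_divByMonic_of_monic hR, hb.1]
            rw [degree_eq_natDegree hR.ne_zero, degree_eq_natDegree hb.1.ne_zero, hb.2]
            exact_mod_cast hn
          · rw [natDegree_divByMonic b hR, hb.2]
        · simp only [add_sub_cancel_right]
          exact modByMonic_add_div b R
      · rintro ⟨a, k⟩ hx
        simp only [Finset.mem_product, mem_Mon] at hx
        obtain ⟨⟨ha, had⟩, hk, hkd⟩ := hx
        have hlt : (a - R).degree < (R * k).degree := by
          refine (hdeg a ha had).trans_le ?_
          rw [mul_comm, hR.degree_mul]
          exact le_add_of_nonneg_left (zero_le_degree_iff.2 hk.ne_zero)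
        exact hmod _ _ ha ((hR.mul hk).add_of_right hlt) ⟨1 - k, by ring⟩
    rw [this, Finset.sum_product]
    simp only [Finset.sum_const, card_Mon, nsmul_eq_mul]
    rw [← Finset.mul_sum, aSeq]; push_cast; rfl
  rw [key (n + 1) (by omega), key n hn, Nat.succ_sub hn, pow_succ]; ring
end

end

section

open Polynomial

section
variable {L K : Type} [Field L] [Fintype L] [Field K] [Fintype K] [Algebra L K]

lemma sSeq_ext (lam : L[X] → ℂ) (k : ℕ) (hk : Module.finrank L K = k) :
    sSeq lam k = ∑ x : K, lam (minpoly L x) ^ (k / (minpoly L x).natDegree) := by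
  classical
  have hfd : FiniteDimensional L K := Module.Finite.of_finite
  have hkpos : 0 < k := hk ▸ Module.finrank_pos
  have hmem : ∀ x ∈ (Finset.univ : Finset K), minpoly L x ∈ IrrLe L k := by
    intro x _
    have hi : IsIntegral L x := Algebra.IsIntegral.isIntegral x
    exact mem_IrrLe.2 ⟨minpoly.monic hi, hk ▸ minpoly.natDegree_le x, minpoly.irreducible hi⟩
  rw [sSeq, ← Finset.sum_fiberwise_of_maps_to hmem]
  refine Finset.sum_congr rfl (fun P hP => ?_)
  obtain ⟨hm, hd, hi⟩ := mem_IrrLe.1 hP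
  have h1 : ∑ x : K with minpoly L x = P, lam (minpoly L x) ^ (k / (minpoly L x).natDegree) =
      ∑ x : K with minpoly L x = P, lam P ^ (k / P.natDegree) := by
    refine Finset.sum_congr rfl (fun x hx => ?_)
    rw [Finset.mem_filter] at hx
    rw [hx.2]
  rw [h1, Finset.sum_const, nsmul_eq_mul]
  split_ifs with hdk
  · congr 2
    have hdvd : P ∣ X ^ (Fintype.card K) - X := by
      have h2 := (hi.natDegree_dvd_iff_dvd_X_pow_card_pow_sub_X (n := k)).1 hdk
      rw [Fintype.card_eq_nat_card, Module.natCard_eq_pow_finrank (K := L), hk]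
      exact h2
    have hsp : (P.map (algebraMap L K)).Splits := by
      have := FiniteField.isSplittingField_sub K L
      refine Splits.of_dvd (IsSplittingField.splits K (X ^ (Fintype.card K) - X : L[X])) ?_ (Polynomial.map_dvd _ hdvd)
      exact map_ne_zero (FiniteField.X_pow_card_sub_X_ne_zero L Fintype.one_lt_card)
    have h3 := card_rootSet_eq_natDegree (K := K) (PerfectField.separable_of_irreducible hi) hsp
    rw [← h3]
    rw [← Set.toFinset_card]
    congr 1
    ext x
    rw [Set.mem_toFinset, Finset.mem_filter, mem_rootSet]
    constructor
    · rintro ⟨_, h⟩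
      exact (minpoly.eq_of_irreducible_of_monic hi h hm).symm ▸ ⟨Finset.mem_univ _, rfl⟩
    · rintro ⟨_, rfl⟩
      exact ⟨hi.ne_zero, minpoly.aeval L x⟩
  · have : (Finset.univ.filter (fun x : K => minpoly L x = P)) = ∅ := by
      rw [Finset.filter_eq_empty_iff]
      rintro x _ rfl
      exact hdk (hk ▸ minpoly.degree_dvd (Algebra.IsIntegral.isIntegral x))
    rw [this]; simp

lemma norm_eval_eq (F : L[X]) (x : K) :
    Algebra.norm L (aeval x F) =
      (resultant (minpoly L x) F) ^ (Module.finrank L K / (minpoly L x).natDegree) := by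
  classical
  have hfd : FiniteDimensional L K := Module.Finite.of_finite
  have hi : IsIntegral L x := Algebra.IsIntegral.isIntegral x
  set M := IntermediateField.adjoin L {x} with hM
  let pb := IntermediateField.adjoin.powerBasis hi
  have hgen : pb.gen = IntermediateField.AdjoinSimple.gen L x := by
    simp [pb]
  have hmin : minpoly L pb.gen = minpoly L x := by
    rw [hgen, IntermediateField.minpoly_gen]
  have e1 : aeval x F = algebraMap M K (aeval pb.gen F) := by
    rw [← aeval_algebraMap_apply, hgen, IntermediateField.AdjoinSimple.algebraMap_gen]
  have e2 : Algebra.norm L (aeval pb.gen F) = resultant (minpoly L x) F := by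
    let E := AlgebraicClosure L
    apply (algebraMap L E).injective
    rw [Algebra.norm_eq_prod_embeddings L E]
    have hnd : ((minpoly L pb.gen).aroots E).Nodup := by
      refine nodup_aroots_iff_of_splits (minpoly.ne_zero (Algebra.IsIntegral.isIntegral _)) (IsAlgClosed.splits _) |>.2 ?_
      exact PerfectField.separable_of_irreducible (minpoly.irreducible (Algebra.IsIntegral.isIntegral _))
    have e3 := resultant_map_map (minpoly L x) F (minpoly L x).natDegree F.natDegree (algebraMap L E)
    rw [← e3]
    have e4 := resultant_eq_prod_eval ((minpoly L x).map (algebraMap L E)) (F.map (algebraMap L E))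
      F.natDegree natDegree_map_le (IsAlgClosed.splits _)
    rw [natDegree_map] at e4
    rw [e4, leadingCoeff_map, (minpoly.monic hi).leadingCoeff, map_one, one_pow, one_mul]
    have e5 : ∏ σ : M →ₐ[L] E, σ (aeval pb.gen F) =
        ∏ y : {y // y ∈ (minpoly L pb.gen).aroots E}, (F.map (algebraMap L E)).eval y.1 := by
      refine Fintype.prod_equiv pb.liftEquiv' _ _ (fun σ => ?_)
      rw [eval_map_algebraMap, PowerBasis.liftEquiv'_apply_coe, ← aeval_algHom_apply]
    rw [e5, Finset.prod_mem_multiset _ _ (fun y => (F.map (algebraMap L E)).eval y) (fun _ => rfl),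
      ]
    rw [Finset.prod_eq_multiset_prod, Multiset.toFinset_val, Multiset.dedup_eq_self.2 hnd, hmin]
  rw [e1, ← Algebra.norm_norm (S := M), Algebra.norm_algebraMap, map_pow, e2]
  congr 1
  have := Module.finrank_mul_finrank L M K
  rw [IntermediateField.adjoin.finrank hi] at this
  rw [← this, Nat.mul_div_cancel_left _ (minpoly.natDegree_pos hi)]
end

end

section

open Polynomial

lemma mulChar_norm_le {L : Type} [Field L] [Fintype L] (η : MulChar L ℂ) (x : L) : ‖η x‖ ≤ 1 := by
  by_cases hx : x = 0
  · subst hx; rw [MulChar.map_zero]; simp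
  · refine (Complex.norm_eq_one_of_pow_eq_one (n := Fintype.card L - 1) ?_ ?_).le
    · rw [← map_pow, FiniteField.pow_card_sub_one_eq_one x hx, map_one]
    · have := Fintype.one_lt_card (α := L); omega

/-- Composition of a multiplicative character with the norm. -/
noncomputable def normChar {L : Type} (K : Type) [Field L] [Fintype L] [Field K] [Fintype K] [Algebra L K]
    (η : MulChar L ℂ) : MulChar K ℂ where
  toMonoidHom := η.toMonoidHom.comp (Algebra.norm L)
  map_nonunit' := by
    intro a ha
    have : a = 0 := by simpa using ha
    subst this
    simp [Algebra.norm_zero, MulChar.map_zero]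

lemma normChar_apply {L : Type} {K : Type} [Field L] [Fintype L] [Field K] [Fintype K] [Algebra L K]
    (η : MulChar L ℂ) (x : K) : normChar K η x = η (Algebra.norm L x) := rfl

lemma pow_card_pow_eq {L : Type} [Field L] [Fintype L] (F : L[X]) (s : ℕ) :
    F ^ (Fintype.card L ^ s) = F.comp (X ^ (Fintype.card L ^ s)) := by
  rw [← expand_eq_comp_X_pow]
  induction s with
  | zero => simp
  | succ s ih =>
    rw [pow_succ, pow_mul, ← FiniteField.expand_card, ih, expand_expand, mul_comm]

lemma ext_bound {L : Type} [Field L] [Fintype L] (p : ℕ) [Fact p.Prime] [CharP L p] (η : MulChar L ℂ) (hη : η ≠ 1) (d : ℕ) (hd : 0 < d)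
    (hdQ : d ∣ Fintype.card L - 1) (hηd : η ^ d = 1) (F : L[X]) (hF0 : F ≠ 0)
    (hF : ∀ n, (∀ a : AlgebraicClosure L, d ∣ n * (F.map (algebraMap L (AlgebraicClosure L))).rootMultiplicity a) → d ∣ n)
    (s : ℕ) (hs : 16 * (F.natDegree + 2) * (d + 1) ≤ s)
    (K : Type) [Field K] [Fintype K] [Algebra L K] (hK : Module.finrank L K = 2 * s) :
    ‖∑ x : K, η (Algebra.norm L (aeval x F))‖ ≤
      (2 * d * (5 * F.natDegree + 9) + F.natDegree) * (Fintype.card L : ℝ) ^ s := by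
  classical
  have hcp : CharP K p := charP_of_injective_algebraMap (algebraMap L K).injective p
  obtain ⟨f, _, hf⟩ := FiniteField.card L p
  set Q := Fintype.card L with hQ
  have hQ1 : 1 < Q := Fintype.one_lt_card
  let ψ : K[X] →+* AlgebraicClosure (FractionRing K[X]) :=
    (algebraMap (FractionRing K[X]) (AlgebraicClosure (FractionRing K[X]))).comp (algebraMap K[X] (FractionRing K[X]))
  have hψ : Function.Injective ψ := by
    intro a b hab
    exact IsFractionRing.injective K[X] (FractionRing K[X]) ((algebraMap (FractionRing K[X]) (AlgebraicClosure (FractionRing K[X]))).injective hab)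
  have hcardK : Fintype.card K = (Q ^ s) ^ 2 := by
    rw [Fintype.card_eq_nat_card, Module.natCard_eq_pow_finrank (K := L), hK, ← Fintype.card_eq_nat_card, ← pow_mul, mul_comm]
  have hdeg : (F.map (algebraMap L K)).natDegree = F.natDegree := natDegree_map _
  have hsQ : s < Q ^ s := Nat.lt_pow_self hQ1
  have key := charsum_bound ψ hψ p (f * s) (Q ^ s) d F.natDegree (by rw [hf, ← pow_mul]) hcardK hd
    (hdQ.trans (by simpa using Nat.sub_dvd_pow_sub_pow Q 1 s))
    (F.map (algebraMap L K)) (Polynomial.map_ne_zero hF0) hdeg.le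
    (by rw [← Polynomial.map_pow, pow_card_pow_eq, map_comp]; simp [hQ])
    (by
      intro n hn
      refine hF n (fun a => ?_)
      let : Algebra L (AlgebraicClosure (FractionRing K[X])) := ((ψ.comp C).comp (algebraMap L K)).toAlgebra
      let ι : AlgebraicClosure L →ₐ[L] AlgebraicClosure (FractionRing K[X]) := IsAlgClosed.lift
      have h1 := hn (ι a)
      rw [Polynomial.map_map] at h1
      have h2 : (ψ.comp C).comp (algebraMap L K) = (ι : AlgebraicClosure L →+* _).comp (algebraMap L (AlgebraicClosure L)) := by
        ext x
        exact (ι.commutes x).symm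
      rw [h2, ← Polynomial.map_map] at h1
      have h3 := eq_rootMultiplicity_map (p := F.map (algebraMap L (AlgebraicClosure L))) (f := (ι : AlgebraicClosure L →+* AlgebraicClosure (FractionRing K[X]))) (RingHom.injective _) a
      rw [h3]
      exact h1)
    (hs.trans hsQ.le)
    (normChar K η)
    (by
      intro h
      apply hη
      ext u
      obtain ⟨v, hv⟩ := FiniteField.unitsMap_norm_surjective L K u
      have h1 : normChar K η v = 1 := by rw [h]; exact MulChar.one_apply v.isUnit
      rw [normChar_apply] at h1
      rw [MulChar.one_apply u.isUnit, ← h1, ← hv]; rfl)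
    (by
      ext u
      have h1 : (η ^ d) (Algebra.norm L (u : K)) = 1 := by
        rw [hηd]; exact MulChar.one_apply (u.isUnit.map (Algebra.norm L))
      rw [MulChar.pow_apply_coe, normChar_apply, MulChar.one_apply u.isUnit, ← h1, MulChar.pow_apply' _ hd.ne'])
  simp only [normChar_apply, eval_map_algebraMap] at key
  refine key.trans ?_
  push_cast
  have h1 : (1 : ℝ) ≤ (Q : ℝ) ^ s := one_le_pow₀ (by exact_mod_cast hQ1.le)
  have h2 : (0 : ℝ) ≤ F.natDegree := by positivity
  nlinarith

lemma weil_core {L : Type} [Field L] [Fintype L] (η : MulChar L ℂ) (hη : η ≠ 1) (d : ℕ) (hd : 0 < d)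
    (hdQ : d ∣ Fintype.card L - 1) (hηd : η ^ d = 1) (g₀ g₁ g₂ F : L[X]) (e₀ e₁ e₂ m : ℕ)
    (h₀ : g₀.Monic) (h₁ : g₁.Monic) (h₂ : g₂.Monic) (hFdef : F = g₀ ^ e₀ * g₁ ^ e₁ * g₂ ^ e₂)
    (hF : ∀ n, (∀ a : AlgebraicClosure L, d ∣ n * (F.map (algebraMap L (AlgebraicClosure L))).rootMultiplicity a) → d ∣ n)
    (hm : (g₀ * g₁ * g₂).natDegree ≤ m) (hm1 : 1 ≤ m) (hQm : ((m : ℝ) - 1) ^ 2 < Fintype.card L) :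
    ‖∑ x : L, η (F.eval x)‖ ≤ (m - 1) * Real.sqrt (Fintype.card L) := by
  classical
  obtain ⟨p, hp⟩ := CharP.exists L
  have hpp : Fact p.Prime := ⟨CharP.char_is_prime L p⟩
  have hFm : F.Monic := hFdef ▸ ((h₀.pow e₀).mul (h₁.pow e₁)).mul (h₂.pow e₂)
  set lam : L[X] → ℂ := fun h => η (resultant F h) with hlam
  have hmodg : ∀ g a b : L[X], g.Monic → a.Monic → b.Monic → g ∣ a - b → resultant g a = resultant g b := by
    intro g a b hg ha hb hab
    let E := AlgebraicClosure L
    apply (algebraMap L E).injective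
    have e4 : ∀ c : L[X], algebraMap L E (resultant g c) =
        ((g.map (algebraMap L E)).roots.map (c.map (algebraMap L E)).eval).prod := by
      intro c
      have e5 := resultant_eq_prod_eval (g.map (algebraMap L E)) (c.map (algebraMap L E))
        c.natDegree natDegree_map_le (IsAlgClosed.splits _)
      rw [natDegree_map, leadingCoeff_map, hg.leadingCoeff, map_one, one_pow, one_mul, resultant_map_map] at e5
      exact e5
    rw [e4, e4]
    congr 1
    refine Multiset.map_congr rfl (fun x hx => ?_)
    have hx0 : (g.map (algebraMap L E)).eval x = 0 := (mem_roots'.1 hx).2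
    obtain ⟨c, hc⟩ := hab
    have h5 : a = b + g * c := by rw [← hc]; ring
    rw [h5]; simp only [Polynomial.map_add, Polynomial.map_mul, eval_add, eval_mul, hx0]; ring
  have hlam1 : lam 1 = 1 := by
    simp [hlam]
  have hmul : ∀ a b : L[X], a.Monic → b.Monic → lam (a * b) = lam a * lam b := by
    intro a b ha hb
    simp only [hlam]
    rw [ha.natDegree_mul hb, resultant_mul_right _ _ _ _ le_rfl, map_mul]
  have hFres : ∀ h : L[X], resultant F h = resultant g₀ h ^ e₀ * resultant g₁ h ^ e₁ * resultant g₂ h ^ e₂ := by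
    intro h
    rw [hFdef, ((h₀.pow e₀).mul (h₁.pow e₁)).natDegree_mul (h₂.pow e₂),
      resultant_mul_left _ _ _ _ le_rfl, (h₀.pow e₀).natDegree_mul (h₁.pow e₁), resultant_mul_left _ _ _ _ le_rfl,
      resultant_pow_left _ _ _ _ (by simp [h₀.leadingCoeff]) le_rfl, resultant_pow_left _ _ _ _ (by simp [h₁.leadingCoeff]) le_rfl, resultant_pow_left _ _ _ _ (by simp [h₂.leadingCoeff]) le_rfl]
  have hmod : ∀ a b : L[X], a.Monic → b.Monic → g₀ * g₁ * g₂ ∣ a - b → lam a = lam b := by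
    intro a b ha hb hab
    simp only [hlam]
    rw [hFres, hFres, hmodg g₀ a b h₀ ha hb, hmodg g₁ a b h₁ ha hb, hmodg g₂ a b h₂ ha hb]
    · exact (Dvd.intro_left _ rfl).trans hab
    · exact ((Dvd.intro_left _ rfl).mul_right _).trans hab
    · exact ((Dvd.intro _ rfl).mul_right _).trans hab
  have hS : ∀ (k : ℕ) (K : Type) [Field K] [Fintype K] [Algebra L K], Module.finrank L K = k →
      ‖sSeq lam k‖ = ‖∑ x : K, η (Algebra.norm L (aeval x F))‖ := by
    intro k K _ _ _ hk
    have hfd : FiniteDimensional L K := Module.Finite.of_finite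
    rw [sSeq_ext (K := K) lam k hk]
    have : ∀ x : K, lam (minpoly L x) ^ (k / (minpoly L x).natDegree) =
        η ((-1) ^ (F.natDegree * k)) * η (Algebra.norm L (aeval x F)) := by
      intro x
      rw [norm_eval_eq, hk, ← map_mul]
      simp only [hlam]
      rw [resultant_comm, ← map_pow, mul_pow, ← pow_mul, mul_assoc]
      congr 4
      exact Nat.mul_div_cancel' (hk ▸ minpoly.degree_dvd (Algebra.IsIntegral.isIntegral x))
    rw [Finset.sum_congr rfl (fun x _ => this x), ← Finset.mul_sum, norm_mul]
    have h1 : ‖η ((-1) ^ (F.natDegree * k))‖ = 1 := by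
      refine Complex.norm_eq_one_of_pow_eq_one (n := 2) ?_ two_ne_zero
      rw [← map_pow, ← pow_mul, mul_comm, pow_mul]; simp
    rw [h1, one_mul]
  have hS1 : ‖sSeq lam 1‖ = ‖∑ x : L, η (F.eval x)‖ := by
    rw [hS 1 L (Module.finrank_self L)]
    simp [Algebra.norm_self, coe_aeval_eq_eval]
  rw [← hS1]
  refine weil_analytic (aSeq lam) (sSeq lam) (Fintype.card L)
    (2 * d * (5 * F.natDegree + 9) + F.natDegree) m (16 * (F.natDegree + 2) * (d + 1)) ?_
    (aSeq_rec lam hlam1 hmul) (fun n hn => ?_) (by exact_mod_cast Fintype.one_lt_card) (fun k hk => ?_) ?_ hm1 hQm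
  · have : Mon L 0 = {1} := by
      ext a
      rw [mem_Mon, Finset.mem_singleton]
      constructor
      · rintro ⟨h, h'⟩; exact (Monic.natDegree_eq_zero h).1 h'
      · rintro rfl; exact ⟨monic_one, natDegree_one⟩
    rw [aSeq, this, Finset.sum_singleton, hlam1]
  · have := aSeq_per lam (g₀ * g₁ * g₂) ((h₀.mul h₁).mul h₂) hmod n (hm.trans hn)
    rw [this]; simp
  · have hkpos : 0 < k := lt_of_lt_of_le (by positivity) hk
    have : NeZero (2 * k) := ⟨by omega⟩
    have : Fintype (FiniteField.Extension L p (2 * k)) := Fintype.ofFinite _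
    rw [hS (2 * k) (FiniteField.Extension L p (2 * k)) (FiniteField.finrank_extension L p (2 * k))]
    exact ext_bound p η hη d hd hdQ hηd F hFm.ne_zero hF k hk _ (FiniteField.finrank_extension L p (2 * k))
  · rw [hS1]
    refine (norm_sum_le _ _).trans ?_
    refine (Finset.sum_le_sum (fun x _ => mulChar_norm_le η _)).trans ?_
    simp

end

section

open Polynomial

lemma rootMultiplicity_pow_aux {E : Type} [Field E] {p : E[X]} (hp : p ≠ 0) (n : ℕ) (a : E) :
    (p ^ n).rootMultiplicity a = n * p.rootMultiplicity a := by
  induction n with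
  | zero => simp [rootMultiplicity_eq_zero]
  | succ n ih => rw [pow_succ, rootMultiplicity_mul (mul_ne_zero (pow_ne_zero n hp) hp), ih]; ring

lemma rootMult_g {L : Type} [Field L] [Fintype L] (g H : L[X]) (k : ℕ) (hgm : g.Monic) (hg : Irreducible g)
    (hgX : g ≠ X) (h1 : g ^ k ∣ H) (h2 : ¬ g ^ (k + 1) ∣ H) :
    ∃ a : AlgebraicClosure L, a ≠ 0 ∧ (H.map (algebraMap L (AlgebraicClosure L))).rootMultiplicity a = k := by
  have hdeg : g.degree ≠ 0 := (degree_pos_of_irreducible hg).ne'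
  obtain ⟨a, ha⟩ := IsAlgClosed.exists_aeval_eq_zero (AlgebraicClosure L) g hdeg
  have hmin : g = minpoly L a := minpoly.eq_of_irreducible_of_monic hg ha hgm
  obtain ⟨h, rfl⟩ := h1
  have hgh : ¬ g ∣ h := by
    rintro ⟨c, rfl⟩
    exact h2 ⟨c, by ring⟩
  have hh0 : h ≠ 0 := by rintro rfl; exact hgh (dvd_zero _)
  refine ⟨a, ?_, ?_⟩
  · rintro rfl
    apply hgX
    rw [hmin, minpoly.zero]
  · have hne : (g.map (algebraMap L (AlgebraicClosure L))) ≠ 0 := Polynomial.map_ne_zero hg.ne_zero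
    have hne' : (h.map (algebraMap L (AlgebraicClosure L))) ≠ 0 := Polynomial.map_ne_zero hh0
    rw [Polynomial.map_mul, rootMultiplicity_mul (mul_ne_zero (by simpa using pow_ne_zero k hne) hne'),
      Polynomial.map_pow, rootMultiplicity_pow_aux hne]
    have e1 : rootMultiplicity a (h.map (algebraMap L (AlgebraicClosure L))) = 0 := by
      apply rootMultiplicity_eq_zero
      intro hr
      rw [IsRoot.def, eval_map_algebraMap] at hr
      exact hgh (hmin ▸ minpoly.dvd L a hr)
    have e2 : rootMultiplicity a (g.map (algebraMap L (AlgebraicClosure L))) = 1 := by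
      apply le_antisymm
      · exact rootMultiplicity_le_one_of_separable ((PerfectField.separable_of_irreducible hg).map) a
      · rw [Nat.one_le_iff_ne_zero, ← Nat.pos_iff_ne_zero]
        rw [rootMultiplicity_pos hne, IsRoot.def, eval_map_algebraMap, ha]
    rw [e1, e2]; ring

lemma mult_cond {L : Type} [Field L] [Fintype L] (f₁ f₂ g : L[X]) (k i j d : ℕ)
    (hf₁ : f₁ ≠ 0) (hf₂ : f₂ ≠ 0) (hco : IsCoprime f₁ f₂) (hgm : g.Monic) (hg : Irreducible g)
    (hgX : g ≠ X) (h1 : g ^ k ∣ f₁ * f₂) (h2 : ¬ g ^ (k + 1) ∣ f₁ * f₂) (hkd : Nat.Coprime k d)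
    (hij : Nat.Coprime (Nat.gcd i j) d) (hd : 2 ≤ d) (n : ℕ)
    (hn : ∀ a : AlgebraicClosure L, d ∣ n * ((X ^ i * f₁ ^ j * f₂ ^ ((d - 1) * j)).map (algebraMap L (AlgebraicClosure L))).rootMultiplicity a) : d ∣ n := by
  set E := AlgebraicClosure L
  set φ := algebraMap L E
  have hF1 : f₁.map φ ≠ 0 := Polynomial.map_ne_zero hf₁
  have hF2 : f₂.map φ ≠ 0 := Polynomial.map_ne_zero hf₂
  have hrm : ∀ a : E, ((X ^ i * f₁ ^ j * f₂ ^ ((d - 1) * j)).map φ).rootMultiplicity a =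
      i * (X : E[X]).rootMultiplicity a + j * (f₁.map φ).rootMultiplicity a +
        ((d - 1) * j) * (f₂.map φ).rootMultiplicity a := by
    intro a
    have hx : (X : E[X]) ^ i ≠ 0 := pow_ne_zero _ X_ne_zero
    have hy := pow_ne_zero j hF1
    have hz := pow_ne_zero ((d - 1) * j) hF2
    simp only [Polynomial.map_mul, Polynomial.map_pow, map_X]
    rw [rootMultiplicity_mul (mul_ne_zero (mul_ne_zero hx hy) hz), rootMultiplicity_mul (mul_ne_zero hx hy),
      rootMultiplicity_pow_aux X_ne_zero, rootMultiplicity_pow_aux hF1, rootMultiplicity_pow_aux hF2]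
  obtain ⟨a, ha, hak⟩ := rootMult_g g (f₁ * f₂) k hgm hg hgX h1 h2
  rw [Polynomial.map_mul, rootMultiplicity_mul (mul_ne_zero hF1 hF2)] at hak
  have hd1 : ∀ z : ℕ, d ∣ n * ((d - 1) * z) → d ∣ n * z := by
    intro z hz
    have e : n * ((d - 1) * z) + n * z = d * (n * z) := by
      obtain ⟨c, rfl⟩ : ∃ c, d = c + 1 := ⟨d - 1, by omega⟩
      simp only [Nat.add_sub_cancel]; ring
    exact (Nat.dvd_add_right hz).1 (e ▸ dvd_mul_right _ _)
  have hX0 : (X : E[X]).rootMultiplicity a = 0 := by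
    apply rootMultiplicity_eq_zero
    simpa using ha
  have hnj : d ∣ n * j := by
    have h3 := hn a
    rw [hrm, hX0] at h3
    have hor : (f₁.map φ).rootMultiplicity a = 0 ∨ (f₂.map φ).rootMultiplicity a = 0 := by
      by_contra hcon
      push Not at hcon
      have r1 := (rootMultiplicity_pos hF1).1 (Nat.pos_of_ne_zero hcon.1)
      have r2 := (rootMultiplicity_pos hF2).1 (Nat.pos_of_ne_zero hcon.2)
      obtain ⟨u, v, huv⟩ := hco
      have h4 := congrArg (fun p => (p.map φ).eval a) huv
      simp only [Polynomial.map_add, Polynomial.map_mul, eval_add, eval_mul, r1.eq_zero, r2.eq_zero] at h4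
      simp at h4
    have h5 : d ∣ n * j * k := by
      rcases hor with h6 | h6
      · rw [h6] at h3 hak
        rw [zero_add] at hak
        rw [hak] at h3
        have := hd1 (j * k) (by convert h3 using 1; ring)
        rwa [← mul_assoc] at this
      · rw [h6] at h3 hak
        rw [add_zero] at hak
        rw [hak] at h3
        convert h3 using 1; ring
    exact (Nat.Coprime.dvd_of_dvd_mul_right hkd.symm h5)
  have hni : d ∣ n * i := by
    have h3 := hn 0
    have hX1 : (X : E[X]).rootMultiplicity 0 = 1 := by
      simpa using rootMultiplicity_X_sub_C_self (x := (0 : E))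
    rw [hrm, hX1] at h3
    have e : n * (i * 1 + j * (f₁.map φ).rootMultiplicity 0 + ((d - 1) * j) * (f₂.map φ).rootMultiplicity 0) =
      n * i + n * j * ((f₁.map φ).rootMultiplicity 0 + (d - 1) * (f₂.map φ).rootMultiplicity 0) := by ring
    rw [e] at h3
    exact (Nat.dvd_add_left (hnj.mul_right _)).1 h3
  have h7 : d ∣ n * Nat.gcd i j := by
    rw [← Nat.gcd_mul_left]
    exact Nat.dvd_gcd hni hnj
  exact Nat.Coprime.dvd_of_dvd_mul_right hij.symm h7

/-- The Weil bound in the form we need (monic version). -/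
lemma weil_monic {L : Type} [Field L] [Fintype L] [DecidableEq L] (χ : MulChar L ℂ)
    (hχ : orderOf χ = Fintype.card L - 1)
    (f₁ f₂ g : L[X]) (k i j : ℕ) (hm₁ : f₁.Monic) (hm₂ : f₂.Monic) (hd₁ : f₁.natDegree ≤ 3) (hd₂ : f₂.natDegree ≤ 2)
    (hco : IsCoprime f₁ f₂) (hgm : g.Monic) (hg : Irreducible g)
    (hgX : g ≠ X) (h1 : g ^ k ∣ f₁ * f₂) (h2 : ¬ g ^ (k + 1) ∣ f₁ * f₂)
    (hkd : Nat.gcd k (Fintype.card L - 1) = 1) (hQ : 25 < Fintype.card L)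
    (hij : ¬ (Fintype.card L - 1 ∣ i ∧ Fintype.card L - 1 ∣ j)) :
    ‖∑ x : L with (x ≠ 0 ∧ f₁.eval x ≠ 0 ∧ f₂.eval x ≠ 0), χ x ^ i * χ (f₁.eval x / f₂.eval x) ^ j‖ ≤
      5 * Real.sqrt (Fintype.card L) := by
  set D := Fintype.card L - 1 with hD
  have hDpos : 0 < D := by omega
  set i₂ := i + D
  set j₂ := j + D
  set g₀ := Nat.gcd (Nat.gcd i₂ j₂) D with hg₀
  have hg0pos : 0 < g₀ := Nat.gcd_pos_of_pos_right _ hDpos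
  obtain ⟨d, hd⟩ : g₀ ∣ D := Nat.gcd_dvd_right _ _
  have hgij : g₀ ∣ Nat.gcd i₂ j₂ := Nat.gcd_dvd_left _ _
  obtain ⟨i', hi'⟩ : g₀ ∣ i₂ := hgij.trans (Nat.gcd_dvd_left _ _)
  obtain ⟨j', hj'⟩ : g₀ ∣ j₂ := hgij.trans (Nat.gcd_dvd_right _ _)
  have hcop : Nat.Coprime (Nat.gcd i' j') d := by
    have e : g₀ * Nat.gcd (Nat.gcd i' j') d = g₀ * 1 := by
      rw [← Nat.gcd_mul_left, ← Nat.gcd_mul_left, ← hi', ← hj', ← hd, mul_one]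
    exact Nat.eq_of_mul_eq_mul_left hg0pos e
  have hdpos : 0 < d := Nat.pos_of_ne_zero (by rintro rfl; simp at hd; omega)
  have hd2 : 2 ≤ d := by
    by_contra hcon
    have hd1 : d = 1 := by omega
    rw [hd1, mul_one] at hd
    refine hij ⟨?_, ?_⟩
    · have : D ∣ i + D := ⟨i', by conv_rhs => rw [hd, ← hi']⟩
      exact (Nat.dvd_add_left (dvd_refl D)).1 this
    · have : D ∣ j + D := ⟨j', by conv_rhs => rw [hd, ← hj']⟩
      exact (Nat.dvd_add_left (dvd_refl D)).1 this
  have hi'pos : i' ≠ 0 := by rintro rfl; simp [i₂] at hi'; omega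
  have hj'pos : j' ≠ 0 := by rintro rfl; simp [j₂] at hj'; omega
  have hχD : ∀ y : L, y ≠ 0 → χ y ^ D = 1 := by
    intro y hy
    rw [← map_pow, FiniteField.pow_card_sub_one_eq_one y hy, map_one]
  set η := χ ^ g₀ with hη
  have hηapp : ∀ y : L, η y = χ y ^ g₀ := fun y => MulChar.pow_apply' χ hg0pos.ne' y
  have hη1 : η ≠ 1 := by
    intro h
    have := orderOf_dvd_of_pow_eq_one h
    rw [hχ, hd] at this
    have := Nat.le_of_dvd hg0pos this
    nlinarith
  have hηd : η ^ d = 1 := by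
    rw [hη, ← pow_mul, ← hd, ← hχ, pow_orderOf_eq_one]
  have key := weil_core η hη1 d hdpos ⟨g₀, hd.trans (mul_comm _ _)⟩ hηd X f₁ f₂ (X ^ i' * f₁ ^ j' * f₂ ^ ((d - 1) * j'))
    i' j' ((d - 1) * j') 6 monic_X hm₁ hm₂ rfl
    (mult_cond f₁ f₂ g k i' j' d hm₁.ne_zero hm₂.ne_zero hco hgm hg hgX h1 h2
      (Nat.Coprime.coprime_dvd_right ⟨g₀, hd.trans (mul_comm _ _)⟩ hkd) hcop hd2)
    (by rw [(monic_X.mul hm₁).natDegree_mul hm₂, monic_X.natDegree_mul hm₁, natDegree_X]; omega) (by norm_num)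
    (by
      norm_num; exact hQ)
  norm_num at key
  refine le_trans (le_of_eq ?_) key
  congr 1
  rw [Finset.sum_filter]
  refine Finset.sum_congr rfl (fun x _ => ?_)
  have hdj : (d - 1) * j' ≠ 0 := mul_ne_zero (by omega) hj'pos
  split_ifs with hx
  · obtain ⟨hx0, hx1, hx2⟩ := hx
    rw [hηapp, hηapp, hηapp, div_eq_mul_inv, map_mul]
    have e1 : χ x ^ i = (χ x ^ g₀) ^ i' := by
      rw [← pow_mul, ← hi', pow_add, hχD x hx0, mul_one]
    have e2 : χ (f₁.eval x) ^ j = (χ (f₁.eval x) ^ g₀) ^ j' := by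
      rw [← pow_mul, ← hj', pow_add, hχD _ hx1, mul_one]
    have e3 : χ ((f₂.eval x)⁻¹) ^ j = (χ (f₂.eval x) ^ g₀) ^ ((d - 1) * j') := by
      have e4 : χ (f₂.eval x) ^ j * χ ((f₂.eval x)⁻¹) ^ j = 1 := by
        rw [← mul_pow, ← map_mul, mul_inv_cancel₀ hx2, map_one, one_pow]
      have e5 : χ (f₂.eval x) ^ j * (χ (f₂.eval x) ^ g₀) ^ ((d - 1) * j') = 1 := by
        have e6 : χ (f₂.eval x) ^ j = (χ (f₂.eval x) ^ g₀) ^ j' := by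
          rw [← pow_mul, ← hj', pow_add, hχD _ hx2, mul_one]
        rw [e6, ← pow_add, show j' + (d - 1) * j' = d * j' by
          obtain ⟨c, rfl⟩ : ∃ c, d = c + 1 := ⟨d - 1, by omega⟩
          simp only [Nat.add_sub_cancel]; ring, pow_mul, ← pow_mul _ g₀ d, ← hd, hχD _ hx2, one_pow]
      have hne : χ (f₂.eval x) ^ j ≠ 0 := left_ne_zero_of_mul_eq_one e4
      exact mul_left_cancel₀ hne (e4.trans e5.symm)
    rw [mul_pow, e1, e2, e3, mul_assoc]
  · rw [eq_comm]
    by_cases hx0 : x = 0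
    · subst hx0; rw [MulChar.map_zero, zero_pow hi'pos]; simp
    by_cases hx1 : f₁.eval x = 0
    · rw [hx1, MulChar.map_zero, zero_pow hj'pos]; simp
    by_cases hx2 : f₂.eval x = 0
    · rw [hx2, MulChar.map_zero, zero_pow hdj]; simp
    exact absurd ⟨hx0, hx1, hx2⟩ hx

/-- The Weil bound in the form we need. -/
lemma weil_gen {L : Type} [Field L] [Fintype L] [DecidableEq L] (χ : MulChar L ℂ)
    (hχ : orderOf χ = Fintype.card L - 1)
    (f₁ f₂ g : L[X]) (k i j : ℕ) (hf₁ : f₁ ≠ 0) (hf₂ : f₂ ≠ 0) (hd₁ : f₁.natDegree ≤ 3) (hd₂ : f₂.natDegree ≤ 2)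
    (hco : IsCoprime f₁ f₂) (hgm : g.Monic) (hg : Irreducible g)
    (hgX : g ≠ X) (h1 : g ^ k ∣ f₁ * f₂) (h2 : ¬ g ^ (k + 1) ∣ f₁ * f₂)
    (hkd : Nat.gcd k (Fintype.card L - 1) = 1) (hQ : 25 < Fintype.card L)
    (hij : ¬ (Fintype.card L - 1 ∣ i ∧ Fintype.card L - 1 ∣ j)) :
    ‖∑ x : L with (x ≠ 0 ∧ f₁.eval x ≠ 0 ∧ f₂.eval x ≠ 0), χ x ^ i * χ (f₁.eval x / f₂.eval x) ^ j‖ ≤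
      5 * Real.sqrt (Fintype.card L) := by
  have hc₁ : f₁.leadingCoeff ≠ 0 := leadingCoeff_ne_zero.2 hf₁
  have hc₂ : f₂.leadingCoeff ≠ 0 := leadingCoeff_ne_zero.2 hf₂
  set c₁ := f₁.leadingCoeff
  set c₂ := f₂.leadingCoeff
  obtain ⟨m₁, hm₁, e₁⟩ : ∃ m₁ : L[X], m₁.Monic ∧ f₁ = C c₁ * m₁ :=
    ⟨f₁ * C c₁⁻¹, monic_mul_leadingCoeff_inv hf₁, by
      rw [mul_comm, mul_assoc, ← C_mul, inv_mul_cancel₀ hc₁]; simp⟩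
  obtain ⟨m₂, hm₂, e₂⟩ : ∃ m₂ : L[X], m₂.Monic ∧ f₂ = C c₂ * m₂ :=
    ⟨f₂ * C c₂⁻¹, monic_mul_leadingCoeff_inv hf₂, by
      rw [mul_comm, mul_assoc, ← C_mul, inv_mul_cancel₀ hc₂]; simp⟩
  have hu₁ : IsUnit (C c₁) := isUnit_C.2 hc₁.isUnit
  have hu₂ : IsUnit (C c₂) := isUnit_C.2 hc₂.isUnit
  have hdv : ∀ h : L[X], h ∣ f₁ * f₂ ↔ h ∣ m₁ * m₂ := by
    intro h
    rw [e₁, e₂, show C c₁ * m₁ * (C c₂ * m₂) = (C c₁ * C c₂) * (m₁ * m₂) by ring, (hu₁.mul hu₂).dvd_mul_left]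
  have hn₁ : f₁.natDegree = m₁.natDegree := by rw [e₁, natDegree_C_mul hc₁]
  have hn₂ : f₂.natDegree = m₂.natDegree := by rw [e₂, natDegree_C_mul hc₂]
  have hco' : IsCoprime m₁ m₂ := by
    rw [e₁, e₂] at hco
    exact (isCoprime_mul_unit_left_left hu₁ _ _).1 ((isCoprime_mul_unit_left_right hu₂ _ _).1 hco)
  have key := weil_monic χ hχ m₁ m₂ g k i j hm₁ hm₂ (hn₁ ▸ hd₁) (hn₂ ▸ hd₂) hco' hgm hg hgX ((hdv _).1 h1)
    (fun h => h2 ((hdv _).2 h)) hkd hQ hij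
  refine le_trans (le_of_eq ?_) key
  have hv₁ : ∀ x, f₁.eval x = c₁ * m₁.eval x := fun x => by conv_lhs => rw [e₁, eval_mul, eval_C]
  have hv₂ : ∀ x, f₂.eval x = c₂ * m₂.eval x := fun x => by conv_lhs => rw [e₂, eval_mul, eval_C]
  have hset : (Finset.univ.filter fun x : L => x ≠ 0 ∧ f₁.eval x ≠ 0 ∧ f₂.eval x ≠ 0) =
      Finset.univ.filter fun x : L => x ≠ 0 ∧ m₁.eval x ≠ 0 ∧ m₂.eval x ≠ 0 := by
    ext x
    simp [hv₁, hv₂, hc₁, hc₂]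
  have hterm : ∀ x : L, χ x ^ i * χ (f₁.eval x / f₂.eval x) ^ j =
      χ (c₁ / c₂) ^ j * (χ x ^ i * χ (m₁.eval x / m₂.eval x) ^ j) := by
    intro x
    rw [hv₁, hv₂, mul_div_mul_comm, map_mul, mul_pow]; ring
  have hone : ‖χ (c₁ / c₂) ^ j‖ = 1 := by
    rw [norm_pow, Complex.norm_eq_one_of_pow_eq_one (n := Fintype.card L - 1), one_pow]
    · rw [← map_pow, FiniteField.pow_card_sub_one_eq_one _ (div_ne_zero hc₁ hc₂), map_one]
    · omega
  rw [hset, Finset.sum_congr rfl (fun x _ => hterm x), ← Finset.mul_sum, norm_mul, hone, one_mul]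

end

section

section
variable {α I : Type} [Fintype I] [DecidableEq I]

lemma sieve_expand (X : Finset α) (n : I → ℕ) (hn : ∀ i, 0 < n i) (φ : I → α → ℂ) (E : ℝ)
    (H : ∀ s : I → ℕ, (∀ i, s i < n i) → s ≠ 0 → ‖∑ x ∈ X, ∏ i, φ i x ^ s i‖ ≤ E)
    (c : I → ℕ → ℂ) :
    ‖∑ x ∈ X, ∏ i, ∑ s ∈ Finset.range (n i), c i s * φ i x ^ s - X.card * ∏ i, c i 0‖ ≤
      E * (∏ i, ∑ s ∈ Finset.range (n i), ‖c i s‖ - ∏ i, ‖c i 0‖) := by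
  classical
  set S := Fintype.piFinset (fun i => Finset.range (n i)) with hS
  have h0 : (0 : I → ℕ) ∈ S := by
    rw [hS, Fintype.mem_piFinset]; intro i; simpa using hn i
  have e1 : ∑ x ∈ X, ∏ i, ∑ s ∈ Finset.range (n i), c i s * φ i x ^ s =
      ∑ s ∈ S, (∏ i, c i (s i)) * ∑ x ∈ X, ∏ i, φ i x ^ s i := by
    have : ∀ x ∈ X, ∏ i, ∑ s ∈ Finset.range (n i), c i s * φ i x ^ s =
        ∑ s ∈ S, (∏ i, c i (s i)) * ∏ i, φ i x ^ s i := by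
      intro x _
      rw [Finset.prod_univ_sum]
      exact Finset.sum_congr rfl (fun s _ => Finset.prod_mul_distrib)
    rw [Finset.sum_congr rfl this, Finset.sum_comm]
    exact Finset.sum_congr rfl (fun s _ => by rw [Finset.mul_sum])
  have e2 : ∏ i, ∑ s ∈ Finset.range (n i), ‖c i s‖ = ∑ s ∈ S, ∏ i, ‖c i (s i)‖ := by
    rw [Finset.prod_univ_sum]
  rw [e1, e2, ← Finset.add_sum_erase S _ h0, ← Finset.add_sum_erase S _ h0]
  simp only [Pi.zero_apply, pow_zero, Finset.prod_const_one, Finset.sum_const, nsmul_eq_mul, mul_one]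
  rw [show (∏ i, c i 0) * (X.card : ℂ) + (∑ s ∈ S.erase 0, (∏ i, c i (s i)) * ∑ x ∈ X, ∏ i, φ i x ^ s i) -
    X.card * ∏ i, c i 0 = ∑ s ∈ S.erase 0, (∏ i, c i (s i)) * ∑ x ∈ X, ∏ i, φ i x ^ s i by ring, add_sub_cancel_left,
    Finset.mul_sum]
  refine (norm_sum_le _ _).trans (Finset.sum_le_sum (fun s hs => ?_))
  rw [Finset.mem_erase, hS, Fintype.mem_piFinset] at hs
  rw [norm_mul, norm_prod, mul_comm]
  refine mul_le_mul_of_nonneg_right (H s (fun i => by simpa using hs.2 i) hs.1) ?_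
  exact Finset.prod_nonneg (fun _ _ => norm_nonneg _)

/-- The orthogonality relation for roots of unity of prime order. -/
lemma root_indicator (n : ℕ) (hn : 0 < n) (z : ℂ) (hz : z ^ n = 1) :
    ∑ s ∈ Finset.range n, (1 / n : ℂ) * z ^ s = if z = 1 then 1 else 0 := by
  have hn' : (n : ℂ) ≠ 0 := by exact_mod_cast hn.ne'
  rw [← Finset.mul_sum]
  split_ifs with h
  · subst h; simp; field_simp
  · rw [geom_sum_eq h, hz]; simp

/-- The sieve inequality. -/
lemma sieve_ineq (X : Finset α) (n : I → ℕ) (hn : ∀ i, 2 ≤ n i) (φ : I → α → ℂ) (E : ℝ)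
    (hφ : ∀ i, ∀ x ∈ X, φ i x ^ n i = 1)
    (H : ∀ s : I → ℕ, (∀ i, s i < n i) → s ≠ 0 → ‖∑ x ∈ X, ∏ i, φ i x ^ s i‖ ≤ E)
    (B T : Finset I) (hBT : Disjoint B T) (δ θ : ℝ) (hδ : δ = 1 - ∑ i ∈ T, (1 / n i : ℝ)) (hδ0 : 0 ≤ δ)
    (hθ : θ = ∏ i ∈ B, (1 - 1 / n i : ℝ)) (S : Finset α)
    (hS : ∀ x ∈ X, (∀ i ∈ B ∪ T, φ i x ≠ 1) → x ∈ S) :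
    θ * (δ * X.card - E * (2 ^ B.card * (T.card - 1 + 2 * δ) - δ)) ≤ S.card := by
  classical
  have hn0 : ∀ i, 0 < n i := fun i => by have := hn i; omega
  have hnR : ∀ i, (2 : ℝ) ≤ n i := fun i => by exact_mod_cast hn i
  -- base part
  let cB : I → ℕ → ℂ := fun i s => if i ∈ B then (if s = 0 then 1 else 0) - 1 / n i else (if s = 0 then 1 else 0)
  have hsum : ∀ i x, x ∈ X → ∑ s ∈ Finset.range (n i), (if s = 0 then (1 : ℂ) else 0) * φ i x ^ s = 1 := by
    intro i x _
    rw [Finset.sum_eq_single 0]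
    · simp
    · intro b _ hb; simp [hb]
    · intro h; exact absurd (Finset.mem_range.2 (hn0 i)) h
  have hsumn : ∀ i, ∑ s ∈ Finset.range (n i), ‖(if s = 0 then (1 : ℂ) else 0)‖ = 1 := by
    intro i
    rw [Finset.sum_eq_single 0]
    · simp
    · intro b _ hb; simp [hb]
    · intro h; exact absurd (Finset.mem_range.2 (hn0 i)) h
  have hval : ∀ i, ∀ x ∈ X, ∑ s ∈ Finset.range (n i), cB i s * φ i x ^ s =
      if i ∈ B then (if φ i x = 1 then 0 else 1) else 1 := by
    intro i x hx
    by_cases hi : i ∈ B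
    · simp only [cB, hi, if_true, sub_mul, Finset.sum_sub_distrib]
      rw [hsum i x hx, root_indicator _ (hn0 i) _ (hφ i x hx)]
      split_ifs <;> simp
    · simp only [cB, hi, if_false]
      exact hsum i x hx
  have hsplit : ∀ (i : I) (f : ℕ → ℝ), ∑ s ∈ Finset.range (n i), f s = f 0 + ∑ s ∈ Finset.Ico 1 (n i), f s := by
    intro i f
    rw [Finset.range_eq_Ico, Finset.sum_eq_sum_Ico_succ_bot (hn0 i)]
  have hninv : ∀ i, ‖(1 / n i : ℂ)‖ = 1 / n i := by intro i; simp
  have hc0 : ∀ i, ‖(1 - 1 / n i : ℂ)‖ = 1 - 1 / n i := by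
    intro i
    have h1 : (1 - 1 / n i : ℂ) = ((1 - 1 / n i : ℝ) : ℂ) := by push_cast; rfl
    rw [h1, Complex.norm_real, Real.norm_of_nonneg]
    have := hnR i
    rw [sub_nonneg, div_le_one (by linarith)]; linarith
  have hl1 : ∀ i, ∑ s ∈ Finset.range (n i), ‖cB i s‖ = if i ∈ B then 2 * (1 - 1 / n i : ℝ) else 1 := by
    intro i
    have := hnR i
    by_cases hi : i ∈ B
    · simp only [cB, hi, if_true]
      rw [hsplit]
      rw [Finset.sum_congr rfl (g := fun _ => (1 / n i : ℝ))]
      · rw [if_pos rfl, hc0, Finset.sum_const, Nat.card_Ico, nsmul_eq_mul, Nat.cast_sub (hn0 i)]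
        push_cast; field_simp; ring
      · intro s hs
        rw [Finset.mem_Ico] at hs
        rw [if_neg (by omega), zero_sub, norm_neg, hninv]
    · simp only [cB, hi, if_false]
      exact hsumn i
  have hcB0 : ∀ i, cB i 0 = if i ∈ B then ((1 - 1 / n i : ℝ) : ℂ) else 1 := by
    intro i; simp only [cB]; split_ifs <;> simp
  have hcB0n : ∀ i, ‖cB i 0‖ = if i ∈ B then (1 - 1 / n i : ℝ) else 1 := by
    intro i; simp only [cB]; split_ifs <;> simp [-one_div, hc0]
  have hprodB : ∏ i, (if i ∈ B then (1 - 1 / n i : ℝ) else 1) = θ := by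
    rw [hθ, Finset.prod_ite_mem, Finset.univ_inter]
  have hprodB2 : ∏ i, (if i ∈ B then 2 * (1 - 1 / n i : ℝ) else 1) = 2 ^ B.card * θ := by
    rw [hθ, Finset.prod_ite_mem, Finset.univ_inter, Finset.prod_mul_distrib, Finset.prod_const]
  have hθ0 : 0 ≤ θ := by
    rw [hθ]
    refine Finset.prod_nonneg (fun i _ => ?_)
    have := hnR i
    rw [sub_nonneg, div_le_one (by linarith)]; linarith
  -- counting function of base
  let w : α → ℝ := fun x => if ∀ i ∈ B, φ i x ≠ 1 then 1 else 0
  have hw : ∀ x ∈ X, ∏ i, ∑ s ∈ Finset.range (n i), cB i s * φ i x ^ s = (w x : ℂ) := by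
    intro x hx
    rw [Finset.prod_congr rfl (fun i _ => hval i x hx), Finset.prod_ite_mem, Finset.univ_inter]
    simp only [w]
    split_ifs with h
    · rw [Finset.prod_eq_one (fun i hi => by rw [if_neg (h i hi)])]; simp
    · push Not at h
      obtain ⟨i, hi, h1⟩ := h
      rw [Finset.prod_eq_zero hi (by rw [if_pos h1])]; simp
  have hbase : |∑ x ∈ X, w x - X.card * θ| ≤ E * (2 ^ B.card * θ - θ) := by
    have key := sieve_expand X n hn0 φ E H cB
    rw [Finset.sum_congr rfl hw, Finset.prod_congr rfl (fun i _ => hl1 i),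
      Finset.prod_congr rfl (fun i _ => hcB0n i), hprodB, hprodB2] at key
    have h1 : ∏ i, cB i 0 = ((θ : ℝ) : ℂ) := by
      rw [← hprodB, Finset.prod_congr rfl (fun i _ => hcB0 i)]
      push_cast
      refine Finset.prod_congr rfl (fun i _ => ?_)
      split_ifs <;> simp
    rw [h1] at key
    rw [← Real.norm_eq_abs, ← Complex.norm_real]
    push_cast
    exact key
  -- the sieving part
  have hsv : ∀ t ∈ T, |∑ x ∈ X, w x * ((if φ t x = 1 then 1 else 0) - 1 / n t)| ≤
      E * (2 ^ B.card * θ * (1 - 1 / n t)) := by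
    intro t ht
    have htB : t ∉ B := fun h => Finset.disjoint_left.1 hBT h ht
    let c : I → ℕ → ℂ := fun i s => if i = t then (if s = 0 then 0 else 1 / n i) else cB i s
    have key := sieve_expand X n hn0 φ E H c
    have k1 : ∀ x ∈ X, ∏ i, ∑ s ∈ Finset.range (n i), c i s * φ i x ^ s =
        ((w x * ((if φ t x = 1 then 1 else 0) - 1 / n t) : ℝ) : ℂ) := by
      intro x hx
      rw [← Finset.mul_prod_erase _ _ (Finset.mem_univ t)]
      have h1 : ∑ s ∈ Finset.range (n t), c t s * φ t x ^ s = (((if φ t x = 1 then 1 else 0) - 1 / n t : ℝ) : ℂ) := by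
        have h2 := root_indicator _ (hn0 t) _ (hφ t x hx)
        rw [Finset.range_eq_Ico, Finset.sum_eq_sum_Ico_succ_bot (hn0 t)] at h2 ⊢
        have h3 : ∑ k ∈ Finset.Ico (0 + 1) (n t), c t k * φ t x ^ k = ∑ k ∈ Finset.Ico (0 + 1) (n t), (1 / n t : ℂ) * φ t x ^ k := by
          refine Finset.sum_congr rfl (fun s hs => ?_)
          rw [Finset.mem_Ico] at hs
          simp only [c, if_true]
          rw [if_neg (by omega)]
        rw [h3]
        have h4 : c t 0 = 0 := by simp [c]
        rw [h4]
        have h5 : (((if φ t x = 1 then 1 else 0) - 1 / n t : ℝ) : ℂ) = (if φ t x = 1 then 1 else 0) - 1 / n t := by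
          push_cast; split_ifs <;> simp
        rw [h5, ← h2]; ring
      rw [h1]
      have h6 : ∏ i ∈ Finset.univ.erase t, ∑ s ∈ Finset.range (n i), c i s * φ i x ^ s = (w x : ℂ) := by
        rw [← hw x hx, ← Finset.mul_prod_erase _ _ (Finset.mem_univ t), hval t x hx, if_neg htB, one_mul]
        refine Finset.prod_congr rfl (fun i hi => ?_)
        have hit := Finset.ne_of_mem_erase hi
        simp only [c, hit, if_false]
      rw [h6]; push_cast; ring
    have k2 : ∏ i, c i 0 = 0 := Finset.prod_eq_zero (Finset.mem_univ t) (by simp [c])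
    have k3 : ∏ i, ‖c i 0‖ = 0 := Finset.prod_eq_zero (Finset.mem_univ t) (by simp [c])
    have k4 : ∏ i, ∑ s ∈ Finset.range (n i), ‖c i s‖ = 2 ^ B.card * θ * (1 - 1 / n t) := by
      rw [← hprodB2, ← Finset.mul_prod_erase _ _ (Finset.mem_univ t),
        ← Finset.mul_prod_erase _ (fun i => if i ∈ B then 2 * (1 - 1 / n i : ℝ) else 1) (Finset.mem_univ t)]
      have h1 : ∑ s ∈ Finset.range (n t), ‖c t s‖ = 1 - 1 / n t := by
        rw [hsplit, Finset.sum_congr rfl (g := fun _ => (1 / n t : ℝ))]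
        · have := hnR t
          simp only [c, if_true, norm_zero]
          rw [Finset.sum_const, Nat.card_Ico, nsmul_eq_mul, Nat.cast_sub (hn0 t)]
          push_cast; field_simp; ring
        · intro s hs
          rw [Finset.mem_Ico] at hs
          simp only [c, if_true]
          rw [if_neg (by omega), hninv]
      rw [h1]
      simp only [htB, if_false, one_mul]
      rw [mul_comm]
      congr 1
      refine Finset.prod_congr rfl (fun i hi => ?_)
      have hit := Finset.ne_of_mem_erase hi
      rw [← hl1 i]
      simp only [c, hit, if_false]
    rw [Finset.sum_congr rfl k1, k2, k3, k4, mul_zero, sub_zero, sub_zero, ← Complex.ofReal_sum, Complex.norm_real, Real.norm_eq_abs] at key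
    exact key
  -- combine
  have hcount : ∑ x ∈ X, w x * (1 - ∑ t ∈ T, (if φ t x = 1 then (1 : ℝ) else 0)) ≤ S.card := by
    have h1 : ∑ x ∈ X, w x * (1 - ∑ t ∈ T, (if φ t x = 1 then (1 : ℝ) else 0)) ≤ ∑ x ∈ X, if x ∈ S then (1 : ℝ) else 0 := by
      refine Finset.sum_le_sum (fun x hx => ?_)
      have hnn : 0 ≤ ∑ t ∈ T, (if φ t x = 1 then (1 : ℝ) else 0) :=
        Finset.sum_nonneg (fun t _ => by split_ifs <;> norm_num)
      simp only [w]
      split_ifs with h2 h3 h3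
      · linarith
      · have : ∃ t ∈ T, φ t x = 1 := by
          by_contra hcon
          push Not at hcon
          apply h3
          refine hS x hx (fun i hi => ?_)
          rcases Finset.mem_union.1 hi with h | h
          · exact h2 i h
          · exact hcon i h
        obtain ⟨t, ht, h4⟩ := this
        have h5 := Finset.single_le_sum (f := fun t => if φ t x = 1 then (1 : ℝ) else 0) (fun t _ => by split_ifs <;> norm_num) ht
        simp only [h4, if_true] at h5
        linarith
      · simp
      · simp
    refine h1.trans ?_
    rw [← Finset.sum_filter, Finset.sum_const, nsmul_eq_mul, mul_one]
    have h2 : X.filter (fun x => x ∈ S) ⊆ S := by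
      intro x hx; exact (Finset.mem_filter.1 hx).2
    exact_mod_cast Finset.card_le_card h2
  have hrew : ∑ x ∈ X, w x * (1 - ∑ t ∈ T, (if φ t x = 1 then (1 : ℝ) else 0)) =
      δ * ∑ x ∈ X, w x - ∑ t ∈ T, ∑ x ∈ X, w x * ((if φ t x = 1 then 1 else 0) - 1 / n t) := by
    rw [Finset.sum_comm, Finset.mul_sum, ← Finset.sum_sub_distrib]
    refine Finset.sum_congr rfl (fun x _ => ?_)
    rw [← Finset.mul_sum, Finset.sum_sub_distrib, hδ]; ring
  have hb1 := (abs_le.1 hbase).1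
  have hb2 : ∑ t ∈ T, ∑ x ∈ X, w x * ((if φ t x = 1 then 1 else 0) - 1 / n t) ≤
      E * (2 ^ B.card * θ * (T.card - (1 - δ))) := by
    refine (Finset.sum_le_sum (fun t ht => (abs_le.1 (hsv t ht)).2)).trans (le_of_eq ?_)
    rw [← Finset.mul_sum, ← Finset.mul_sum, Finset.sum_sub_distrib, hδ]; simp
  have hb3 := mul_le_mul_of_nonneg_left hb1 hδ0
  rw [hrew] at hcount
  nlinarith [hcount, hb2, hb3]
end

end

section

lemma prime_sum_dvd (D : ℕ) (hD : 0 < D) (s : {ℓ // ℓ ∈ D.primeFactors} → ℕ) (hs : ∀ ℓ, s ℓ < ℓ.1)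
    (h : D ∣ ∑ ℓ, (D / ℓ.1) * s ℓ) : s = 0 := by
  classical
  funext l
  obtain ⟨p, hp⟩ := l
  have hpp := Nat.prime_of_mem_primeFactors hp
  have hpD := Nat.dvd_of_mem_primeFactors hp
  set v := D.factorization p with hv
  have hv1 : 1 ≤ v := hpp.factorization_pos_of_dvd hD.ne' hpD
  have hpv : p ^ v ∣ D := Nat.ordProj_dvd D p
  rw [← Finset.add_sum_erase _ _ (Finset.mem_univ (⟨p, hp⟩ : {ℓ // ℓ ∈ D.primeFactors}))] at h
  have h1 : p ^ v ∣ ∑ ℓ ∈ Finset.univ.erase (⟨p, hp⟩ : {ℓ // ℓ ∈ D.primeFactors}), (D / ℓ.1) * s ℓ := by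
    refine Finset.dvd_sum (fun ℓ hℓ => ?_)
    have hne : ℓ.1 ≠ p := fun e => Finset.ne_of_mem_erase hℓ (Subtype.ext e)
    have hlp := Nat.prime_of_mem_primeFactors ℓ.2
    have hlD := Nat.dvd_of_mem_primeFactors ℓ.2
    refine Dvd.dvd.mul_right ?_ _
    have hc : Nat.Coprime (p ^ v) ℓ.1 := Nat.Coprime.pow_left _ ((Nat.coprime_primes hpp hlp).2 hne.symm)
    refine Nat.Coprime.dvd_of_dvd_mul_right hc ?_
    rw [Nat.div_mul_cancel hlD]; exact hpv
  have h2 := (Nat.dvd_add_left h1).1 (hpv.trans h)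
  obtain ⟨c, hc⟩ := hpv
  have hcp : ¬ p ∣ c := by
    rintro ⟨e, rfl⟩
    have h3 : p ^ (v + 1) ∣ D := ⟨e, by rw [hc]; ring⟩
    have h4 := (hpp.pow_dvd_iff_le_factorization hD.ne').1 h3
    omega
  obtain ⟨w, hw⟩ : ∃ w, v = w + 1 := ⟨v - 1, by omega⟩
  have hdiv : D / p = p ^ w * c := by
    rw [hc, hw, pow_succ]
    rw [show p ^ w * p * c = p ^ w * c * p by ring]
    exact Nat.mul_div_cancel _ hpp.pos
  simp only at h2
  rw [hdiv, hw, pow_succ, mul_assoc] at h2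
  have h3 := Nat.dvd_of_mul_dvd_mul_left (pow_pos hpp.pos w) h2
  rcases (hpp.dvd_mul).1 h3 with h4 | h4
  · exact absurd h4 hcp
  · exact Nat.eq_zero_of_dvd_of_lt h4 (hs ⟨p, hp⟩)

lemma field_sieve {L : Type} [Field L] [Fintype L] (D : ℕ) (hD : D = Fintype.card L - 1)
    (χ : MulChar L ℂ) (X : Finset L) (v : L → L) (hX : ∀ x ∈ X, x ≠ 0 ∧ v x ≠ 0) (E : ℝ)
    (hW : ∀ i j : ℕ, ¬ (D ∣ i ∧ D ∣ j) → ‖∑ x ∈ X, χ x ^ i * χ (v x) ^ j‖ ≤ E)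
    (B T : Finset ℕ) (hB : B ⊆ D.primeFactors) (hT : T ⊆ D.primeFactors) (hBT : Disjoint B T)
    (δ θ : ℝ) (hδ : δ = 1 - 2 * ∑ ℓ ∈ T, (1 / ℓ : ℝ)) (hδ0 : 0 ≤ δ) (hθ : θ = ∏ ℓ ∈ B, (1 - 1 / ℓ : ℝ))
    (S : Finset L) (hS : ∀ x ∈ X, (∀ ℓ ∈ B ∪ T, x ^ (D / ℓ) ≠ 1 ∧ v x ^ (D / ℓ) ≠ 1) → x ∈ S) :
    θ ^ 2 * (δ * X.card - E * (4 ^ B.card * (2 * T.card - 1 + 2 * δ) - δ)) ≤ S.card := by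
  classical
  have hDpos : 0 < D := by have := Fintype.one_lt_card (α := L); omega
  let P := {ℓ // ℓ ∈ D.primeFactors}
  let φ : Bool × P → L → ℂ := fun i x => χ (if i.1 then v x else x) ^ (D / i.2.1)
  have hroot : ∀ y : L, y ≠ 0 → χ y ^ D = 1 := by
    intro y hy
    rw [← map_pow, hD, FiniteField.pow_card_sub_one_eq_one y hy, map_one]
  let B' : Finset (Bool × P) := Finset.univ ×ˢ B.subtype (· ∈ D.primeFactors)
  let T' : Finset (Bool × P) := Finset.univ ×ˢ T.subtype (· ∈ D.primeFactors)
  have hcard : ∀ Z : Finset ℕ, Z ⊆ D.primeFactors → (Z.subtype (· ∈ D.primeFactors)).card = Z.card := by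
    intro Z hZ
    rw [Finset.card_subtype, Finset.filter_true_of_mem (fun x hx => hZ hx)]
  have key := sieve_ineq X (fun i : Bool × P => i.2.1) (fun i => (Nat.prime_of_mem_primeFactors i.2.2).two_le) φ E
    (by
      rintro ⟨b, ℓ⟩ x hx
      simp only [φ]
      rw [← pow_mul, Nat.div_mul_cancel (Nat.dvd_of_mem_primeFactors ℓ.2)]
      apply hroot
      split_ifs
      · exact (hX x hx).2
      · exact (hX x hx).1)
    (by
      intro s hs hs0
      have e : ∀ x ∈ X, ∏ i, φ i x ^ s i =
          χ x ^ (∑ ℓ : P, (D / ℓ.1) * s (false, ℓ)) * χ (v x) ^ (∑ ℓ : P, (D / ℓ.1) * s (true, ℓ)) := by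
        intro x _
        rw [Fintype.prod_prod_type, Fintype.prod_bool, mul_comm]
        simp only [φ, if_true, Bool.false_eq_true, if_false, ← pow_mul]
        rw [Finset.prod_pow_eq_pow_sum, Finset.prod_pow_eq_pow_sum]
      rw [Finset.sum_congr rfl e]
      apply hW
      rintro ⟨h1, h2⟩
      apply hs0
      have h3 := prime_sum_dvd D hDpos (fun ℓ => s (false, ℓ)) (fun ℓ => hs _) h1
      have h4 := prime_sum_dvd D hDpos (fun ℓ => s (true, ℓ)) (fun ℓ => hs _) h2
      funext ⟨b, ℓ⟩
      cases b
      · exact congrFun h3 ℓ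
      · exact congrFun h4 ℓ)
    B' T'
    (by
      rw [Finset.disjoint_left]
      rintro ⟨b, ℓ⟩ h1 h2
      simp only [B', T', Finset.mem_product, Finset.mem_subtype] at h1 h2
      exact Finset.disjoint_left.1 hBT h1.2 h2.2)
    δ (θ ^ 2)
    (by
      rw [hδ, Finset.sum_product]
      simp only [Finset.sum_const, Finset.card_univ, Fintype.card_bool, nsmul_eq_mul]
      rw [Finset.sum_subtype_of_mem (fun ℓ : ℕ => (1 / ℓ : ℝ)) (fun x hx => hT hx)]; norm_num)
    hδ0
    (by
      rw [hθ, Finset.prod_product]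
      simp only [Finset.prod_const, Finset.card_univ, Fintype.card_bool]
      rw [Finset.prod_subtype_of_mem (fun ℓ : ℕ => (1 - 1 / ℓ : ℝ)) (fun x hx => hB hx)])
    S
    (by
      intro x hx h
      refine hS x hx (fun ℓ hℓ => ?_)
      have hmem : ℓ ∈ D.primeFactors := by
        rcases Finset.mem_union.1 hℓ with h | h
        · exact hB h
        · exact hT h
      have hin : ∀ b : Bool, (b, (⟨ℓ, hmem⟩ : P)) ∈ B' ∪ T' := by
        intro b
        rcases Finset.mem_union.1 hℓ with h | h
        · exact Finset.mem_union_left _ (by simp [B', h])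
        · exact Finset.mem_union_right _ (by simp [T', h])
      refine ⟨fun h1 => h _ (hin false) ?_, fun h1 => h _ (hin true) ?_⟩
      · simp only [φ]; rw [← map_pow]; simp [h1]
      · simp only [φ]; rw [← map_pow]; simp [h1])
  have c1 : B'.card = 2 * B.card := by
    simp only [B']; rw [Finset.card_product, hcard B hB]; simp
  have c2 : T'.card = 2 * T.card := by
    simp only [T']; rw [Finset.card_product, hcard T hT]; simp
  rw [c1, c2, pow_mul] at key
  norm_num at key
  exact key

end

section

open Polynomial

lemma count_good {L : Type} [Field L] [Fintype L] [DecidableEq L] (S : Finset L) (M n : ℕ) (τ : L) (hn : 0 < n)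
    (hτ : orderOf (τ ^ M) = n) (hτ0 : τ ≠ 0) (hS : ∀ x ∈ S, τ * x ∈ S)
    (hx : ∀ x ∈ S, (x ^ M) ^ n = 1) :
    (S.filter (fun x => orderOf (x ^ M) = n)).card * n = n.totient * S.card := by
  classical
  have : NeZero n := ⟨hn.ne'⟩
  set ρ := τ ^ M with hρ
  have hprim : IsPrimitiveRoot ρ n := hτ ▸ IsPrimitiveRoot.orderOf ρ
  have hSpow : ∀ i : ℕ, ∀ x ∈ S, τ ^ i * x ∈ S := by
    intro i
    induction i with
    | zero => intro x hx; simpa using hx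
    | succ k ih => intro x hx; rw [pow_succ', mul_assoc]; exact hS _ (ih x hx)
  let F : ℕ → Finset L := fun i => S.filter (fun x => x ^ M = ρ ^ i)
  have hle : ∀ i j : ℕ, (F i).card ≤ (F (i + j)).card := by
    intro i j
    refine Finset.card_le_card_of_injOn (fun x => τ ^ j * x) ?_ ?_
    · intro x hx
      simp only [F, Finset.coe_filter, Set.mem_ofPred_eq] at hx ⊢
      refine ⟨hSpow j x hx.1, ?_⟩
      rw [mul_pow, hx.2, ← pow_mul, mul_comm j M, pow_mul, ← hρ, ← pow_add, add_comm]
    · intro x _ y _ h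
      exact mul_left_cancel₀ (pow_ne_zero j hτ0) h
  have hper : ∀ i, i ≤ n → (F i).card = (F 0).card := by
    intro i hi
    apply le_antisymm
    · have := hle i (n - i)
      rw [Nat.add_sub_cancel' hi] at this
      have e : F n = F 0 := by simp only [F, hprim.pow_eq_one, pow_zero]
      rwa [e] at this
    · simpa using hle 0 i
  have hinj : Set.InjOn (fun i => ρ ^ i) (Finset.range n : Set ℕ) := by
    intro i hi j hj h
    exact hprim.pow_inj (by simpa using hi) (by simpa using hj) h
  have hfib : ∀ S' : Finset L, S' ⊆ S → ∀ I : Finset ℕ, I ⊆ Finset.range n →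
      (∀ x ∈ S, ∀ i ∈ Finset.range n, x ^ M = ρ ^ i → (x ∈ S' ↔ i ∈ I)) → S'.card = I.card * (F 0).card := by
    intro S' hS' I hI h
    rw [Finset.card_eq_sum_card_fiberwise (f := fun x => x ^ M) (t := I.image (fun i => ρ ^ i))]
    · rw [Finset.sum_image (hinj.mono (by exact_mod_cast hI)), ← smul_eq_mul, ← Finset.sum_const]
      refine Finset.sum_congr rfl (fun i hi => ?_)
      rw [← hper i (Finset.mem_range.1 (hI hi)).le]
      congr 1
      ext x
      simp only [F, Finset.mem_filter]
      constructor
      · rintro ⟨a, b⟩; exact ⟨hS' a, b⟩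
      · rintro ⟨a, b⟩; exact ⟨(h x a i (hI hi) b).2 hi, b⟩
    · intro x hx'
      obtain ⟨i, hi, e⟩ := hprim.eq_pow_of_pow_eq_one (hx x (hS' hx'))
      simp only [Finset.coe_image, Set.mem_image]
      exact ⟨i, (h x (hS' hx') i (Finset.mem_range.2 hi) e.symm).1 hx', e⟩
  have h1 := hfib S (Finset.Subset.refl _) (Finset.range n) (Finset.Subset.refl _)
    (fun x hx i hi _ => by simp only [hx, hi])
  have h2 := hfib (S.filter (fun x => orderOf (x ^ M) = n)) (Finset.filter_subset _ _)
    ((Finset.range n).filter (fun i => n.Coprime i)) (Finset.filter_subset _ _)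
    (by
      intro x hx i hi e
      simp only [Finset.mem_filter, hx, hi, true_and]
      rw [e, (orderOf_pos_iff.1 (hτ ▸ hn : 0 < orderOf ρ)).orderOf_pow, hτ, Nat.coprime_iff_gcd_eq_one]
      constructor
      · intro h
        by_contra hc
        have hg : 0 < n.gcd i := Nat.gcd_pos_of_pos_left _ hn
        have : n / n.gcd i < n := Nat.div_lt_self hn (by omega)
        omega
      · intro h; rw [h, Nat.div_one])
  have h3 : ((Finset.range n).filter (fun i => n.Coprime i)).card = n.totient := rfl
  rw [h1, h2, h3, Finset.card_range]; ring

/-- non-normal elements -/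
lemma nn_mul {K L : Type} [Field K] [Fintype K] [Field L] [Algebra K L] (τ x : L) (ω : K)
    (hτ : τ ≠ 0) (hω : τ ^ Fintype.card K = algebraMap K L ω * τ)
    (h : LinearIndependent K (fun i : Fin 5 => (τ * x) ^ Fintype.card K ^ (i : ℕ))) :
    LinearIndependent K (fun i : Fin 5 => x ^ Fintype.card K ^ (i : ℕ)) := by
  have hω0 : ω ≠ 0 := by
    rintro rfl
    rw [map_zero, zero_mul] at hω
    exact hτ (eq_zero_of_pow_eq_zero hω)
  have hpow : ∀ i : ℕ, τ ^ Fintype.card K ^ i = algebraMap K L (ω ^ i) * τ := by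
    intro i
    induction i with
    | zero => simp
    | succ k ih =>
      rw [pow_succ, pow_mul, ih, mul_pow, hω, ← map_pow, FiniteField.pow_card, ← mul_assoc, ← map_mul, pow_succ]
  let w : Fin 5 → Kˣ := fun i => (Units.mk0 ω hω0) ^ (i : ℕ)
  have e : (fun i : Fin 5 => (τ * x) ^ Fintype.card K ^ (i : ℕ)) =
      w • (fun i : Fin 5 => (LinearMap.mulLeft K τ) (x ^ Fintype.card K ^ (i : ℕ))) := by
    funext i
    simp only [Pi.smul_apply', w, LinearMap.mulLeft_apply, Units.smul_def, Units.val_pow_eq_pow_val, Units.val_mk0,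
      Algebra.smul_def]
    rw [mul_pow, hpow]; ring
  rw [e, LinearIndependent.units_smul_iff] at h
  exact LinearIndependent.of_comp (LinearMap.mulLeft K τ) h

end

section

open Polynomial

section
variable {K L : Type} [Field K] [Fintype K] [Field L] [Fintype L] [Algebra K L]

noncomputable def frobEnd (K L : Type) [Field K] [Fintype K] [Field L] [Algebra K L] : Module.End K L :=
  (FiniteField.frobeniusAlgHom K L).toLinearMap

lemma frobEnd_pow (i : ℕ) (x : L) : (frobEnd K L ^ i) x = x ^ Fintype.card K ^ i := by
  induction i generalizing x with
  | zero => simp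
  | succ k ih =>
    rw [pow_succ, Module.End.mul_apply, ih, pow_succ', pow_mul]
    rfl

lemma aeval_frob (p : K[X]) (x : L) : (aeval (frobEnd K L) p) x =
    ∑ i ∈ Finset.range (p.natDegree + 1), algebraMap K L (p.coeff i) * x ^ Fintype.card K ^ i := by
  rw [aeval_eq_sum_range, LinearMap.sum_apply]
  refine Finset.sum_congr rfl (fun i _ => ?_)
  rw [LinearMap.smul_apply, frobEnd_pow, Algebra.smul_def]

lemma ker_card [DecidableEq L] (p : K[X]) (hp : p ≠ 0) :
    (Finset.univ.filter (fun x : L => (aeval (frobEnd K L) p) x = 0)).card ≤ Fintype.card K ^ p.natDegree := by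
  classical
  have hq : 1 < Fintype.card K := Fintype.one_lt_card
  let P : L[X] := ∑ i ∈ Finset.range (p.natDegree + 1), C (algebraMap K L (p.coeff i)) * X ^ Fintype.card K ^ i
  have hdeg : P.natDegree ≤ Fintype.card K ^ p.natDegree := by
    refine natDegree_sum_le_of_forall_le _ _ (fun i hi => ?_)
    refine (natDegree_C_mul_X_pow_le _ _).trans (Nat.pow_le_pow_right hq.le ?_)
    have := Finset.mem_range.1 hi; omega
  have hP : P ≠ 0 := by
    intro h0
    have h1 : P.coeff (Fintype.card K ^ p.natDegree) = algebraMap K L p.leadingCoeff := by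
      simp only [P, finset_sum_coeff, coeff_C_mul, coeff_X_pow]
      rw [Finset.sum_eq_single p.natDegree]
      · simp
      · intro i _ hi
        rw [if_neg, mul_zero]
        intro h
        exact hi (Nat.pow_right_injective hq h).symm
      · intro h; simp at h
    rw [h0, coeff_zero] at h1
    exact hp (leadingCoeff_eq_zero.1 ((map_eq_zero _).1 h1.symm))
  refine le_trans (Finset.card_le_card (t := P.roots.toFinset) ?_) ((Multiset.toFinset_card_le _).trans ((card_roots' P).trans hdeg))
  intro x hx
  simp only [Finset.mem_filter, Finset.mem_univ, true_and] at hx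
  rw [Multiset.mem_toFinset, mem_roots hP, IsRoot.def]
  rw [aeval_frob] at hx
  simp only [P, eval_finset_sum, eval_mul, eval_C, eval_pow, eval_X]
  exact hx

lemma aeval_X5 (hL : Fintype.card L = Fintype.card K ^ 5) : aeval (frobEnd K L) (X ^ 5 - 1 : K[X]) = 0 := by
  ext x
  simp only [map_sub, map_pow, aeval_X, map_one, LinearMap.sub_apply, frobEnd_pow, Module.End.one_apply, LinearMap.zero_apply]
  rw [← hL, FiniteField.pow_card, sub_self]

lemma nn_cover (hL : Fintype.card L = Fintype.card K ^ 5) (x : L)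
    (h : ¬ LinearIndependent K (fun i : Fin 5 => x ^ Fintype.card K ^ (i : ℕ))) :
    ∃ p r : K[X], p.Monic ∧ Irreducible p ∧ X ^ 5 - 1 = p * r ∧ (aeval (frobEnd K L) r) x = 0 := by
  classical
  have hX : (X ^ 5 - 1 : K[X]) ≠ 0 := by
    have := X_pow_sub_C_ne_zero (R := K) (n := 5) (by norm_num) 1
    simpa using this
  have hXd : (X ^ 5 - 1 : K[X]).natDegree = 5 := by
    have := natDegree_X_pow_sub_C (R := K) (n := 5) (r := 1)
    simpa using this
  rw [Fintype.not_linearIndependent_iff] at h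
  obtain ⟨g, hg, i0, hi0⟩ := h
  let p : K[X] := ∑ i : Fin 5, C (g i) * X ^ (i : ℕ)
  have hpc : p.coeff (i0 : ℕ) = g i0 := by
    simp only [p, finset_sum_coeff, coeff_C_mul, coeff_X_pow]
    rw [Finset.sum_eq_single i0]
    · simp
    · intro b _ hb
      rw [if_neg (fun e => hb (Fin.ext e.symm)), mul_zero]
    · simp
  have hp0 : p ≠ 0 := by
    intro h0; rw [h0, coeff_zero] at hpc; exact hi0 hpc.symm
  have hpd : p.natDegree ≤ 4 := by
    refine natDegree_sum_le_of_forall_le _ _ (fun i _ => ?_)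
    refine (natDegree_C_mul_X_pow_le _ _).trans (by omega)
  have hpx : (aeval (frobEnd K L) p) x = 0 := by
    simp only [p, map_sum, map_mul, aeval_C, map_pow, aeval_X, LinearMap.sum_apply, Module.End.mul_apply, frobEnd_pow,
      Module.algebraMap_end_apply]
    exact hg
  set d := EuclideanDomain.gcd p (X ^ 5 - 1) with hd
  have hdx : (aeval (frobEnd K L) d) x = 0 := by
    rw [hd, EuclideanDomain.gcd_eq_gcd_ab, map_add, mul_comm p, map_mul, LinearMap.add_apply, Module.End.mul_apply, hpx,
      map_zero, map_mul, aeval_X5 hL, zero_mul, LinearMap.zero_apply, add_zero]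
  obtain ⟨e, he⟩ := EuclideanDomain.gcd_dvd_right p (X ^ 5 - 1)
  rw [← hd] at he
  have hdd : d.natDegree ≤ 4 := (natDegree_le_of_dvd (EuclideanDomain.gcd_dvd_left p (X ^ 5 - 1)) hp0).trans hpd
  have hd0 : d ≠ 0 := by rintro h0; rw [h0, zero_mul] at he; exact hX he
  have he0 : e ≠ 0 := by rintro h0; rw [h0, mul_zero] at he; exact hX he
  have hed : e.natDegree ≠ 0 := by
    rw [he, natDegree_mul hd0 he0] at hXd; omega
  obtain ⟨m, hm1, hm2, c, hc⟩ := exists_monic_irreducible_factor e (fun hu => hed (natDegree_eq_zero_of_isUnit hu))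
  refine ⟨m, c * d, hm1, hm2, by rw [he, hc]; ring, ?_⟩
  rw [map_mul, Module.End.mul_apply, hdx, map_zero]

end

end

section

open Polynomial

section
variable {K L : Type} [Field K] [Fintype K] [Field L] [Fintype L] [Algebra K L]

lemma fac_set (K : Type) [Field K] : ∃ H : Finset K[X], (∀ p, p ∈ H ↔ p.Monic ∧ Irreducible p ∧ p ∣ X ^ 5 - 1) ∧ H.card ≤ 5 := by
  classical
  have hX : (X ^ 5 - 1 : K[X]) ≠ 0 := by
    have := X_pow_sub_C_ne_zero (R := K) (n := 5) (by norm_num) 1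
    simpa using this
  have hXd : (X ^ 5 - 1 : K[X]).natDegree = 5 := by
    have := natDegree_X_pow_sub_C (R := K) (n := 5) (r := 1)
    simpa using this
  let H : Finset K[X] := (UniqueFactorizationMonoid.normalizedFactors (X ^ 5 - 1 : K[X])).toFinset
  have hH : ∀ p, p ∈ H ↔ p.Monic ∧ Irreducible p ∧ p ∣ X ^ 5 - 1 := by
    intro p
    simp only [H, Multiset.mem_toFinset]
    constructor
    · intro h
      have h0 := UniqueFactorizationMonoid.irreducible_of_normalized_factor p h
      have h1 := UniqueFactorizationMonoid.normalize_normalized_factor p h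
      exact ⟨h1 ▸ monic_normalize h0.ne_zero, h0, UniqueFactorizationMonoid.dvd_of_mem_normalizedFactors h⟩
    · rintro ⟨h1, h2, h3⟩
      obtain ⟨r, hr1, hr2⟩ := UniqueFactorizationMonoid.exists_mem_normalizedFactors_of_dvd hX h2 h3
      have h0 := UniqueFactorizationMonoid.irreducible_of_normalized_factor r hr1
      have h4 := UniqueFactorizationMonoid.normalize_normalized_factor r hr1
      have hrm : r.Monic := h4 ▸ monic_normalize h0.ne_zero
      rw [eq_of_monic_of_associated h1 hrm hr2]; exact hr1
  refine ⟨H, hH, ?_⟩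
  have hdvd : ∏ p ∈ H, p ∣ X ^ 5 - 1 := by
    refine Finset.prod_dvd_of_isRelPrime ?_ (fun p hp => ((hH p).1 hp).2.2)
    intro p hp r hr hne
    have h1 := (hH p).1 hp
    have h2 := (hH r).1 hr
    refine (h1.2.1.isRelPrime_iff_not_dvd).2 (fun hd => hne ?_)
    exact eq_of_monic_of_associated h1.1 h2.1 (h1.2.1.associated_of_dvd h2.2.1 hd)
  have h1 := natDegree_le_of_dvd hdvd hX
  rw [natDegree_prod_of_monic _ _ (fun p hp => ((hH p).1 hp).1), hXd] at h1
  calc H.card = ∑ p ∈ H, 1 := by simp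
    _ ≤ ∑ p ∈ H, p.natDegree := Finset.sum_le_sum (fun p hp => ((hH p).1 hp).2.1.natDegree_pos)
    _ ≤ 5 := h1

open Classical in
lemma nn_card_sum (hL : Fintype.card L = Fintype.card K ^ 5) (H : Finset K[X])
    (hH : ∀ p, p ∈ H ↔ p.Monic ∧ Irreducible p ∧ p ∣ X ^ 5 - 1) :
    (Finset.univ.filter (fun x : L => ¬ LinearIndependent K (fun i : Fin 5 => x ^ Fintype.card K ^ (i : ℕ)))).card ≤
      ∑ p ∈ H, Fintype.card K ^ (5 - p.natDegree) := by
  have hX : (X ^ 5 - 1 : K[X]) ≠ 0 := by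
    have := X_pow_sub_C_ne_zero (R := K) (n := 5) (by norm_num) 1
    simpa using this
  have hXd : (X ^ 5 - 1 : K[X]).natDegree = 5 := by
    have := natDegree_X_pow_sub_C (R := K) (n := 5) (r := 1)
    simpa using this
  have hsub : (Finset.univ.filter (fun x : L => ¬ LinearIndependent K (fun i : Fin 5 => x ^ Fintype.card K ^ (i : ℕ)))) ⊆
      H.biUnion (fun p => Finset.univ.filter (fun x : L => (aeval (frobEnd K L) ((X ^ 5 - 1) / p)) x = 0)) := by
    intro x hx
    simp only [Finset.mem_filter, Finset.mem_univ, true_and] at hx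
    obtain ⟨p, r, h1, h2, h3, h4⟩ := nn_cover hL x hx
    refine Finset.mem_biUnion.2 ⟨p, (hH p).2 ⟨h1, h2, ⟨r, h3⟩⟩, ?_⟩
    simp only [Finset.mem_filter, Finset.mem_univ, true_and]
    rw [h3, mul_div_cancel_left₀ _ h2.ne_zero]; exact h4
  refine (Finset.card_le_card hsub).trans (Finset.card_biUnion_le.trans (Finset.sum_le_sum (fun p hp => ?_)))
  obtain ⟨h1, h2, r, h3⟩ := (hH p).1 hp
  have hr : r ≠ 0 := by rintro rfl; rw [mul_zero] at h3; exact hX h3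
  have hd := hXd
  rw [h3, natDegree_mul h2.ne_zero hr] at hd
  rw [h3, mul_div_cancel_left₀ _ h2.ne_zero, show 5 - p.natDegree = r.natDegree by omega]
  exact ker_card r hr

open Classical in
lemma nn_card5 (hL : Fintype.card L = Fintype.card K ^ 5) :
    (Finset.univ.filter (fun x : L => ¬ LinearIndependent K (fun i : Fin 5 => x ^ Fintype.card K ^ (i : ℕ)))).card ≤
      5 * Fintype.card K ^ 4 := by
  obtain ⟨H, hH, hc⟩ := fac_set K
  refine (nn_card_sum hL H hH).trans ?_
  calc ∑ p ∈ H, Fintype.card K ^ (5 - p.natDegree) ≤ ∑ p ∈ H, Fintype.card K ^ 4 := by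
        refine Finset.sum_le_sum (fun p hp => Nat.pow_le_pow_right Fintype.card_pos ?_)
        have := ((hH p).1 hp).2.1.natDegree_pos
        omega
    _ = H.card * Fintype.card K ^ 4 := by simp
    _ ≤ _ := Nat.mul_le_mul_right _ hc

open Classical in
lemma nn_card2 (hL : Fintype.card L = Fintype.card K ^ 5) (hq : Fintype.card K % 5 ≠ 1) (hq5 : 5 ≤ Fintype.card K) :
    (Finset.univ.filter (fun x : L => ¬ LinearIndependent K (fun i : Fin 5 => x ^ Fintype.card K ^ (i : ℕ)))).card ≤
      2 * Fintype.card K ^ 4 := by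
  obtain ⟨H, hH, hc⟩ := fac_set K
  refine (nn_card_sum hL H hH).trans ?_
  have hlin : ∀ p ∈ H, p ≠ X - 1 → 2 ≤ p.natDegree := by
    intro p hp hne
    obtain ⟨h1, h2, h3⟩ := (hH p).1 hp
    by_contra hlt
    have hpos := h2.natDegree_pos
    have hd1 : p.natDegree = 1 := by omega
    have hp1 := h1.eq_X_add_C hd1
    set a := p.coeff 0
    apply hne
    have hroot : (X ^ 5 - 1 : K[X]).eval (-a) = 0 := by
      obtain ⟨r, hr⟩ := h3
      rw [hr, hp1]; simp
    have h5 : (-a) ^ 5 = 1 := by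
      simp only [eval_sub, eval_pow, eval_X, eval_one] at hroot
      exact sub_eq_zero.1 hroot
    have ha0 : -a ≠ 0 := by intro h0; rw [h0] at h5; norm_num at h5
    have hq1 := FiniteField.pow_card_sub_one_eq_one (-a) ha0
    have hg : Nat.gcd 5 (Fintype.card K - 1) = 1 := by
      rw [← Nat.coprime_iff_gcd_eq_one, Nat.Prime.coprime_iff_not_dvd (by norm_num)]
      omega
    have h6 : orderOf (-a) ∣ Nat.gcd 5 (Fintype.card K - 1) :=
      Nat.dvd_gcd (orderOf_dvd_of_pow_eq_one h5) (orderOf_dvd_of_pow_eq_one hq1)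
    rw [hg, Nat.dvd_one, orderOf_eq_one_iff] at h6
    rw [hp1, show a = -1 by rw [← h6, neg_neg]]; simp [sub_eq_add_neg]
  calc ∑ p ∈ H, Fintype.card K ^ (5 - p.natDegree) ≤ ∑ p ∈ H, (Fintype.card K ^ 3 + if p = X - 1 then Fintype.card K ^ 4 else 0) := by
        refine Finset.sum_le_sum (fun p hp => ?_)
        split_ifs with h
        · refine le_trans (Nat.pow_le_pow_right Fintype.card_pos ?_) (Nat.le_add_left _ _)
          have := ((hH p).1 hp).2.1.natDegree_pos
          omega
        · refine le_trans (Nat.pow_le_pow_right Fintype.card_pos ?_) (Nat.le_add_right _ _)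
          have := hlin p hp h
          omega
    _ = H.card * Fintype.card K ^ 3 + ∑ p ∈ H, (if p = X - 1 then Fintype.card K ^ 4 else 0) := by
        rw [Finset.sum_add_distrib]; simp
    _ ≤ 5 * Fintype.card K ^ 3 + Fintype.card K ^ 4 := by
        refine Nat.add_le_add (Nat.mul_le_mul_right _ hc) ?_
        rw [Finset.sum_ite_eq']; split_ifs <;> simp
    _ ≤ Fintype.card K * Fintype.card K ^ 3 + Fintype.card K ^ 4 := Nat.add_le_add_right (Nat.mul_le_mul_right _ hq5) _
    _ = _ := by ring

end

end

section

open Polynomial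

lemma mem_base_of_pow {K L : Type} [Field K] [Fintype K] [Field L] [Algebra K L] (x : L)
    (hx : x ^ Fintype.card K = x) : ∃ y : K, algebraMap K L y = x := by
  classical
  have hq : 1 < Fintype.card K := Fintype.one_lt_card
  have hne := FiniteField.X_pow_card_sub_X_ne_zero L hq
  have hsub : (Finset.univ.image (algebraMap K L)) ⊆ (X ^ Fintype.card K - X : L[X]).roots.toFinset := by
    intro z hz
    obtain ⟨y, _, rfl⟩ := Finset.mem_image.1 hz
    rw [Multiset.mem_toFinset, mem_roots hne, IsRoot.def]
    simp [← map_pow, FiniteField.pow_card]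
  have hcard : (X ^ Fintype.card K - X : L[X]).roots.toFinset.card ≤ (Finset.univ.image (algebraMap K L)).card := by
    rw [Finset.card_image_of_injective _ (algebraMap K L).injective, Finset.card_univ]
    refine (Multiset.toFinset_card_le _).trans ((card_roots' _).trans ?_)
    rw [FiniteField.X_pow_card_sub_X_natDegree_eq L hq]
  have heq := Finset.eq_of_subset_of_card_le hsub hcard
  have hmem : x ∈ (X ^ Fintype.card K - X : L[X]).roots.toFinset := by
    rw [Multiset.mem_toFinset, mem_roots hne, IsRoot.def]
    simp [hx]
  rw [← heq] at hmem
  obtain ⟨y, _, h⟩ := Finset.mem_image.1 hmem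
  exact ⟨y, h⟩

lemma exists_e (q M : ℕ) (hq : 2 ≤ q) (hM : M = q ^ 4 + q ^ 3 + q ^ 2 + q + 1) :
    ∃ e, Nat.Coprime (q - 1) e ∧ M ∣ e * (q - 1) := by
  obtain ⟨t, rfl⟩ : ∃ t, q = t + 1 := ⟨q - 1, by omega⟩
  simp only [Nat.add_sub_cancel]
  have hM' : M = 5 + t * (t ^ 3 + 5 * t ^ 2 + 10 * t + 10) := by rw [hM]; ring
  by_cases h : 5 ∣ t
  · obtain ⟨k, rfl⟩ := h
    refine ⟨1 + 5 * k * (25 * k ^ 3 + 25 * k ^ 2 + 10 * k + 2), ?_, ⟨k, by rw [hM']; ring⟩⟩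
    simp
  · refine ⟨M, ?_, Nat.dvd_mul_right _ _⟩
    rw [hM']
    simp only [Nat.coprime_add_mul_left_right]
    exact ((Nat.Prime.coprime_iff_not_dvd (by norm_num)).2 h).symm

open Classical in
lemma nn_good {K L : Type} [Field K] [Fintype K] [Field L] [Fintype L] [Algebra K L]
    (q M c : ℕ) (hK : Fintype.card K = q) (hL : Fintype.card L = q ^ 5)
    (hM : M = q ^ 4 + q ^ 3 + q ^ 2 + q + 1)
    (hc : c = 5 ∨ (c = 2 ∧ q % 5 ≠ 1 ∧ 5 ≤ q)) :
    ((Finset.univ.filter (fun x : L => ¬ LinearIndependent K (fun i : Fin 5 => x ^ Fintype.card K ^ (i : ℕ))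
      ∧ x ≠ 0 ∧ orderOf (x ^ M) = q - 1)).card * (q - 1) ≤ (q - 1).totient * (c * q ^ 4)) := by
  have hq : 2 ≤ q := hK ▸ Fintype.one_lt_card
  subst hK
  set q := Fintype.card K with hqdef
  have hD : q ^ 5 - 1 = M * (q - 1) := by
    obtain ⟨t, ht⟩ : ∃ t, q = t + 1 := ⟨q - 1, by omega⟩
    rw [hM, ht]; simp only [Nat.add_sub_cancel]
    refine Nat.sub_eq_of_eq_add ?_
    ring
  have hDpos : 0 < q ^ 5 - 1 := by rw [hD]; exact Nat.mul_pos (by omega) (by omega)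
  obtain ⟨e, he1, he2⟩ := exists_e q M hq hM
  obtain ⟨g, hg⟩ := IsCyclic.exists_ofOrder_eq_natCard (α := Lˣ)
  have hgo : orderOf (g : L) = q ^ 5 - 1 := by
    rw [orderOf_units, hg, Nat.card_eq_fintype_card, Fintype.card_units, hL]
  have hMord : orderOf ((g : L) ^ M) = q - 1 := by
    rw [orderOf_pow_of_dvd (by omega) (by rw [hgo, hD]; exact Nat.dvd_mul_right _ _), hgo, hD]
    exact Nat.mul_div_cancel_left _ (by omega)
  set τ : L := (g : L) ^ e with hτ
  have hτ0 : τ ≠ 0 := pow_ne_zero _ g.ne_zero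
  have hτM : orderOf (τ ^ M) = q - 1 := by
    rw [hτ, ← pow_mul, mul_comm, pow_mul, Nat.Coprime.orderOf_pow, hMord]
    rw [hMord]; exact he1
  have hω1 : (τ ^ (q - 1)) ^ (q - 1) = 1 := by
    rw [hτ, ← pow_mul, ← pow_mul]
    apply orderOf_dvd_iff_pow_eq_one.1
    rw [hgo, hD]
    rw [← mul_assoc]
    exact Nat.mul_dvd_mul_right he2 _
  have hω2 : (τ ^ (q - 1)) ^ q = τ ^ (q - 1) := by
    conv_lhs => rw [show q = (q - 1) + 1 by omega, pow_succ]
    rw [Nat.add_sub_cancel, hω1, one_mul]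
  obtain ⟨ω, hω⟩ := mem_base_of_pow (K := K) _ hω2
  have hωτ : τ ^ q = algebraMap K L ω * τ := by
    rw [hω, ← pow_succ]; congr 1; omega
  set S : Finset L := (Finset.univ.filter (fun x : L => ¬ LinearIndependent K (fun i : Fin 5 => x ^ q ^ (i : ℕ)) ∧ x ≠ 0)) with hS
  have hcount := count_good S M (q - 1) τ (by omega) hτM hτ0
    (by
      intro x hx
      simp only [hS, Finset.mem_filter, Finset.mem_univ, true_and] at hx ⊢
      exact ⟨fun h => hx.1 (nn_mul τ x ω hτ0 hωτ h), mul_ne_zero hτ0 hx.2⟩)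
    (by
      intro x hx
      simp only [hS, Finset.mem_filter, Finset.mem_univ, true_and] at hx
      rw [← pow_mul, ← hD, ← hL, FiniteField.pow_card_sub_one_eq_one x hx.2])
  have hScard : S.card ≤ c * q ^ 4 := by
    refine le_trans (Finset.card_le_card (t := Finset.univ.filter (fun x : L => ¬ LinearIndependent K (fun i : Fin 5 => x ^ q ^ (i : ℕ)))) ?_) ?_
    · intro x hx
      simp only [hS, Finset.mem_filter, Finset.mem_univ, true_and] at hx ⊢
      exact hx.1
    · rcases hc with rfl | ⟨rfl, h1, h2⟩
      · exact nn_card5 hL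
      · exact nn_card2 hL h1 h2
  have hfe : (Finset.univ.filter (fun x : L => ¬ LinearIndependent K (fun i : Fin 5 => x ^ q ^ (i : ℕ))
      ∧ x ≠ 0 ∧ orderOf (x ^ M) = q - 1)) = S.filter (fun x => orderOf (x ^ M) = q - 1) := by
    ext x
    simp only [hS, Finset.mem_filter, Finset.mem_univ, true_and, and_assoc]
  rw [hfe, hcount]
  exact Nat.mul_le_mul_left _ hScard

end

section

open Polynomial

lemma ratEval_eq {F : Type} [Field F] (f₁ f₂ : F[X]) (hf₂ : f₂ ≠ 0) (α : F) (h : f₂.eval α ≠ 0) :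
    ratEval (algebraMap F[X] (RatFunc F) f₁ / algebraMap F[X] (RatFunc F) f₂) α = f₁.eval α / f₂.eval α := by
  set f := algebraMap F[X] (RatFunc F) f₁ / algebraMap F[X] (RatFunc F) f₂ with hf
  have h1 := (RatFunc.num_mul_eq_mul_denom_iff (x := f) (p := f₁) hf₂).2 hf
  have h2 : f.denom.eval α ≠ 0 := by
    obtain ⟨r, hr⟩ := RatFunc.denom_div_dvd f₁ f₂
    rw [← hf] at hr
    intro h0
    apply h
    rw [hr, eval_mul, h0, zero_mul]
  unfold ratEval RatFunc.eval
  rw [← eval_map, ← eval_map, Polynomial.map_id, Polynomial.map_id, div_eq_div_iff h2 h, ← eval_mul, h1, eval_mul]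

lemma prim_of_primes {L : Type} [Field L] [Fintype L] (x : L) (hx : x ≠ 0)
    (h : ∀ ℓ ∈ (Fintype.card L - 1).primeFactors, x ^ ((Fintype.card L - 1) / ℓ) ≠ 1) : IsPrimitiveElem x := by
  have := Fintype.one_lt_card (α := L)
  refine orderOf_eq_of_pow_and_pow_div_prime (by omega) (FiniteField.pow_card_sub_one_eq_one x hx) ?_
  intro p hp hd
  exact h p (Nat.mem_primeFactors.2 ⟨hp, hd, by omega⟩)

lemma fiber_count {L : Type} [Field L] [Fintype L] [DecidableEq L] (f₁ f₂ : L[X]) (hd₁ : f₁.natDegree ≤ 3) (hd₂ : f₂.natDegree ≤ 2)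
    (hne : ∀ y : L, f₁ - C y * f₂ ≠ 0) (m : ℕ) (hm : 0 < m) :
    (Finset.univ.filter (fun x : L => f₂.eval x ≠ 0 ∧ (f₁.eval x / f₂.eval x) ^ m = 1)).card ≤ 3 * m := by
  classical
  have hsub : (Finset.univ.filter (fun x : L => f₂.eval x ≠ 0 ∧ (f₁.eval x / f₂.eval x) ^ m = 1)) ⊆
      (nthRoots m (1 : L)).toFinset.biUnion (fun y => (f₁ - C y * f₂).roots.toFinset) := by
    intro x hx
    simp only [Finset.mem_filter, Finset.mem_univ, true_and] at hx
    rw [Finset.mem_biUnion]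
    refine ⟨f₁.eval x / f₂.eval x, ?_, ?_⟩
    · rw [Multiset.mem_toFinset, mem_nthRoots hm]; exact hx.2
    · rw [Multiset.mem_toFinset, mem_roots (hne _), IsRoot.def]
      simp only [eval_sub, eval_mul, eval_C]
      rw [div_mul_cancel₀ _ hx.1, sub_self]
  refine (Finset.card_le_card hsub).trans ?_
  refine (Finset.card_biUnion_le_card_mul _ _ 3 ?_).trans ?_
  · intro y _
    refine (Multiset.toFinset_card_le _).trans ((card_roots' _).trans ?_)
    refine (natDegree_sub_le _ _).trans (max_le hd₁ ?_)
    exact (natDegree_C_mul_le _ _).trans (by omega)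
  · rw [mul_comm]
    refine Nat.mul_le_mul_left _ ((Multiset.toFinset_card_le _).trans (card_nthRoots m 1))

lemma totient_real (n : ℕ) (hn : 0 < n) : ∏ ℓ ∈ n.primeFactors, (1 - 1 / ℓ : ℝ) = n.totient / n := by
  have h := Nat.totient_eq_mul_prod_factors n
  have h2 : (n.totient : ℝ) = n * ∏ p ∈ n.primeFactors, (1 - (p : ℝ)⁻¹) := by
    have := congrArg (fun x : ℚ => (x : ℝ)) h
    push_cast at this
    exact this
  rw [h2, mul_div_cancel_left₀ _ (by positivity)]
  simp

theorem criterion (q c : ℕ) (hq8 : 8 ≤ q) (hc : c = 5 ∨ (c = 2 ∧ q % 5 ≠ 1)) (B T U : Finset ℕ)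
    (hBT : Disjoint B T)
    (hB : B ⊆ (q ^ 5 - 1).primeFactors) (hT : T ⊆ (q ^ 5 - 1).primeFactors) (hU : U ⊆ (q ^ 5 - 1).primeFactors)
    (hall : ∀ ℓ ∈ (q ^ 5 - 1).primeFactors, ℓ ∈ B ∪ T ∪ U)
    (δ θ : ℝ) (hδ : δ = 1 - 2 * ∑ ℓ ∈ T, (1 / ℓ : ℝ)) (hδ0 : 0 ≤ δ) (hθ : θ = ∏ ℓ ∈ B, (1 - 1 / ℓ : ℝ))
    (hineq : ((q - 1).totient / (q - 1 : ℕ) : ℝ) * (c * (q : ℝ) ^ 4) + 4 * (q : ℝ) ^ 5 * ∑ ℓ ∈ U, (1 / ℓ : ℝ) <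
      θ ^ 2 * (δ * (q : ℝ) ^ 5 - 5 * Real.sqrt ((q : ℝ) ^ 5) * (4 ^ B.card * (2 * T.card - 1 + 2 * δ)))) :
    memB 3 2 q 5 := by
  intro K L _ _ _ _ _ hK hL f hf
  classical
  obtain ⟨f₁, f₂, hf₂, hfe, hd₁, hd₂, hco, k, g, hk, hgm, hg, hgX, hgk, h1, h2⟩ := hf
  have hf₁ : f₁ ≠ 0 := by rintro rfl; exact h2 (by simp)
  have hQ : 25 < Fintype.card L := by
    rw [hL]
    calc 25 < 8 ^ 5 := by norm_num
      _ ≤ q ^ 5 := Nat.pow_le_pow_left hq8 5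
  set D := q ^ 5 - 1 with hD
  have hDL : D = Fintype.card L - 1 := by rw [hL]
  have hDpos : 0 < D := by omega
  set M := q ^ 4 + q ^ 3 + q ^ 2 + q + 1 with hM
  have hDM : D = M * (q - 1) := by
    obtain ⟨t, ht⟩ : ∃ t, q = t + 1 := ⟨q - 1, by omega⟩
    rw [hD, hM, ht]; simp only [Nat.add_sub_cancel]
    refine Nat.sub_eq_of_eq_add ?_
    ring
  -- f is not constant
  have hne : ∀ y : L, f₁ - C y * f₂ ≠ 0 := by
    intro y h0
    have e1 : f₁ = C y * f₂ := sub_eq_zero.1 h0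
    have e2 : IsUnit f₂ := by
      refine hco.isUnit_of_dvd' ?_ dvd_rfl
      rw [e1]; exact Dvd.intro_left _ rfl
    have hy : y ≠ 0 := by rintro rfl; rw [map_zero, zero_mul] at e1; exact hf₁ e1
    have e3 : IsUnit (f₁ * f₂) := by
      rw [e1]; exact ((isUnit_C.2 hy.isUnit).mul e2).mul e2
    have e4 : IsUnit (g ^ k) := isUnit_of_dvd_unit h1 e3
    exact hg.not_isUnit ((isUnit_pow_iff hk.ne').1 e4)
  -- the character
  obtain ⟨χ, hχ⟩ := MulChar.exists_mulChar_orderOf L (n := Fintype.card L - 1) dvd_rfl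
    (Complex.isPrimitiveRoot_exp _ (by omega))
  set X0 : Finset L := Finset.univ.filter (fun x : L => x ≠ 0 ∧ f₁.eval x ≠ 0 ∧ f₂.eval x ≠ 0) with hX0
  set v : L → L := fun x => f₁.eval x / f₂.eval x with hv
  have hX0v : ∀ x ∈ X0, x ≠ 0 ∧ v x ≠ 0 := by
    intro x hx
    simp only [hX0, Finset.mem_filter, Finset.mem_univ, true_and] at hx
    exact ⟨hx.1, div_ne_zero hx.2.1 hx.2.2⟩
  have hX0card : q ^ 5 ≤ X0.card + 6 := by
    have hsub : (Finset.univ : Finset L) ⊆ X0 ∪ ({0} ∪ f₁.roots.toFinset ∪ f₂.roots.toFinset) := by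
      intro x _
      simp only [hX0, Finset.mem_union, Finset.mem_filter, Finset.mem_univ, true_and, Finset.mem_singleton,
        Multiset.mem_toFinset, mem_roots hf₁, mem_roots hf₂, IsRoot.def]
      tauto
    have e1 := Finset.card_le_card hsub
    rw [Finset.card_univ, hL] at e1
    have e2 := Finset.card_union_le X0 ({0} ∪ f₁.roots.toFinset ∪ f₂.roots.toFinset)
    have e3 := Finset.card_union_le ({0} ∪ f₁.roots.toFinset) f₂.roots.toFinset
    have e4 := Finset.card_union_le {0} f₁.roots.toFinset
    have e5 := (Multiset.toFinset_card_le f₁.roots).trans ((card_roots' f₁).trans hd₁)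
    have e6 := (Multiset.toFinset_card_le f₂.roots).trans ((card_roots' f₂).trans hd₂)
    have e7 : ({0} : Finset L).card = 1 := Finset.card_singleton 0
    omega
  set E : ℝ := 5 * Real.sqrt (Fintype.card L) with hE
  have hcast : ((Fintype.card L : ℕ) : ℝ) = (q : ℝ) ^ 5 := by rw [hL]; push_cast; rfl
  set S : Finset L := X0.filter (fun x => ∀ ℓ ∈ B ∪ T, x ^ (D / ℓ) ≠ 1 ∧ v x ^ (D / ℓ) ≠ 1) with hS
  have key := field_sieve D hDL χ X0 v hX0v E
    (fun i j hij => by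
      have := weil_gen χ hχ f₁ f₂ g k i j hf₁ hf₂ hd₁ hd₂ hco hgm hg hgX h1 h2 hgk hQ (by rw [← hDL]; exact hij)
      exact this)
    B T hB hT hBT δ θ hδ hδ0 hθ S (fun x hx h => Finset.mem_filter.2 ⟨hx, h⟩)
  by_contra hcon
  push Not at hcon
  -- cover S
  set NG : Finset L := (Finset.univ.filter (fun x : L => ¬ LinearIndependent K (fun i : Fin 5 => x ^ Fintype.card K ^ (i : ℕ))
      ∧ x ≠ 0 ∧ orderOf (x ^ M) = q - 1)) with hNG
  have hNGc := nn_good (K := K) (L := L) q M c hK hL hM (by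
    rcases hc with h | h
    · exact Or.inl h
    · exact Or.inr ⟨h.1, h.2, by omega⟩)
  have hcover : S ⊆ NG ∪ U.biUnion (fun ℓ => (nthRoots (D / ℓ) (1 : L)).toFinset ∪
      Finset.univ.filter (fun x : L => f₂.eval x ≠ 0 ∧ (f₁.eval x / f₂.eval x) ^ (D / ℓ) = 1)) := by
    intro x hx
    obtain ⟨hx1, hx2⟩ := Finset.mem_filter.1 hx
    have hx0 := hX0v x hx1
    simp only [hX0, Finset.mem_filter, Finset.mem_univ, true_and] at hx1
    rw [Finset.mem_union]
    by_contra hno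
    push Not at hno
    obtain ⟨hn1, hn2⟩ := hno
    have hxU : ∀ ℓ ∈ U, x ^ (D / ℓ) ≠ 1 ∧ v x ^ (D / ℓ) ≠ 1 := by
      intro ℓ hℓ
      have hDl : 0 < D / ℓ := by
        have := hU hℓ
        exact Nat.div_pos (Nat.le_of_mem_primeFactors this) (Nat.pos_of_mem_primeFactors this)
      constructor
      · intro h
        apply hn2
        refine Finset.mem_biUnion.2 ⟨ℓ, hℓ, Finset.mem_union_left _ ?_⟩
        rw [Multiset.mem_toFinset, mem_nthRoots hDl]; exact h
      · intro h
        apply hn2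
        refine Finset.mem_biUnion.2 ⟨ℓ, hℓ, Finset.mem_union_right _ ?_⟩
        simp only [Finset.mem_filter, Finset.mem_univ, true_and]
        exact ⟨hx1.2.2, h⟩
    have hxall : ∀ ℓ ∈ D.primeFactors, x ^ (D / ℓ) ≠ 1 ∧ v x ^ (D / ℓ) ≠ 1 := by
      intro ℓ hℓ
      rcases Finset.mem_union.1 (hall ℓ hℓ) with h | h
      · exact hx2 ℓ h
      · exact hxU ℓ h
    have hp1 : IsPrimitiveElem x := prim_of_primes x hx0.1 (fun ℓ hℓ => by
      rw [← hDL] at hℓ ⊢; exact (hxall ℓ hℓ).1)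
    have hp2 : IsPrimitiveElem (ratEval f x) := by
      rw [hfe, ratEval_eq f₁ f₂ hf₂ x hx1.2.2]
      exact prim_of_primes _ hx0.2 (fun ℓ hℓ => by rw [← hDL] at hℓ ⊢; exact (hxall ℓ hℓ).2)
    have hord : orderOf (x ^ M) = q - 1 := by
      have h3 : orderOf x = M * (q - 1) := by rw [← hDM, hDL]; exact hp1
      rw [orderOf_pow_of_dvd (by omega) (by rw [h3]; exact Nat.dvd_mul_right _ _), h3]
      exact Nat.mul_div_cancel_left _ (by omega)
    have hli : LinearIndependent K (fun i : Fin 5 => x ^ Fintype.card K ^ (i : ℕ)) := by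
      by_contra hli
      apply hn1
      simp only [hNG, Finset.mem_filter, Finset.mem_univ, true_and]
      exact ⟨hli, hx0.1, hord⟩
    refine hcon x hp1 ⟨hli, ?_⟩ hp2
    have hfr : Module.finrank K L = 5 := by
      have h3 := Module.card_eq_pow_finrank (K := K) (V := L)
      rw [hL, hK] at h3
      exact (Nat.pow_right_injective (by omega : 2 ≤ q) h3).symm
    exact hli.span_eq_top_of_card_eq_finrank' (by rw [hfr]; simp)
  have hScard : (S.card : ℝ) ≤ ((q - 1).totient / (q - 1 : ℕ) : ℝ) * (c * (q : ℝ) ^ 4) + 4 * (q : ℝ) ^ 5 * ∑ ℓ ∈ U, (1 / ℓ : ℝ) := by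
    have e1 := (Finset.card_le_card hcover).trans (Finset.card_union_le _ _)
    have e2 : (NG.card : ℝ) ≤ ((q - 1).totient / (q - 1 : ℕ) : ℝ) * (c * (q : ℝ) ^ 4) := by
      have hpos : (0 : ℝ) < ((q - 1 : ℕ) : ℝ) := by
        have : 0 < q - 1 := by omega
        exact_mod_cast this
      rw [div_mul_eq_mul_div, le_div_iff₀ hpos]
      exact_mod_cast hNGc
    have e3 : (U.biUnion (fun ℓ => (nthRoots (D / ℓ) (1 : L)).toFinset ∪
      Finset.univ.filter (fun x : L => f₂.eval x ≠ 0 ∧ (f₁.eval x / f₂.eval x) ^ (D / ℓ) = 1))).card ≤ ∑ ℓ ∈ U, 4 * (D / ℓ) := by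
      refine Finset.card_biUnion_le.trans (Finset.sum_le_sum (fun ℓ hℓ => ?_))
      have hDl : 0 < D / ℓ := by
        have := hU hℓ
        exact Nat.div_pos (Nat.le_of_mem_primeFactors this) (Nat.pos_of_mem_primeFactors this)
      have a1 := (Multiset.toFinset_card_le _).trans (card_nthRoots (D / ℓ) (1 : L))
      have a2 := fiber_count f₁ f₂ hd₁ hd₂ hne (D / ℓ) hDl
      have a3 := Finset.card_union_le (nthRoots (D / ℓ) (1 : L)).toFinset (Finset.univ.filter (fun x : L => f₂.eval x ≠ 0 ∧ (f₁.eval x / f₂.eval x) ^ (D / ℓ) = 1))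
      omega
    have e4 : ((∑ ℓ ∈ U, 4 * (D / ℓ) : ℕ) : ℝ) ≤ 4 * (q : ℝ) ^ 5 * ∑ ℓ ∈ U, (1 / ℓ : ℝ) := by
      push_cast
      rw [Finset.mul_sum]
      refine Finset.sum_le_sum (fun ℓ _ => ?_)
      rw [mul_assoc, mul_one_div]
      refine mul_le_mul_of_nonneg_left ?_ (by norm_num)
      refine Nat.cast_div_le.trans ?_
      refine div_le_div_of_nonneg_right ?_ (Nat.cast_nonneg _)
      have : D ≤ q ^ 5 := by omega
      exact_mod_cast this
    have e5 : (S.card : ℝ) ≤ NG.card + ((∑ ℓ ∈ U, 4 * (D / ℓ) : ℕ) : ℝ) := by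
      have := e1.trans (Nat.add_le_add_left e3 _)
      exact_mod_cast this
    linarith
  have hfin : θ ^ 2 * (δ * (q : ℝ) ^ 5 - 5 * Real.sqrt ((q : ℝ) ^ 5) * (4 ^ B.card * (2 * T.card - 1 + 2 * δ))) ≤
      θ ^ 2 * (δ * X0.card - E * (4 ^ B.card * (2 * T.card - 1 + 2 * δ) - δ)) := by
    refine mul_le_mul_of_nonneg_left ?_ (sq_nonneg θ)
    have e1 : (q : ℝ) ^ 5 ≤ X0.card + 6 := by exact_mod_cast hX0card
    have e2 : (6 : ℝ) ≤ E := by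
      rw [hE]
      have : (2 : ℝ) ≤ Real.sqrt (Fintype.card L) := by
        apply Real.le_sqrt_of_sq_le
        have : (25 : ℝ) < Fintype.card L := by exact_mod_cast hQ
        linarith
      linarith
    rw [← hcast, ← hE]
    rw [← hcast] at e1
    nlinarith [mul_nonneg hδ0 (by linarith : (0 : ℝ) ≤ X0.card + E - (Fintype.card L : ℕ))]
  linarith

end

section

lemma card_mod10 (A : Finset ℕ) (m : ℕ) (hA : ∀ x ∈ A, x % 10 = 1 ∧ 11 ≤ x ∧ x < m) (hm : m % 10 = 1) (hm2 : 11 ≤ m) :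
    10 * A.card + 11 ≤ m := by
  have h : A.card ≤ (Finset.Icc 1 (m / 10 - 1)).card := by
    refine Finset.card_le_card_of_injOn (fun x => x / 10) ?_ ?_
    · intro x hx
      have := hA x hx
      simp only [Finset.coe_Icc, Set.mem_Icc]
      omega
    · intro x hx y hy h
      have h1 := hA x hx
      have h2 := hA y hy
      simp only at h
      omega
  rw [Nat.card_Icc] at h
  omega

lemma invsum_le (T : Finset ℕ) (hT : ∀ x ∈ T, x % 10 = 1 ∧ 11 ≤ x) :
    ∑ ℓ ∈ T, (1 / ℓ : ℝ) ≤ ∑ i ∈ Finset.range T.card, (1 / (10 * i + 11) : ℝ) := by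
  induction T using Finset.induction_on_max with
  | empty => simp
  | insert m A hmax ih =>
    have hmA : m ∉ A := fun h => lt_irrefl _ (hmax m h)
    rw [Finset.sum_insert hmA, Finset.card_insert_of_notMem hmA, Finset.sum_range_succ]
    have h1 := ih (fun x hx => hT x (Finset.mem_insert_of_mem hx))
    have h2 := hT m (Finset.mem_insert_self _ _)
    have h3 := card_mod10 A m (fun x hx => by
      have := hT x (Finset.mem_insert_of_mem hx)
      exact ⟨this.1, this.2, hmax x hx⟩) h2.1 h2.2
    have h4 : (10 * A.card + 11 : ℝ) ≤ m := by exact_mod_cast h3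
    have h5 : (1 / m : ℝ) ≤ 1 / (10 * A.card + 11) := one_div_le_one_div_of_le (by positivity) h4
    linarith

lemma prodT_le (T : Finset ℕ) (hT : ∀ x ∈ T, x % 10 = 1 ∧ 11 ≤ x) :
    ∏ i ∈ Finset.range T.card, (10 * i + 11) ≤ ∏ ℓ ∈ T, ℓ := by
  induction T using Finset.induction_on_max with
  | empty => simp
  | insert m A hmax ih =>
    have hmA : m ∉ A := fun h => lt_irrefl _ (hmax m h)
    rw [Finset.prod_insert hmA, Finset.card_insert_of_notMem hmA, Finset.prod_range_succ, mul_comm]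
    have h1 := ih (fun x hx => hT x (Finset.mem_insert_of_mem hx))
    have h2 := hT m (Finset.mem_insert_self _ _)
    have h3 := card_mod10 A m (fun x hx => by
      have := hT x (Finset.mem_insert_of_mem hx)
      exact ⟨this.1, this.2, hmax x hx⟩) h2.1 h2.2
    exact Nat.mul_le_mul h3 h1

lemma card_ge2 (A : Finset ℕ) (m : ℕ) (hA : ∀ x ∈ A, 2 ≤ x ∧ x < m) (hm : 2 ≤ m) : A.card + 2 ≤ m := by
  have h : A ⊆ Finset.Ico 2 m := fun x hx => Finset.mem_Ico.2 (hA x hx)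
  have := Finset.card_le_card h
  rw [Nat.card_Ico] at this
  omega

lemma theta_ge (A : Finset ℕ) (hA : ∀ x ∈ A, 2 ≤ x) : (1 / (A.card + 1) : ℝ) ≤ ∏ ℓ ∈ A, (1 - 1 / ℓ : ℝ) := by
  induction A using Finset.induction_on_max with
  | empty => simp
  | insert m A hmax ih =>
    have hmA : m ∉ A := fun h => lt_irrefl _ (hmax m h)
    rw [Finset.prod_insert hmA, Finset.card_insert_of_notMem hmA]
    have h1 := ih (fun x hx => hA x (Finset.mem_insert_of_mem hx))
    have h2 := hA m (Finset.mem_insert_self _ _)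
    have h3 := card_ge2 A m (fun x hx => ⟨hA x (Finset.mem_insert_of_mem hx), hmax x hx⟩) h2
    have h4 : (A.card + 2 : ℝ) ≤ m := by exact_mod_cast h3
    have h5 : (1 / m : ℝ) ≤ 1 / (A.card + 2) := one_div_le_one_div_of_le (by positivity) h4
    push_cast
    calc (1 / (A.card + 1 + 1) : ℝ) = (1 - 1 / (A.card + 2)) * (1 / (A.card + 1)) := by field_simp; ring
      _ ≤ (1 - 1 / m) * ∏ ℓ ∈ A, (1 - 1 / ℓ : ℝ) := by
        refine mul_le_mul (by linarith) h1 (by positivity) ?_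
        have : (1 / (A.card + 2) : ℝ) ≤ 1 := by
          rw [div_le_one (by positivity)]; linarith [(Nat.cast_nonneg A.card : (0:ℝ) ≤ A.card)]
        linarith

lemma fact_le (A : Finset ℕ) (hA : ∀ x ∈ A, 2 ≤ x) : (A.card + 1).factorial ≤ ∏ ℓ ∈ A, ℓ := by
  induction A using Finset.induction_on_max with
  | empty => simp
  | insert m A hmax ih =>
    have hmA : m ∉ A := fun h => lt_irrefl _ (hmax m h)
    rw [Finset.prod_insert hmA, Finset.card_insert_of_notMem hmA, Nat.factorial_succ]
    have h1 := ih (fun x hx => hA x (Finset.mem_insert_of_mem hx))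
    have h2 := hA m (Finset.mem_insert_self _ _)
    have h3 := card_ge2 A m (fun x hx => ⟨hA x (Finset.mem_insert_of_mem hx), hmax x hx⟩) h2
    exact Nat.mul_le_mul h3 h1

/-- primes of `Φ₅(q)` not dividing `q - 1` are `1 mod 10` -/
lemma prime_mod10 (q ℓ : ℕ) (hq : 2 ≤ q) (hℓ : ℓ.Prime) (hd : ℓ ∣ q ^ 5 - 1) (hn : ¬ ℓ ∣ q - 1) :
    ℓ ∣ q ^ 4 + q ^ 3 + q ^ 2 + q + 1 ∧ ℓ % 10 = 1 ∧ 11 ≤ ℓ := by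
  have hD : q ^ 5 - 1 = (q ^ 4 + q ^ 3 + q ^ 2 + q + 1) * (q - 1) := by
    obtain ⟨t, ht⟩ : ∃ t, q = t + 1 := ⟨q - 1, by omega⟩
    rw [ht]; simp only [Nat.add_sub_cancel]
    refine Nat.sub_eq_of_eq_add ?_
    ring
  have h1 : ℓ ∣ q ^ 4 + q ^ 3 + q ^ 2 + q + 1 := by
    rw [hD] at hd
    exact (hℓ.dvd_mul.1 hd).resolve_right hn
  have hodd : (q ^ 4 + q ^ 3 + q ^ 2 + q + 1) % 2 = 1 := by
    rcases Nat.mod_two_eq_zero_or_one q with h | h <;> simp [Nat.add_mod, Nat.pow_mod, h]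
  have hl2 : ℓ ≠ 2 := by
    rintro rfl
    omega
  have hfact : Fact ℓ.Prime := ⟨hℓ⟩
  have e1 : ((q : ZMod ℓ)) ^ 5 = 1 := by
    have h2 : (((q ^ 5 - 1 : ℕ)) : ZMod ℓ) = 0 := (ZMod.natCast_eq_zero_iff _ _).2 hd
    rw [Nat.cast_sub (Nat.one_le_pow _ _ (by omega))] at h2
    push_cast at h2
    exact sub_eq_zero.1 h2
  have e2 : (q : ZMod ℓ) ≠ 1 := by
    intro h
    apply hn
    rw [← ZMod.natCast_eq_zero_iff, Nat.cast_sub (by omega)]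
    push_cast
    rw [h, sub_self]
  have hf5 : Fact (Nat.Prime 5) := ⟨by norm_num⟩
  have e3 : orderOf (q : ZMod ℓ) = 5 := orderOf_eq_prime e1 e2
  have e4 : (q : ZMod ℓ) ≠ 0 := by
    intro h; rw [h] at e1; norm_num at e1
  have e5 : 5 ∣ ℓ - 1 := by
    rw [← e3]; exact ZMod.orderOf_dvd_card_sub_one e4
  have h3 := hℓ.two_le
  have h4 : ℓ % 2 = 1 := hℓ.eq_two_or_odd.resolve_left hl2
  refine ⟨h1, by omega, by omega⟩

end

section

lemma fact_ge1 (a : ℕ) (h : 4 ≤ a) : 121 * (a + 1) ^ 2 ≤ 25 * ((a + 1).factorial + 1) ∧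
    121 * 4 ^ a ≤ 256 * ((a + 1).factorial + 1) ∧ 120 ≤ (a + 1).factorial := by
  induction a, h using Nat.le_induction with
  | base => decide
  | succ n hn ih =>
    obtain ⟨h1, h2, h3⟩ := ih
    rw [Nat.factorial_succ (n + 1)]
    set F := (n + 1).factorial
    refine ⟨?_, ?_, ?_⟩
    · nlinarith [Nat.mul_le_mul hn h3]
    · rw [pow_succ]; nlinarith [Nat.mul_le_mul hn h3]
    · nlinarith

lemma core_A (w δ K : ℝ) (hw : 0 < w) (h : (61 ≤ w ^ 2 ∧ 0.57 ≤ δ ∧ K ≤ 11) ∨ (174 ≤ w ^ 2 ∧ 0.39 ≤ δ ∧ K ≤ 27)) :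
    20 * w ^ 3 + 320 * K < δ * w ^ 5 := by
  have h7 : 7 ≤ w := by
    rcases h with h | h <;> nlinarith
  have h3 : 343 ≤ w ^ 3 := by
    calc (343 : ℝ) = 7 ^ 3 := by norm_num
      _ ≤ w ^ 3 := pow_le_pow_left₀ (by norm_num) h7 3
  have e : w ^ 5 = w ^ 3 * w ^ 2 := by ring
  rcases h with ⟨h1, h2, h4⟩ | ⟨h1, h2, h4⟩
  · have h5 : 34 ≤ δ * w ^ 2 := by nlinarith
    rw [e]; nlinarith
  · have h5 : 67 ≤ δ * w ^ 2 := by nlinarith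
    rw [e]; nlinarith

lemma core_B (w δ K : ℝ) (hw : 0 < w) (hw2 : 121 ≤ w ^ 2) (h : (61 ≤ w ^ 2 ∧ 0.57 ≤ δ ∧ K ≤ 11) ∨ (174 ≤ w ^ 2 ∧ 0.39 ≤ δ ∧ K ≤ 27)) :
    25 / 11 * w ^ 4 + 1280 / 121 * w ^ 2 * K < δ * w ^ 5 := by
  have h7 : 11 ≤ w := by nlinarith
  have e : w ^ 5 = w ^ 2 * (w ^ 2 * w) := by ring
  have e4 : w ^ 4 = w ^ 2 * w ^ 2 := by ring
  suffices hs : 25 / 11 * w ^ 2 + 1280 / 121 * K < δ * w * w ^ 2 by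
    rw [e, e4]; nlinarith [mul_lt_mul_of_pos_right hs (by positivity : 0 < w ^ 2)]
  rcases h with ⟨h1, h2, h4⟩ | ⟨h1, h2, h4⟩
  · have h5 : 6.27 ≤ δ * w := by nlinarith
    nlinarith
  · have h8 : 13 ≤ w := by nlinarith
    have h5 : 5 ≤ δ * w := by nlinarith
    nlinarith

lemma core (w δ : ℝ) (q a s : ℕ) (hw : 0 < w) (hwq : w ^ 2 = q) (hδ1 : δ ≤ 1)
    (ha : (a + 1).factorial + 1 ≤ q)
    (h : (61 ≤ q ∧ 0.57 ≤ δ ∧ s ≤ 5) ∨ (174 ≤ q ∧ 0.39 ≤ δ ∧ s ≤ 13)) :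
    (a + 1) * (5 * w ^ 8) < δ * w ^ 10 - 5 * w ^ 5 * (4 ^ a * (2 * s - 1 + 2 * δ)) := by
  have hs : (0 : ℝ) ≤ s := Nat.cast_nonneg s
  have hδ0 : 0.39 ≤ δ := by
    rcases h with ⟨_, h, _⟩ | ⟨_, h, _⟩ <;> norm_num at h ⊢ <;> linarith
  set K : ℝ := 2 * s + 1 with hK
  have hK1 : 2 * s - 1 + 2 * δ ≤ K := by linarith
  have hK0 : 0 ≤ K := by linarith
  have h' : (61 ≤ w ^ 2 ∧ 0.57 ≤ δ ∧ K ≤ 11) ∨ (174 ≤ w ^ 2 ∧ 0.39 ≤ δ ∧ K ≤ 27) := by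
    rw [hwq]
    rcases h with ⟨h1, h2, h3⟩ | ⟨h1, h2, h3⟩
    · left
      have : (s : ℝ) ≤ 5 := by exact_mod_cast h3
      exact ⟨by exact_mod_cast h1, h2, by linarith⟩
    · right
      have : (s : ℝ) ≤ 13 := by exact_mod_cast h3
      exact ⟨by exact_mod_cast h1, h2, by linarith⟩
  suffices hsuf : (a + 1) * 5 * w ^ 3 + 5 * (4 ^ a * K) < δ * w ^ 5 by
    have h5 : 0 < w ^ 5 := by positivity
    have h6 : (4 : ℝ) ^ a * (2 * s - 1 + 2 * δ) ≤ 4 ^ a * K := mul_le_mul_of_nonneg_left hK1 (by positivity)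
    have h7 := mul_lt_mul_of_pos_right hsuf h5
    have h8 := mul_le_mul_of_nonneg_left h6 h5.le
    have e1 : w ^ 8 = w ^ 3 * w ^ 5 := by ring
    have e2 : w ^ 10 = w ^ 5 * w ^ 5 := by ring
    rw [e1, e2]
    linarith
  rcases Nat.lt_or_ge a 4 with h4 | h4
  · have hA := core_A w δ K hw h'
    have a1 : (a : ℝ) ≤ 3 := by exact_mod_cast (by omega : a ≤ 3)
    have a2 : (4 : ℝ) ^ a ≤ 64 := by
      calc (4 : ℝ) ^ a ≤ 4 ^ 3 := pow_le_pow_right₀ (by norm_num) (by omega)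
        _ = 64 := by norm_num
    have b1 : (a + 1) * 5 * w ^ 3 ≤ 20 * w ^ 3 := mul_le_mul_of_nonneg_right (by linarith) (by positivity)
    have b2 : (4 : ℝ) ^ a * K ≤ 64 * K := mul_le_mul_of_nonneg_right a2 hK0
    linarith
  · obtain ⟨f1, f2, f3⟩ := fact_ge1 a h4
    have g1 : 121 * ((a : ℝ) + 1) ^ 2 ≤ 25 * w ^ 2 := by
      rw [hwq]; exact_mod_cast f1.trans (Nat.mul_le_mul_left _ ha)
    have g2 : 121 * (4 : ℝ) ^ a ≤ 256 * w ^ 2 := by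
      rw [hwq]; exact_mod_cast f2.trans (Nat.mul_le_mul_left _ ha)
    have g3 : 121 ≤ w ^ 2 := by rw [hwq]; exact_mod_cast (by omega : 121 ≤ q)
    have hB := core_B w δ K hw g3 h'
    have a1 : (a : ℝ) + 1 ≤ 5 / 11 * w := by
      refine (pow_le_pow_iff_left₀ (by positivity) (by positivity) two_ne_zero).1 ?_
      rw [mul_pow]; linarith
    have b1 : (a + 1) * 5 * w ^ 3 ≤ 25 / 11 * w ^ 4 := by
      have := mul_le_mul_of_nonneg_right a1 (by positivity : 0 ≤ 5 * w ^ 3)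
      calc (a + 1) * 5 * w ^ 3 = (a + 1) * (5 * w ^ 3) := by ring
        _ ≤ _ := this
        _ = _ := by ring
    have b2 : (4 : ℝ) ^ a * K ≤ 256 / 121 * w ^ 2 * K := mul_le_mul_of_nonneg_right (by linarith) hK0
    linarith

lemma pow16_fact (a : ℕ) : 16 ^ a ≤ 55110 * (a + 1).factorial := by
  rcases Nat.lt_or_ge a 15 with h | h
  · interval_cases a <;> decide
  · induction a, h using Nat.le_induction with
    | base => decide
    | succ n hn ih =>
      rw [Nat.factorial_succ (n + 1), pow_succ]
      nlinarith [Nat.mul_le_mul_right ((n + 1).factorial) (by omega : 16 ≤ n + 1 + 1)]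

lemma prod10_ge (s : ℕ) (h : 14 ≤ s) : 10 ^ 8 * 16 ^ s ≤ ∏ i ∈ Finset.range s, (10 * i + 11) := by
  induction s, h using Nat.le_induction with
  | base => decide
  | succ n hn ih =>
    rw [Finset.prod_range_succ, pow_succ 16 n, ← mul_assoc]
    exact Nat.mul_le_mul ih (by omega)

lemma pow10_lt (n : ℕ) (h : 14 ≤ n) : 10 ^ 3 * (n + 1) ^ 10 < 16 ^ n := by
  induction n, h using Nat.le_induction with
  | base => norm_num
  | succ n hn ih =>
    have h1 : (n + 1 + 1) ^ 10 ≤ 16 * (n + 1) ^ 10 := by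
      have h2 : 15 * (n + 1 + 1) ≤ 16 * (n + 1) := by omega
      have h3 := Nat.pow_le_pow_left h2 10
      rw [mul_pow, mul_pow] at h3
      have h4 : (16 : ℕ) ^ 10 ≤ 16 * 15 ^ 10 := by norm_num
      have h5 := Nat.mul_le_mul_right ((n + 1) ^ 10) h4
      have h6 : 15 ^ 10 * (n + 1 + 1) ^ 10 ≤ 15 ^ 10 * (16 * (n + 1) ^ 10) := by
        calc _ ≤ _ := h3
          _ ≤ _ := h5
          _ = _ := by ring
      exact Nat.le_of_mul_le_mul_left h6 (by norm_num)
    calc 10 ^ 3 * (n + 1 + 1) ^ 10 ≤ 10 ^ 3 * (16 * (n + 1) ^ 10) := Nat.mul_le_mul_left _ h1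
      _ = 16 * (10 ^ 3 * (n + 1) ^ 10) := by ring
      _ < 16 * 16 ^ n := Nat.mul_lt_mul_of_pos_left ih (by norm_num)
      _ = 16 ^ (n + 1) := by ring

lemma core_big (a s q : ℕ) (hq : 2 ≤ q) (ha : (a + 1).factorial + 1 ≤ q) (hs : 14 ≤ s)
    (hP : ∏ i ∈ Finset.range s, (10 * i + 11) ≤ q ^ 4 + q ^ 3 + q ^ 2 + q + 1) :
    100 * 16 ^ (a + s) ≤ q ^ 5 ∧ 10 * (a + s + 1) ^ 2 < q := by
  have h1 : q ^ 4 + q ^ 3 + q ^ 2 + q + 1 ≤ 2 * q ^ 4 := by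
    obtain ⟨t, rfl⟩ : ∃ t, q = t + 2 := ⟨q - 2, by omega⟩
    ring_nf
    nlinarith [Nat.zero_le (t ^ 2), Nat.zero_le (t ^ 3), Nat.zero_le (t ^ 4)]
  have h2 : 16 ^ a ≤ 55110 * q := (pow16_fact a).trans (Nat.mul_le_mul_left _ (by omega))
  have h3 : 10 ^ 8 * 16 ^ s ≤ 2 * q ^ 4 := (prod10_ge s hs).trans (hP.trans h1)
  have h4 := Nat.mul_le_mul h2 h3
  have h5 : 100 * 16 ^ (a + s) ≤ q ^ 5 := by
    have e1 : 16 ^ a * (10 ^ 8 * 16 ^ s) = 10 ^ 6 * (100 * 16 ^ (a + s)) := by rw [pow_add]; ring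
    have e2 : 55110 * q * (2 * q ^ 4) = 110220 * q ^ 5 := by ring
    rw [e1, e2] at h4
    omega
  refine ⟨h5, ?_⟩
  by_contra hlt
  push Not at hlt
  have h6 := pow10_lt (a + s) (by omega)
  have h7 := Nat.pow_le_pow_left hlt 5
  have e : (10 * (a + s + 1) ^ 2) ^ 5 = 100 * (10 ^ 3 * (a + s + 1) ^ 10) := by ring
  rw [e] at h7
  omega

end

section

theorem large_case (q : ℕ) (hq : 61 ≤ q) : memB 3 2 q 5 := by
  classical
  set B := (q - 1).primeFactors with hB
  set T := (q ^ 5 - 1).primeFactors \ B with hT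
  have hqD : q - 1 ∣ q ^ 5 - 1 := by simpa using Nat.sub_dvd_pow_sub_pow q 1 5
  have hD0 : q ^ 5 - 1 ≠ 0 := by
    have : 2 ^ 5 ≤ q ^ 5 := Nat.pow_le_pow_left (by omega) 5
    omega
  have hBD : B ⊆ (q ^ 5 - 1).primeFactors := Nat.primeFactors_mono hqD hD0
  have hTD : T ⊆ (q ^ 5 - 1).primeFactors := Finset.sdiff_subset
  have hBT : Disjoint B T := Finset.disjoint_sdiff
  have hTprop : ∀ ℓ ∈ T, ℓ ∣ q ^ 4 + q ^ 3 + q ^ 2 + q + 1 ∧ ℓ % 10 = 1 ∧ 11 ≤ ℓ := by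
    intro ℓ hℓ
    obtain ⟨h1, h2⟩ := Finset.mem_sdiff.1 hℓ
    have hp := Nat.prime_of_mem_primeFactors h1
    exact prime_mod10 q ℓ (by omega) hp (Nat.dvd_of_mem_primeFactors h1)
      (fun h => h2 (Nat.mem_primeFactors.2 ⟨hp, h, by omega⟩))
  have hTm : ∀ x ∈ T, x % 10 = 1 ∧ 11 ≤ x := fun x hx => (hTprop x hx).2
  have hP : ∏ i ∈ Finset.range T.card, (10 * i + 11) ≤ q ^ 4 + q ^ 3 + q ^ 2 + q + 1 := by
    refine (prodT_le T hTm).trans (Nat.le_of_dvd (by omega) ?_)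
    refine Finset.prod_primes_dvd _ (fun ℓ hℓ => ?_) (fun ℓ hℓ => (hTprop ℓ hℓ).1)
    exact (Nat.prime_of_mem_primeFactors (hTD hℓ)).prime
  have hB2 : ∀ x ∈ B, 2 ≤ x := fun x hx => (Nat.prime_of_mem_primeFactors hx).two_le
  have ha : (B.card + 1).factorial + 1 ≤ q := by
    have := (fact_le B hB2).trans (Nat.le_of_dvd (by omega) (Nat.prod_primeFactors_dvd (q - 1)))
    omega
  set w : ℝ := Real.sqrt q with hw
  have hq0 : (0 : ℝ) < q := by exact_mod_cast (by omega : 0 < q)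
  have hw0 : 0 < w := Real.sqrt_pos.2 hq0
  have hwq : w ^ 2 = q := Real.sq_sqrt hq0.le
  have hsq : Real.sqrt ((q : ℝ) ^ 5) = w ^ 5 := by
    rw [← hwq, show (w ^ 2) ^ 5 = (w ^ 5) ^ 2 by ring]
    exact Real.sqrt_sq (by positivity)
  have hθtot := totient_real (q - 1) (by omega)
  rcases Nat.lt_or_ge T.card 14 with hs | hs
  · set δ : ℝ := 1 - 2 * ∑ ℓ ∈ T, (1 / ℓ : ℝ) with hδ
    set θ : ℝ := ∏ ℓ ∈ B, (1 - 1 / ℓ : ℝ) with hθ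
    have hsum := invsum_le T hTm
    have hδ1 : δ ≤ 1 := by
      have : (0 : ℝ) ≤ ∑ ℓ ∈ T, (1 / ℓ : ℝ) := Finset.sum_nonneg (fun i _ => by positivity)
      linarith
    have hmono : ∀ n : ℕ, T.card ≤ n → ∑ i ∈ Finset.range T.card, (1 / (10 * i + 11) : ℝ) ≤ ∑ i ∈ Finset.range n, (1 / (10 * i + 11) : ℝ) := by
      intro n hn
      exact Finset.sum_le_sum_of_subset_of_nonneg (Finset.range_mono hn) (fun i _ _ => by positivity)
    have hcase : (61 ≤ q ∧ 0.57 ≤ δ ∧ T.card ≤ 5) ∨ (174 ≤ q ∧ 0.39 ≤ δ ∧ T.card ≤ 13) := by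
      rcases Nat.lt_or_ge T.card 6 with h6 | h6
      · left
        refine ⟨hq, ?_, by omega⟩
        have h1 := hmono 5 (by omega)
        have h2 : ∑ i ∈ Finset.range 5, (1 / (10 * i + 11) : ℝ) ≤ 0.215 := by
          simp only [Finset.sum_range_succ, Finset.sum_range_zero]; norm_num
        rw [hδ]; linarith
      · right
        refine ⟨?_, ?_, by omega⟩
        · by_contra hlt
          have h1 : ∏ i ∈ Finset.range 6, (10 * i + 11) ≤ ∏ i ∈ Finset.range T.card, (10 * i + 11) :=
            Finset.prod_le_prod_of_subset_of_one_le' (Finset.range_mono h6) (fun i _ _ => by omega)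
          have h2 := h1.trans hP
          have hq3 : q ≤ 173 := by omega
          have h3 : q ^ 4 + q ^ 3 + q ^ 2 + q + 1 ≤ 173 ^ 4 + 173 ^ 3 + 173 ^ 2 + 173 + 1 := by gcongr
          have h4 := h2.trans h3
          revert h4
          decide
        · have h1 := hmono 13 (by omega)
          have h2 : ∑ i ∈ Finset.range 13, (1 / (10 * i + 11) : ℝ) ≤ 0.305 := by
            simp only [Finset.sum_range_succ, Finset.sum_range_zero]; norm_num
          rw [hδ]; linarith
    have hδ0 : 0 ≤ δ := by
      rcases hcase with ⟨_, h, _⟩ | ⟨_, h, _⟩ <;> norm_num at h ⊢ <;> linarith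
    have hcore := core w δ q B.card T.card hw0 hwq hδ1 ha hcase
    have hθge := theta_ge B hB2
    rw [← hθ] at hθge
    refine criterion q 5 (by omega) (Or.inl rfl) B T ∅ hBT hBD hTD (by simp) ?_ δ θ hδ hδ0 hθ ?_
    · intro ℓ hℓ
      simp only [hT, Finset.union_empty, Finset.union_sdiff_self_eq_union, Finset.mem_union]
      exact Or.inr hℓ
    · rw [← hθtot, hsq, Finset.sum_empty, mul_zero, add_zero, ← hwq]
      set G := δ * (w ^ 2) ^ 5 - 5 * w ^ 5 * (4 ^ B.card * (2 * T.card - 1 + 2 * δ)) with hG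
      have hGe : (B.card + 1) * (5 * w ^ 8) < G := by
        rw [hG, show (w ^ 2) ^ 5 = w ^ 10 by ring]; exact hcore
      have hθ0 : 0 < θ := lt_of_lt_of_le (by positivity) hθge
      have hG0 : 0 < G := lt_of_le_of_lt (by positivity) hGe
      have h1 : 5 * w ^ 8 < θ * G := by
        have h2 : 1 ≤ θ * (B.card + 1) := by
          have := mul_le_mul_of_nonneg_right hθge (by positivity : (0 : ℝ) ≤ B.card + 1)
          rwa [one_div, inv_mul_cancel₀ (by positivity)] at this
        have h3 : θ * ((B.card + 1) * (5 * w ^ 8)) < θ * G := mul_lt_mul_of_pos_left hGe hθ0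
        have h4 : 1 * (5 * w ^ 8) ≤ θ * (B.card + 1) * (5 * w ^ 8) := mul_le_mul_of_nonneg_right h2 (by positivity)
        linarith
      have h5 := mul_lt_mul_of_pos_left h1 hθ0
      push_cast
      calc θ * (5 * (w ^ 2) ^ 4) = θ * (5 * w ^ 8) := by ring
        _ < θ * (θ * G) := h5
        _ = θ ^ 2 * G := by ring
  · obtain ⟨hb1, hb2⟩ := core_big B.card T.card q (by omega) ha hs hP
    set A := (q ^ 5 - 1).primeFactors with hA
    have hAc : A.card = B.card + T.card := by
      rw [← Finset.card_union_of_disjoint hBT]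
      congr 1
      simp only [hT, Finset.union_sdiff_self_eq_union]
      exact (Finset.union_eq_right.2 hBD).symm
    rw [← hAc] at hb1 hb2
    set θ : ℝ := ∏ ℓ ∈ A, (1 - 1 / ℓ : ℝ) with hθ
    have hA2 : ∀ x ∈ A, 2 ≤ x := fun x hx => (Nat.prime_of_mem_primeFactors hx).two_le
    have hθge := theta_ge A hA2
    rw [← hθ] at hθge
    refine criterion q 5 (by omega) (Or.inl rfl) A ∅ ∅ (by simp) (Finset.Subset.refl _) (by simp) (by simp) ?_ 1 θ (by simp) (by norm_num) hθ ?_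
    · intro ℓ hℓ; exact Finset.mem_union_left _ (Finset.mem_union_left _ hℓ)
    · rw [hsq, Finset.sum_empty, mul_zero, add_zero]
      have e1 : ((q - 1).totient / (q - 1 : ℕ) : ℝ) ≤ 1 := by
        apply div_le_one_of_le₀ _ (Nat.cast_nonneg _)
        exact_mod_cast Nat.totient_le _
      have e2 : (10 : ℝ) * 4 ^ A.card ≤ w ^ 5 := by
        refine (pow_le_pow_iff_left₀ (by positivity) (by positivity) two_ne_zero).1 ?_
        rw [← pow_mul, mul_comm 5 2, pow_mul, hwq, mul_pow, ← pow_mul, mul_comm _ 2, pow_mul]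
        norm_num
        exact_mod_cast hb1
      have e3 : (10 : ℝ) * (A.card + 1) ^ 2 < q := by exact_mod_cast hb2
      have hn0 : (0 : ℝ) < A.card + 1 := by positivity
      set n : ℝ := A.card + 1 with hn
      have e4 : (1 / n) ^ 2 ≤ θ ^ 2 := pow_le_pow_left₀ (by positivity) hθge 2
      have e5 : (q : ℝ) ^ 5 / 2 ≤ 1 * (q : ℝ) ^ 5 - 5 * w ^ 5 * (4 ^ A.card * (2 * ((∅ : Finset ℕ).card : ℝ) - 1 + 2 * 1)) := by
        have h1 := mul_le_mul_of_nonneg_left e2 (by positivity : 0 ≤ w ^ 5)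
        have h2 : w ^ 5 * w ^ 5 = (q : ℝ) ^ 5 := by rw [← hwq]; ring
        simp only [Finset.card_empty, Nat.cast_zero]
        linarith
      have hq4 : (0 : ℝ) < (q : ℝ) ^ 4 := by positivity
      calc ((q - 1).totient / (q - 1 : ℕ) : ℝ) * ((5 : ℕ) * (q : ℝ) ^ 4) ≤ 1 * (5 * (q : ℝ) ^ 4) := by
            push_cast; exact mul_le_mul_of_nonneg_right e1 (by positivity)
        _ = (1 / n) ^ 2 * ((10 * n ^ 2) * (q : ℝ) ^ 4 / 2) := by field_simp; norm_num
        _ < (1 / n) ^ 2 * ((q : ℝ) ^ 5 / 2) := by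
            refine mul_lt_mul_of_pos_left ?_ (by positivity)
            have := mul_lt_mul_of_pos_right e3 hq4
            have e6 : (q : ℝ) ^ 5 = q * (q : ℝ) ^ 4 := by ring
            rw [e6]; linarith
        _ ≤ θ ^ 2 * ((q : ℝ) ^ 5 / 2) := mul_le_mul_of_nonneg_right e4 (by positivity)
        _ ≤ _ := mul_le_mul_of_nonneg_left e5 (sq_nonneg θ)

end

section

open Polynomial

theorem crit_num (q c : ℕ) (hq8 : 8 ≤ q) (hc : c = 5 ∨ (c = 2 ∧ q % 5 ≠ 1)) (B T U : Finset ℕ) (t : ℕ) (r : ℝ)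
    (hBT : Disjoint B T)
    (hp : ∀ ℓ ∈ B ∪ T ∪ U, ℓ.Prime ∧ ℓ ∣ q ^ 5 - 1)
    (hdvd : (q ^ 5 - 1) ∣ (∏ ℓ ∈ B ∪ T ∪ U, ℓ) ^ 10)
    (ht : (q - 1).totient = t)
    (hr : 0 ≤ r) (hr2 : (q : ℝ) ^ 5 ≤ r ^ 2)
    (hδ0 : 0 ≤ 1 - 2 * ∑ ℓ ∈ T, (1 / ℓ : ℝ))
    (hT1 : 1 ≤ T.card)
    (hineq : ((t : ℝ) / (q - 1 : ℕ) : ℝ) * (c * (q : ℝ) ^ 4) + 4 * (q : ℝ) ^ 5 * ∑ ℓ ∈ U, (1 / ℓ : ℝ) <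
      (∏ ℓ ∈ B, (1 - 1 / ℓ : ℝ)) ^ 2 * ((1 - 2 * ∑ ℓ ∈ T, (1 / ℓ : ℝ)) * (q : ℝ) ^ 5 - 5 * r * (4 ^ B.card * (2 * T.card - 1 + 2 * (1 - 2 * ∑ ℓ ∈ T, (1 / ℓ : ℝ)))))) :
    memB 3 2 q 5 := by
  have hq5 : q ^ 5 - 1 ≠ 0 := by
    have : 8 ^ 5 ≤ q ^ 5 := Nat.pow_le_pow_left hq8 5
    omega
  have hmem : ∀ ℓ ∈ B ∪ T ∪ U, ℓ ∈ (q ^ 5 - 1).primeFactors := fun ℓ h =>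
    Nat.mem_primeFactors.2 ⟨(hp ℓ h).1, (hp ℓ h).2, hq5⟩
  refine criterion q c hq8 hc B T U hBT (fun ℓ h => hmem ℓ (by simp [h])) (fun ℓ h => hmem ℓ (by simp [h]))
    (fun ℓ h => hmem ℓ (by simp [h])) ?_ _ _ rfl hδ0 rfl ?_
  · intro ℓ hℓ
    have hℓp := Nat.prime_of_mem_primeFactors hℓ
    have h1 := hℓp.dvd_of_dvd_pow ((Nat.dvd_of_mem_primeFactors hℓ).trans hdvd)
    obtain ⟨a, ha, hla⟩ := (Prime.dvd_finsetProd_iff hℓp.prime _).1 h1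
    rwa [(Nat.prime_dvd_prime_iff_eq hℓp (hp a ha).1).1 hla]
  · rw [ht]
    refine hineq.trans_le ?_
    have hs : Real.sqrt ((q : ℝ) ^ 5) ≤ r := Real.sqrt_le_iff.2 ⟨hr, hr2⟩
    have hT1' : (1 : ℝ) ≤ T.card := by exact_mod_cast hT1
    apply mul_le_mul_of_nonneg_left _ (sq_nonneg _)
    apply sub_le_sub_left
    apply mul_le_mul_of_nonneg_right (by linarith)
    apply mul_nonneg (by positivity)
    linarith

theorem small_8 : memB 3 2 8 5 := by
  refine crit_num 8 2 (by norm_num) (Or.inr ⟨rfl, by norm_num⟩) {7} {31,151} ∅ 6 182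
    (by simp) ?_ (by norm_num) (by decide) (by norm_num) (by norm_num) ?_ (by simp) ?_
  · simp only [Finset.mem_union, Finset.mem_insert, Finset.mem_singleton, Finset.notMem_empty]
    intro ℓ h
    simp only [or_false, or_assoc] at h
    rcases h with rfl | rfl | rfl <;> norm_num
  · norm_num [Finset.sum_insert]
  · norm_num [Finset.sum_insert, Finset.prod_insert, Finset.card_insert_of_notMem]

theorem small_13 : memB 3 2 13 5 := by
  refine crit_num 13 2 (by norm_num) (Or.inr ⟨rfl, by norm_num⟩) {2,3} {30941} ∅ 4 610
    (by simp) ?_ (by norm_num) (by decide) (by norm_num) (by norm_num) ?_ (by simp) ?_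
  · simp only [Finset.mem_union, Finset.mem_insert, Finset.mem_singleton, Finset.notMem_empty]
    intro ℓ h
    simp only [or_false, or_assoc] at h
    rcases h with rfl | rfl | rfl <;> norm_num
  · norm_num [Finset.sum_insert]
  · norm_num [Finset.sum_insert, Finset.prod_insert, Finset.card_insert_of_notMem]

theorem small_17 : memB 3 2 17 5 := by
  refine crit_num 17 2 (by norm_num) (Or.inr ⟨rfl, by norm_num⟩) {2} {88741} ∅ 8 1192
    (by simp) ?_ (by norm_num) (by decide) (by norm_num) (by norm_num) ?_ (by simp) ?_
  · simp only [Finset.mem_union, Finset.mem_insert, Finset.mem_singleton, Finset.notMem_empty]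
    intro ℓ h
    simp only [or_false, or_assoc] at h
    rcases h with rfl | rfl <;> norm_num
  · norm_num [Finset.sum_insert]
  · norm_num [Finset.sum_insert, Finset.prod_insert, Finset.card_insert_of_notMem]

theorem small_19 : memB 3 2 19 5 := by
  refine crit_num 19 2 (by norm_num) (Or.inr ⟨rfl, by norm_num⟩) {2,3} {151,911} ∅ 6 1574
    (by simp) ?_ (by norm_num) (by decide) (by norm_num) (by norm_num) ?_ (by simp) ?_
  · simp only [Finset.mem_union, Finset.mem_insert, Finset.mem_singleton, Finset.notMem_empty]
    intro ℓ h
    simp only [or_false, or_assoc] at h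
    rcases h with rfl | rfl | rfl | rfl <;> norm_num
  · norm_num [Finset.sum_insert]
  · norm_num [Finset.sum_insert, Finset.prod_insert, Finset.card_insert_of_notMem]

theorem small_23 : memB 3 2 23 5 := by
  refine crit_num 23 5 (by norm_num) (Or.inl rfl) {2,11} {292561} ∅ 10 2537
    (by simp) ?_ (by norm_num) (by decide) (by norm_num) (by norm_num) ?_ (by simp) ?_
  · simp only [Finset.mem_union, Finset.mem_insert, Finset.mem_singleton, Finset.notMem_empty]
    intro ℓ h
    simp only [or_false, or_assoc] at h
    rcases h with rfl | rfl | rfl <;> norm_num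
  · norm_num [Finset.sum_insert]
  · norm_num [Finset.sum_insert, Finset.prod_insert, Finset.card_insert_of_notMem]

theorem small_25 : memB 3 2 25 5 := by
  refine crit_num 25 5 (by norm_num) (Or.inl rfl) {2,3} {11,71,521} ∅ 8 3126
    (by simp) ?_ (by norm_num) (by decide) (by norm_num) (by norm_num) ?_ (by simp) ?_
  · simp only [Finset.mem_union, Finset.mem_insert, Finset.mem_singleton, Finset.notMem_empty]
    intro ℓ h
    simp only [or_false, or_assoc] at h
    rcases h with rfl | rfl | rfl | rfl | rfl <;> norm_num
  · norm_num [Finset.sum_insert]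
  · norm_num [Finset.sum_insert, Finset.prod_insert, Finset.card_insert_of_notMem]

theorem small_27 : memB 3 2 27 5 := by
  refine crit_num 27 5 (by norm_num) (Or.inl rfl) {2,13} {11,4561} ∅ 12 3788
    (by simp) ?_ (by norm_num) (by decide) (by norm_num) (by norm_num) ?_ (by simp) ?_
  · simp only [Finset.mem_union, Finset.mem_insert, Finset.mem_singleton, Finset.notMem_empty]
    intro ℓ h
    simp only [or_false, or_assoc] at h
    rcases h with rfl | rfl | rfl | rfl <;> norm_num
  · norm_num [Finset.sum_insert]
  · norm_num [Finset.sum_insert, Finset.prod_insert, Finset.card_insert_of_notMem]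

theorem small_29 : memB 3 2 29 5 := by
  refine crit_num 29 5 (by norm_num) (Or.inl rfl) {2,7} {732541} ∅ 12 4529
    (by simp) ?_ (by norm_num) (by decide) (by norm_num) (by norm_num) ?_ (by simp) ?_
  · simp only [Finset.mem_union, Finset.mem_insert, Finset.mem_singleton, Finset.notMem_empty]
    intro ℓ h
    simp only [or_false, or_assoc] at h
    rcases h with rfl | rfl | rfl <;> norm_num
  · norm_num [Finset.sum_insert]
  · norm_num [Finset.sum_insert, Finset.prod_insert, Finset.card_insert_of_notMem]

theorem small_31 : memB 3 2 31 5 := by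
  refine crit_num 31 5 (by norm_num) (Or.inl rfl) {2,3,5} {11} {17351} 8 5351
    (by simp) ?_ (by norm_num) (by decide) (by norm_num) (by norm_num) ?_ (by simp) ?_
  · simp only [Finset.mem_union, Finset.mem_insert, Finset.mem_singleton, Finset.notMem_empty]
    intro ℓ h
    simp only [or_false, or_assoc] at h
    rcases h with rfl | rfl | rfl | rfl | rfl <;> norm_num
  · norm_num [Finset.sum_insert]
  · norm_num [Finset.sum_insert, Finset.prod_insert, Finset.card_insert_of_notMem]

theorem small_32 : memB 3 2 32 5 := by
  refine crit_num 32 5 (by norm_num) (Or.inl rfl) {31} {601,1801} ∅ 30 5793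
    (by simp) ?_ (by norm_num) (by decide) (by norm_num) (by norm_num) ?_ (by simp) ?_
  · simp only [Finset.mem_union, Finset.mem_insert, Finset.mem_singleton, Finset.notMem_empty]
    intro ℓ h
    simp only [or_false, or_assoc] at h
    rcases h with rfl | rfl | rfl <;> norm_num
  · norm_num [Finset.sum_insert]
  · norm_num [Finset.sum_insert, Finset.prod_insert, Finset.card_insert_of_notMem]

theorem small_37 : memB 3 2 37 5 := by
  refine crit_num 37 5 (by norm_num) (Or.inl rfl) {2,3} {11,41,4271} ∅ 12 8328
    (by simp) ?_ (by norm_num) (by decide) (by norm_num) (by norm_num) ?_ (by simp) ?_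
  · simp only [Finset.mem_union, Finset.mem_insert, Finset.mem_singleton, Finset.notMem_empty]
    intro ℓ h
    simp only [or_false, or_assoc] at h
    rcases h with rfl | rfl | rfl | rfl | rfl <;> norm_num
  · norm_num [Finset.sum_insert]
  · norm_num [Finset.sum_insert, Finset.prod_insert, Finset.card_insert_of_notMem]

theorem small_41 : memB 3 2 41 5 := by
  refine crit_num 41 5 (by norm_num) (Or.inl rfl) {2,5} {579281} ∅ 16 10764
    (by simp) ?_ (by norm_num) (by decide) (by norm_num) (by norm_num) ?_ (by simp) ?_
  · simp only [Finset.mem_union, Finset.mem_insert, Finset.mem_singleton, Finset.notMem_empty]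
    intro ℓ h
    simp only [or_false, or_assoc] at h
    rcases h with rfl | rfl | rfl <;> norm_num
  · norm_num [Finset.sum_insert]
  · norm_num [Finset.sum_insert, Finset.prod_insert, Finset.card_insert_of_notMem]

theorem small_43 : memB 3 2 43 5 := by
  refine crit_num 43 5 (by norm_num) (Or.inl rfl) {2,3,7} {3500201} ∅ 12 12125
    (by simp) ?_ (by norm_num) (by decide) (by norm_num) (by norm_num) ?_ (by simp) ?_
  · simp only [Finset.mem_union, Finset.mem_insert, Finset.mem_singleton, Finset.notMem_empty]
    intro ℓ h
    simp only [or_false, or_assoc] at h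
    rcases h with rfl | rfl | rfl | rfl <;> norm_num
  · norm_num [Finset.sum_insert]
  · norm_num [Finset.sum_insert, Finset.prod_insert, Finset.card_insert_of_notMem]

theorem small_47 : memB 3 2 47 5 := by
  refine crit_num 47 5 (by norm_num) (Or.inl rfl) {2,23} {11,31,14621} ∅ 22 15145
    (by simp) ?_ (by norm_num) (by decide) (by norm_num) (by norm_num) ?_ (by simp) ?_
  · simp only [Finset.mem_union, Finset.mem_insert, Finset.mem_singleton, Finset.notMem_empty]
    intro ℓ h
    simp only [or_false, or_assoc] at h
    rcases h with rfl | rfl | rfl | rfl | rfl <;> norm_num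
  · norm_num [Finset.sum_insert]
  · norm_num [Finset.sum_insert, Finset.prod_insert, Finset.card_insert_of_notMem]

theorem small_49 : memB 3 2 49 5 := by
  refine crit_num 49 5 (by norm_num) (Or.inl rfl) {2,3} {11,191,2801} ∅ 16 16808
    (by simp) ?_ (by norm_num) (by decide) (by norm_num) (by norm_num) ?_ (by simp) ?_
  · simp only [Finset.mem_union, Finset.mem_insert, Finset.mem_singleton, Finset.notMem_empty]
    intro ℓ h
    simp only [or_false, or_assoc] at h
    rcases h with rfl | rfl | rfl | rfl | rfl <;> norm_num
  · norm_num [Finset.sum_insert]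
  · norm_num [Finset.sum_insert, Finset.prod_insert, Finset.card_insert_of_notMem]

theorem small_53 : memB 3 2 53 5 := by
  refine crit_num 53 5 (by norm_num) (Or.inl rfl) {2,13} {11,131,5581} ∅ 24 20450
    (by simp) ?_ (by norm_num) (by decide) (by norm_num) (by norm_num) ?_ (by simp) ?_
  · simp only [Finset.mem_union, Finset.mem_insert, Finset.mem_singleton, Finset.notMem_empty]
    intro ℓ h
    simp only [or_false, or_assoc] at h
    rcases h with rfl | rfl | rfl | rfl | rfl <;> norm_num
  · norm_num [Finset.sum_insert]
  · norm_num [Finset.sum_insert, Finset.prod_insert, Finset.card_insert_of_notMem]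

theorem small_59 : memB 3 2 59 5 := by
  refine crit_num 59 5 (by norm_num) (Or.inl rfl) {2,29} {11,41,151,181} ∅ 28 26739
    (by simp) ?_ (by norm_num) (by decide) (by norm_num) (by norm_num) ?_ (by simp) ?_
  · simp only [Finset.mem_union, Finset.mem_insert, Finset.mem_singleton, Finset.notMem_empty]
    intro ℓ h
    simp only [or_false, or_assoc] at h
    rcases h with rfl | rfl | rfl | rfl | rfl | rfl <;> norm_num
  · norm_num [Finset.sum_insert]
  · norm_num [Finset.sum_insert, Finset.prod_insert, Finset.card_insert_of_notMem]

end

theorem npp_of_two {n p r : ℕ} (hp : p.Prime) (hr : r.Prime) (hne : p ≠ r) (h1 : p ∣ n) (h2 : r ∣ n) :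
    ¬ IsPrimePow n := by
  intro h
  rw [isPrimePow_nat_iff] at h
  obtain ⟨l, k, hl, _, rfl⟩ := h
  have e1 := (Nat.prime_dvd_prime_iff_eq hp hl).1 (hp.dvd_of_dvd_pow h1)
  have e2 := (Nat.prime_dvd_prime_iff_eq hr hl).1 (hr.dvd_of_dvd_pow h2)
  exact hne (e1.trans e2.symm)

theorem stmt10 (q : ℕ) (hq : IsPrimePow q)
    (h : q ∉ ({2, 3, 4, 5, 7, 9, 11, 16} : Finset ℕ)) :
    memB 3 2 q 5 := by
  rcases Nat.lt_or_ge q 61 with hlt | hge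
  swap
  · exact large_case q hge
  interval_cases q
  · exact absurd hq (not_isPrimePow_zero)
  · exact absurd hq (not_isPrimePow_one)
  · simp at h
  · simp at h
  · simp at h
  · simp at h
  · exact absurd hq (npp_of_two (p := 2) (r := 3) (by norm_num) (by norm_num) (by norm_num) (by norm_num) (by norm_num))
  · simp at h
  · exact small_8
  · simp at h
  · exact absurd hq (npp_of_two (p := 2) (r := 5) (by norm_num) (by norm_num) (by norm_num) (by norm_num) (by norm_num))
  · simp at h
  · exact absurd hq (npp_of_two (p := 2) (r := 3) (by norm_num) (by norm_num) (by norm_num) (by norm_num) (by norm_num))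
  · exact small_13
  · exact absurd hq (npp_of_two (p := 2) (r := 7) (by norm_num) (by norm_num) (by norm_num) (by norm_num) (by norm_num))
  · exact absurd hq (npp_of_two (p := 3) (r := 5) (by norm_num) (by norm_num) (by norm_num) (by norm_num) (by norm_num))
  · simp at h
  · exact small_17
  · exact absurd hq (npp_of_two (p := 2) (r := 3) (by norm_num) (by norm_num) (by norm_num) (by norm_num) (by norm_num))
  · exact small_19
  · exact absurd hq (npp_of_two (p := 2) (r := 5) (by norm_num) (by norm_num) (by norm_num) (by norm_num) (by norm_num))
  · exact absurd hq (npp_of_two (p := 3) (r := 7) (by norm_num) (by norm_num) (by norm_num) (by norm_num) (by norm_num))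
  · exact absurd hq (npp_of_two (p := 2) (r := 11) (by norm_num) (by norm_num) (by norm_num) (by norm_num) (by norm_num))
  · exact small_23
  · exact absurd hq (npp_of_two (p := 2) (r := 3) (by norm_num) (by norm_num) (by norm_num) (by norm_num) (by norm_num))
  · exact small_25
  · exact absurd hq (npp_of_two (p := 2) (r := 13) (by norm_num) (by norm_num) (by norm_num) (by norm_num) (by norm_num))
  · exact small_27
  · exact absurd hq (npp_of_two (p := 2) (r := 7) (by norm_num) (by norm_num) (by norm_num) (by norm_num) (by norm_num))
  · exact small_29
  · exact absurd hq (npp_of_two (p := 2) (r := 3) (by norm_num) (by norm_num) (by norm_num) (by norm_num) (by norm_num))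
  · exact small_31
  · exact small_32
  · exact absurd hq (npp_of_two (p := 3) (r := 11) (by norm_num) (by norm_num) (by norm_num) (by norm_num) (by norm_num))
  · exact absurd hq (npp_of_two (p := 2) (r := 17) (by norm_num) (by norm_num) (by norm_num) (by norm_num) (by norm_num))
  · exact absurd hq (npp_of_two (p := 5) (r := 7) (by norm_num) (by norm_num) (by norm_num) (by norm_num) (by norm_num))
  · exact absurd hq (npp_of_two (p := 2) (r := 3) (by norm_num) (by norm_num) (by norm_num) (by norm_num) (by norm_num))
  · exact small_37
  · exact absurd hq (npp_of_two (p := 2) (r := 19) (by norm_num) (by norm_num) (by norm_num) (by norm_num) (by norm_num))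
  · exact absurd hq (npp_of_two (p := 3) (r := 13) (by norm_num) (by norm_num) (by norm_num) (by norm_num) (by norm_num))
  · exact absurd hq (npp_of_two (p := 2) (r := 5) (by norm_num) (by norm_num) (by norm_num) (by norm_num) (by norm_num))
  · exact small_41
  · exact absurd hq (npp_of_two (p := 2) (r := 3) (by norm_num) (by norm_num) (by norm_num) (by norm_num) (by norm_num))
  · exact small_43
  · exact absurd hq (npp_of_two (p := 2) (r := 11) (by norm_num) (by norm_num) (by norm_num) (by norm_num) (by norm_num))
  · exact absurd hq (npp_of_two (p := 3) (r := 5) (by norm_num) (by norm_num) (by norm_num) (by norm_num) (by norm_num))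
  · exact absurd hq (npp_of_two (p := 2) (r := 23) (by norm_num) (by norm_num) (by norm_num) (by norm_num) (by norm_num))
  · exact small_47
  · exact absurd hq (npp_of_two (p := 2) (r := 3) (by norm_num) (by norm_num) (by norm_num) (by norm_num) (by norm_num))
  · exact small_49
  · exact absurd hq (npp_of_two (p := 2) (r := 5) (by norm_num) (by norm_num) (by norm_num) (by norm_num) (by norm_num))
  · exact absurd hq (npp_of_two (p := 3) (r := 17) (by norm_num) (by norm_num) (by norm_num) (by norm_num) (by norm_num))
  · exact absurd hq (npp_of_two (p := 2) (r := 13) (by norm_num) (by norm_num) (by norm_num) (by norm_num) (by norm_num))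
  · exact small_53
  · exact absurd hq (npp_of_two (p := 2) (r := 3) (by norm_num) (by norm_num) (by norm_num) (by norm_num) (by norm_num))
  · exact absurd hq (npp_of_two (p := 5) (r := 11) (by norm_num) (by norm_num) (by norm_num) (by norm_num) (by norm_num))
  · exact absurd hq (npp_of_two (p := 2) (r := 7) (by norm_num) (by norm_num) (by norm_num) (by norm_num) (by norm_num))
  · exact absurd hq (npp_of_two (p := 3) (r := 19) (by norm_num) (by norm_num) (by norm_num) (by norm_num) (by norm_num))
  · exact absurd hq (npp_of_two (p := 2) (r := 29) (by norm_num) (by norm_num) (by norm_num) (by norm_num) (by norm_num))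
  · exact small_59
  · exact absurd hq (npp_of_two (p := 2) (r := 3) (by norm_num) (by norm_num) (by norm_num) (by norm_num) (by norm_num))
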